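/- Let n ≥ 2 be a natural number. There exist real numbers a > 0 and T > 0 and a positive function U : (−a, a) × [0, T) → ℝ, with continuous partial derivatives ∂ₜU, ∂ₓU, ∂ₓ²U, satisfying the rotationally symmetric mean curvature flow equation ∂ₜU(x,t) = ∂ₓ²U(x,t)/(1 + (∂ₓU(x,t))²) − (n−1)/U(x,t) for all x ∈ (−a, a) and t ∈ [0, T), such that the rescaled function u(y, τ) := e^{τ/2} · U(e^{−τ/2} y, T − e^{−τ}) satisfies, for every L > 0, lim_{τ → ∞} τ · sup_{|y| ≤ L} | u(y, τ) − √(2(n−1)) − (√(2(n−1))/(4τ))·(y² − 2) | = 0. -/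

import Mathlib

open Real Set Filter

/-- First contact principle. -/
theorem neg_of_no_first_contact {X : Type*} [TopologicalSpace X] {K : Set X} (hK : IsCompact K)
    {a b : ℝ} {D : X → ℝ → ℝ}
    (hD : ContinuousOn (fun p : X × ℝ => D p.1 p.2) (K ×ˢ Icc a b))
    (h0 : ∀ x ∈ K, D x a < 0)
    (hc : ∀ t ∈ Ioc a b, ∀ x ∈ K, D x t = 0 →
      (∀ s ∈ Ico a t, ∀ y ∈ K, D y s < 0) → (∀ y ∈ K, D y t ≤ 0) → False) :
    ∀ t ∈ Icc a b, ∀ x ∈ K, D x t < 0 := by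
  by_contra! hcon
  obtain ⟨t₀, ht₀, x₀, hx₀, hpos⟩ := hcon
  have hcomp : IsCompact (K ×ˢ Icc a b) := hK.prod isCompact_Icc
  let S : Set (X × ℝ) := (K ×ˢ Icc a b) ∩ (fun p : X × ℝ => D p.1 p.2) ⁻¹' Ici 0
  have hT : IsCompact (Prod.snd '' S) := by
    have : IsCompact S := by
      have hrs : IsCompact (Prod.snd '' (K ×ˢ Icc a b)) := hcomp.image continuous_snd
      obtain ⟨u, hu, hu'⟩ := (continuousOn_iff_isClosed.1 hD) (Ici 0) isClosed_Ici
      have : S = (K ×ˢ Icc a b) ∩ u := by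
        rw [inter_comm, ← hu', inter_comm]
      rw [this]
      exact hcomp.inter_right hu
    exact this.image continuous_snd
  have hne : (Prod.snd '' S).Nonempty := ⟨t₀, (x₀, t₀), ⟨⟨hx₀, ht₀⟩, hpos⟩, rfl⟩
  obtain ⟨t, ⟨⟨⟨x, t'⟩, hxS, rfl⟩, hmin⟩⟩ := hT.exists_isLeast hne
  have hx : x ∈ K := hxS.1.1
  have ht : t' ∈ Icc a b := hxS.1.2
  have hDx : 0 ≤ D x t' := hxS.2
  have hbefore : ∀ s ∈ Ico a t', ∀ y ∈ K, D y s < 0 := by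
    intro s hs y hy
    by_contra! hge
    exact absurd (hmin ⟨(y, s), ⟨⟨hy, hs.1, hs.2.le.trans ht.2⟩, hge⟩, rfl⟩) (not_le.2 hs.2)
  have hat : a < t' := lt_of_le_of_ne ht.1 (by
    rintro rfl
    exact absurd (h0 x hx) (not_lt.2 hDx))
  have hle : ∀ y ∈ K, D y t' ≤ 0 := by
    intro y hy
    have hcont : ContinuousWithinAt (fun s => D y s) (Icc a b) t' :=
      (hD (y, t') ⟨hy, ht⟩).comp (f := fun s : ℝ => (y, s)) (by fun_prop) (fun s hs => ⟨hy, hs⟩)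
    have hmem : t' ∈ closure (Ico a t') := by
      rw [closure_Ico hat.ne]; exact ⟨hat.le, le_rfl⟩
    have hnb : (nhdsWithin t' (Ico a t')).NeBot := mem_closure_iff_nhdsWithin_neBot.1 hmem
    have := hcont.mono (show Ico a t' ⊆ Icc a b from fun s hs => ⟨hs.1, hs.2.le.trans ht.2⟩)
    refine le_of_tendsto this ?_
    filter_upwards [self_mem_nhdsWithin] with s hs using (hbefore s hs y hy).le
  exact hc t' ⟨hat, ht.2⟩ x hx (le_antisymm (hle x hx) hDx) hbefore hle

/-- At a time of first contact the time derivative is nonnegative. -/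
theorem deriv_nonneg_of_first_contact {f : ℝ → ℝ} {a t f' : ℝ} (hat : a < t)
    (hf : HasDerivAt f f' t) (h0 : f t = 0) (hneg : ∀ s ∈ Ico a t, f s < 0) : 0 ≤ f' := by
  have h : HasDerivWithinAt f f' (Iio t) t := hf.hasDerivWithinAt
  rw [hasDerivWithinAt_iff_tendsto_slope' (by simp)] at h
  refine ge_of_tendsto h ?_
  filter_upwards [Ico_mem_nhdsLT hat] with s hs
  rw [slope_def_field, h0]
  exact div_nonneg_of_nonpos (by linarith [hneg s hs]) (by linarith [hs.2])

/-- A linear differential inequality bounds a function exponentially. -/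
theorem le_exp_of_deriv_le {f f' : ℝ → ℝ} {k T : ℝ}
    (hf : ∀ t ∈ Icc 0 T, HasDerivAt f (f' t) t) (hle : ∀ t ∈ Ioo 0 T, f' t ≤ k * f t) :
    ∀ t ∈ Icc 0 T, f t ≤ f 0 * exp (k * t) := by
  intro t ht
  have hd : ∀ s ∈ Icc 0 T, HasDerivAt (fun s => f s * exp (-(k * s)))
      (f' s * exp (-(k * s)) + f s * (exp (-(k * s)) * (-(k * 1)))) s := fun s hs =>
    (hf s hs).mul (((hasDerivAt_id s).const_mul k).neg.exp)
  have hanti : AntitoneOn (fun s => f s * exp (-(k * s))) (Icc 0 T) := by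
    refine antitoneOn_of_deriv_nonpos (convex_Icc 0 T)
      (fun s hs => (hd s hs).continuousAt.continuousWithinAt)
      (fun s hs => (hd s (interior_subset hs)).differentiableAt.differentiableWithinAt) ?_
    intro s hs
    rw [interior_Icc] at hs
    rw [(hd s (Ioo_subset_Icc_self hs)).deriv]
    have := hle s hs
    have hp := exp_pos (-(k * s))
    nlinarith
  have h := hanti ⟨le_rfl, ht.1.trans ht.2⟩ ht ht.1
  simp only [mul_zero, neg_zero, exp_zero, mul_one] at h
  rw [exp_neg, ← div_eq_mul_inv, div_le_iff₀ (exp_pos _)] at h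
  exact h

/-- A function with derivative at most `k` grows at most linearly. -/
theorem le_add_mul_of_deriv_le {f f' : ℝ → ℝ} {k a b : ℝ} (hab : a ≤ b)
    (hf : ∀ t ∈ Icc a b, HasDerivAt f (f' t) t) (hle : ∀ t ∈ Ioo a b, f' t ≤ k) :
    f b ≤ f a + k * (b - a) := by
  have hanti : AntitoneOn (fun s => f s - k * s) (Icc a b) := by
    have hd : ∀ s ∈ Icc a b, HasDerivAt (fun s => f s - k * s) (f' s - k * 1) s := fun s hs =>
      (hf s hs).sub ((hasDerivAt_id s).const_mul k)
    refine antitoneOn_of_deriv_nonpos (convex_Icc a b)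
      (fun s hs => (hd s hs).continuousAt.continuousWithinAt)
      (fun s hs => (hd s (interior_subset hs)).differentiableAt.differentiableWithinAt) ?_
    intro s hs
    rw [interior_Icc] at hs
    rw [(hd s (Ioo_subset_Icc_self hs)).deriv]
    linarith [hle s hs]
  have h := hanti ⟨le_rfl, hab⟩ ⟨hab, le_rfl⟩ hab
  simp only at h
  linarith

/-- Maximum principle for a finite family of functions. -/
theorem finite_max_principle {N : ℕ} {φ φ' : ℕ → ℝ → ℝ} {k B T : ℝ} (hB : 0 ≤ B)
    (hφ : ∀ i < N, ∀ t ∈ Icc 0 T, HasDerivAt (φ i) (φ' i t) t)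
    (h0 : ∀ i < N, φ i 0 ≤ B)
    (hmax : ∀ i < N, ∀ t ∈ Icc 0 T, 0 < φ i t → (∀ j < N, φ j t ≤ φ i t) →
      φ' i t ≤ k * φ i t) :
    ∀ i < N, ∀ t ∈ Icc 0 T, φ i t ≤ B * exp (k * t) := by
  intro i hi t ht
  refine le_of_forall_pos_le_add fun ε hε => ?_
  -- the barrier is `(B + η (1 + t)) exp (k t)`
  set η : ℝ := ε / ((1 + T) * exp (k * t)) with hη
  have hT : 0 ≤ T := ht.1.trans ht.2
  have hηpos : 0 < η := by positivity
  have key := neg_of_no_first_contact (X := ℕ) (K := {j | j < N}) (a := 0) (b := T)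
    (D := fun j s => φ j s - (B + η * (1 + s)) * exp (k * s))
    ((Set.finite_lt_nat N).isCompact) ?_ ?_ ?_ t ht i hi
  · have h1 : η * (1 + t) * exp (k * t) ≤ ε := by
      have : η * ((1 + T) * exp (k * t)) = ε := by rw [hη]; field_simp
      rw [← this, ← mul_assoc]
      gcongr
      exact ht.2
    nlinarith
  · refine (continuousOn_prod_of_discrete_left).2 fun j => ?_
    intro s hs
    have hs' : j < N ∧ s ∈ Icc 0 T := by simpa using hs
    have h1 : ContinuousAt (φ j) s := (hφ j hs'.1 s hs'.2).continuousAt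
    exact ((h1.sub (by fun_prop))).continuousWithinAt
  · intro j hj
    have := h0 j hj
    simp; linarith
  · intro s hs j hj hz hbef hle
    have hs' : s ∈ Icc 0 T := Ioc_subset_Icc_self hs
    have hpe := exp_pos (k * s)
    have hval : φ j s = (B + η * (1 + s)) * exp (k * s) := by linarith
    have hpos : 0 < φ j s := by
      rw [hval]
      have : 0 < η * (1 + s) := mul_pos hηpos (by linarith [hs.1])
      positivity
    have hd : HasDerivAt (fun s => φ j s - (B + η * (1 + s)) * exp (k * s))
        (φ' j s - ((η * 1) * exp (k * s) + (B + η * (1 + s)) * (exp (k * s) * (k * 1)))) s :=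
      (hφ j hj s hs').sub ((((((hasDerivAt_id s).const_add 1).const_mul η).const_add B)).mul
        ((hasDerivAt_id s).const_mul k).exp)
    have h1 := deriv_nonneg_of_first_contact hs.1 hd hz (fun r hr => hbef r hr j hj)
    have h2 := hmax j hj s hs' hpos (fun l hl => by
      have := hle l hl
      linarith)
    rw [hval] at h2
    have : 0 < η * exp (k * s) := by positivity
    nlinarith

/-- Difference quotients at the edges of a grid with `N` cells of width `h`; the value is `0` at
the left end and `c` at the right end. -/
noncomputable def edge (N : ℕ) (h c : ℝ) (φ : ℕ → ℝ) : ℕ → ℝ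
  | 0 => 0
  | i + 1 => if i + 1 < N then (φ (i + 1) - φ i) / h else c

@[simp] theorem edge_zero (N : ℕ) (h c : ℝ) (φ : ℕ → ℝ) : edge N h c φ 0 = 0 := rfl

theorem edge_succ {N : ℕ} (h c : ℝ) (φ : ℕ → ℝ) {i : ℕ} (hi : i + 1 < N) :
    edge N h c φ (i + 1) = (φ (i + 1) - φ i) / h := by
  simp [edge, hi]

theorem edge_of_le {N : ℕ} (hN : 0 < N) (h c : ℝ) (φ : ℕ → ℝ) {i : ℕ} (hi : N ≤ i) :
    edge N h c φ i = c := by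
  obtain ⟨i, rfl⟩ : ∃ j, i = j + 1 := ⟨i - 1, by omega⟩
  simp [edge, Nat.not_lt.2 hi]

theorem hasDerivAt_edge {N : ℕ} (h c : ℝ) {φ φ' : ℕ → ℝ → ℝ} {t : ℝ}
    (hφ : ∀ i < N, HasDerivAt (φ i) (φ' i t) t) (i : ℕ) :
    HasDerivAt (fun s => edge N h c (fun j => φ j s) i) (edge N h 0 (fun j => φ' j t) i) t := by
  rcases i with _ | i
  · simpa using hasDerivAt_const t (0 : ℝ)
  · by_cases hi : i + 1 < N
    · simp only [edge_succ h _ _ hi]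
      exact ((hφ _ hi).sub (hφ i (by omega))).div_const h
    · simp only [edge, hi, if_false]
      exact hasDerivAt_const t c

/-- Summation by parts with vanishing boundary flux. -/
theorem sum_by_parts_edge {N : ℕ} {h c : ℝ} (hh : h ≠ 0) {F : ℕ → ℝ} (φ : ℕ → ℝ)
    (h0 : F 0 = 0) (hN : F N = 0) :
    ∑ i ∈ Finset.range N, (F (i + 1) - F i) / h * φ i
      = -∑ i ∈ Finset.range N, F i * edge N h c φ i := by
  have key : ∀ M, M + 1 ≤ N → ∑ i ∈ Finset.range (M + 1), (F (i + 1) - F i) / h * φ i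
      = F (M + 1) * φ M / h - ∑ i ∈ Finset.range (M + 1), F i * edge N h c φ i := by
    intro M
    induction M with
    | zero => intro _; simp [h0]; ring
    | succ M ih =>
      intro hM
      rw [Finset.sum_range_succ, ih (by omega), Finset.sum_range_succ _ (M + 1),
        edge_succ h c φ (by omega)]
      field_simp
      ring
  rcases N with _ | N
  · simp
  · rw [key N le_rfl, hN]; simp

theorem sum_range_diff_le {N : ℕ} {ψ : ℕ → ℝ} (hψ : ∀ i, 0 ≤ ψ i) {i j : ℕ} (hj : j ≤ N) :
    ∑ l ∈ Finset.Ico i j, ψ l ≤ ∑ l ∈ Finset.range N, ψ l := by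
  refine Finset.sum_le_sum_of_subset_of_nonneg ?_ fun l _ _ => hψ l
  intro l hl
  simp only [Finset.mem_Ico, Finset.mem_range] at *
  omega

/-- Square-integrable differences give a Hölder bound with exponent one half. -/
theorem abs_sub_le_sqrt_of_sum_sq {N : ℕ} {h S : ℝ} (hh : 0 < h) {φ ψ : ℕ → ℝ}
    (hS : h * ∑ l ∈ Finset.range N, ψ l ^ 2 ≤ S)
    {i j : ℕ} (hij : i ≤ j) (hj : j ≤ N) (hd : ∀ l, i ≤ l → l < j → |φ (l + 1) - φ l| ≤ h * |ψ l|) :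
    |φ j - φ i| ≤ √(((j : ℝ) - i) * h) * √S := by
  have htel : φ j - φ i = ∑ l ∈ Finset.Ico i j, (φ (l + 1) - φ l) :=
    (Finset.sum_Ico_sub φ hij).symm
  have h1 : |φ j - φ i| ≤ ∑ l ∈ Finset.Ico i j, h * |ψ l| := by
    rw [htel]
    refine (Finset.abs_sum_le_sum_abs _ _).trans (Finset.sum_le_sum fun l hl => ?_)
    rw [Finset.mem_Ico] at hl
    exact hd l hl.1 hl.2
  have h2 : (∑ l ∈ Finset.Ico i j, h * |ψ l|) ^ 2 ≤ (((j : ℝ) - i) * h) * S := by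
    have hcs := sq_sum_le_card_mul_sum_sq (s := Finset.Ico i j) (f := fun l => h * |ψ l|)
    rw [Nat.card_Ico, Nat.cast_sub hij] at hcs
    refine hcs.trans ?_
    have h3 : ∑ l ∈ Finset.Ico i j, (h * |ψ l|) ^ 2 = h * (h * ∑ l ∈ Finset.Ico i j, ψ l ^ 2) := by
      rw [Finset.mul_sum, Finset.mul_sum]
      refine Finset.sum_congr rfl fun l _ => ?_
      rw [mul_pow, sq_abs]; ring
    have h4 := sum_range_diff_le (ψ := fun l => ψ l ^ 2) (fun l => sq_nonneg _) (i := i) hj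
    have h5 : (0 : ℝ) ≤ (j : ℝ) - i := by
      have : (i : ℝ) ≤ j := by exact_mod_cast hij
      linarith
    rw [h3]
    calc ((j : ℝ) - i) * (h * (h * ∑ l ∈ Finset.Ico i j, ψ l ^ 2))
        ≤ ((j : ℝ) - i) * (h * S) := by
          gcongr
          exact (mul_le_mul_of_nonneg_left h4 hh.le).trans hS
      _ = _ := by ring
  refine h1.trans ?_
  have hS0 : 0 ≤ S := le_trans (by positivity) hS
  rw [← sqrt_mul' _ hS0]
  exact le_sqrt_of_sq_le h2

/-- Telescoping with nearly constant increments. -/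
theorem abs_sub_sub_mul_le {h ε P : ℝ} (hh : 0 ≤ h) {φ χ : ℕ → ℝ} {i j : ℕ} (hij : i ≤ j)
    (hd : ∀ l, i ≤ l → l < j → φ (l + 1) - φ l = h * χ l)
    (hχ : ∀ l, i ≤ l → l < j → |χ l - P| ≤ ε) :
    |φ j - φ i - ((j : ℝ) - i) * h * P| ≤ ((j : ℝ) - i) * h * ε := by
  induction j, hij using Nat.le_induction with
  | base => simp
  | succ j hij ih =>
    have h1 := ih (fun l h1 h2 => hd l h1 (by omega)) (fun l h1 h2 => hχ l h1 (by omega))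
    have h2 := hd j hij (by omega)
    have h3 := hχ j hij (by omega)
    have h4 : |h * (χ j - P)| ≤ h * ε := by
      rw [abs_mul, abs_of_nonneg hh]; gcongr
    have h5 : φ (j + 1) - φ i - (((j + 1 : ℕ) : ℝ) - i) * h * P
        = (φ j - φ i - ((j : ℝ) - i) * h * P) + h * (χ j - P) := by
      push_cast; linear_combination h2
    rw [h5]
    refine (abs_add_le _ _).trans ?_
    push_cast
    linarith

/-- The first order Taylor remainder on a grid of width `h` is of order `3 / 2`. -/
def GridTaylor (N : ℕ) (h C : ℝ) (φ ψ : ℕ → ℝ) : Prop :=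
  ∀ i < N, ∀ j < N, |φ j - φ i - ((j : ℝ) - i) * h * ψ i| ≤
    C * √(|(j : ℝ) - i| * h) * (|(j : ℝ) - i| * h)

theorem gridTaylor_of_forward {N : ℕ} {h C : ℝ} (hh : 0 < h) (hC : 0 ≤ C) {φ ψ : ℕ → ℝ}
    (hd : ∀ l, l + 1 < N → φ (l + 1) - φ l = h * ψ (l + 1) ∨ φ (l + 1) - φ l = h * ψ l)
    (hψ : ∀ i j, i ≤ j → j < N → |ψ j - ψ i| ≤ C * √(((j : ℝ) - i) * h)) :
    GridTaylor N h C φ ψ := by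
  have hψ' : ∀ i < N, ∀ j < N, |ψ j - ψ i| ≤ C * √(|(j : ℝ) - i| * h) := by
    intro i hi j hj
    rcases le_total i j with hij | hij
    · have : (i : ℝ) ≤ j := by exact_mod_cast hij
      rw [abs_of_nonneg (a := (j : ℝ) - i) (by linarith)]
      exact hψ i j hij hj
    · have : (j : ℝ) ≤ i := by exact_mod_cast hij
      rw [abs_sub_comm (j : ℝ), abs_sub_comm, abs_of_nonneg (a := (i : ℝ) - j) (by linarith)]
      exact hψ j i hij hi
  have hmono : ∀ i l j : ℕ, |(l : ℝ) - i| ≤ |(j : ℝ) - i| →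
      C * √(|(l : ℝ) - i| * h) ≤ C * √(|(j : ℝ) - i| * h) := fun i l j hl => by gcongr
  choose! χ hχ using fun l (hl : l + 1 < N) => (show ∃ χ : ℕ, (χ = l ∨ χ = l + 1) ∧
      φ (l + 1) - φ l = h * ψ χ by
    rcases hd l hl with h | h
    · exact ⟨l + 1, Or.inr rfl, h⟩
    · exact ⟨l, Or.inl rfl, h⟩)
  intro i hi j hj
  rcases le_total i j with hij | hij
  · have hij' : (i : ℝ) ≤ j := by exact_mod_cast hij
    have := abs_sub_sub_mul_le (P := ψ i) (ε := C * √(|(j : ℝ) - i| * h)) hh.le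
      (χ := fun l => ψ (χ l)) hij (fun l h1 h2 => (hχ l (by omega)).2) (fun l h1 h2 => by
        have hl := (hχ l (by omega)).1
        refine (hψ' i hi (χ l) (by omega)).trans (hmono _ _ _ ?_)
        have e1 : (i : ℝ) ≤ χ l := by exact_mod_cast (show i ≤ χ l by omega)
        have e2 : (χ l : ℝ) ≤ j := by exact_mod_cast (show χ l ≤ j by omega)
        rw [abs_of_nonneg (by linarith), abs_of_nonneg (by linarith)]
        linarith)
    refine this.trans (le_of_eq ?_)
    rw [abs_of_nonneg (a := (j : ℝ) - i) (by linarith)]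
    ring
  · have hij' : (j : ℝ) ≤ i := by exact_mod_cast hij
    have := abs_sub_sub_mul_le (P := ψ i) (ε := C * √(|(j : ℝ) - i| * h)) hh.le
      (χ := fun l => ψ (χ l)) hij (fun l h1 h2 => (hχ l (by omega)).2) (fun l h1 h2 => by
        have hl := (hχ l (by omega)).1
        refine (hψ' i hi (χ l) (by omega)).trans (hmono _ _ _ ?_)
        have e1 : (j : ℝ) ≤ χ l := by exact_mod_cast (show j ≤ χ l by omega)
        have e2 : (χ l : ℝ) ≤ i := by exact_mod_cast (show χ l ≤ i by omega)
        rw [abs_of_nonpos (by linarith), abs_of_nonpos (by linarith)]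
        linarith)
    have e : φ j - φ i - ((j : ℝ) - i) * h * ψ i = -(φ i - φ j - ((i : ℝ) - j) * h * ψ i) := by
      ring
    rw [e, abs_neg]
    refine this.trans (le_of_eq ?_)
    rw [abs_of_nonpos (a := (j : ℝ) - i) (by linarith)]
    ring

section Lattice

variable (m c h : ℝ) (N : ℕ) (U : ℕ → ℝ → ℝ)

/-- Discrete slope. -/
noncomputable def latW (i : ℕ) (t : ℝ) : ℝ := edge N h c (fun j => U j t) i

/-- Discrete velocity. -/
noncomputable def latG (i : ℕ) (t : ℝ) : ℝ :=
  (arctan (latW c h N U (i + 1) t) - arctan (latW c h N U i t)) / h - m / U i t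

/-- Discrete slope of the velocity. -/
noncomputable def latDG (i : ℕ) (t : ℝ) : ℝ := edge N h 0 (fun j => latG m c h N U j t) i

/-- Time derivative of the flux. -/
noncomputable def latF (i : ℕ) (t : ℝ) : ℝ :=
  latDG m c h N U i t / (1 + latW c h N U i t ^ 2)

/-- Discrete acceleration. -/
noncomputable def latA (i : ℕ) (t : ℝ) : ℝ :=
  (latF m c h N U (i + 1) t - latF m c h N U i t) / h + m * latG m c h N U i t / U i t ^ 2

/-- Discrete slope of the acceleration. -/
noncomputable def latDA (i : ℕ) (t : ℝ) : ℝ := edge N h 0 (fun j => latA m c h N U j t) i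

/-- Second time derivative of the flux. -/
noncomputable def latF' (i : ℕ) (t : ℝ) : ℝ :=
  latDA m c h N U i t / (1 + latW c h N U i t ^ 2)
    - 2 * latW c h N U i t * latDG m c h N U i t ^ 2 / (1 + latW c h N U i t ^ 2) ^ 2

/-- A solution of the spatially discretised mean curvature flow which stays above `δ`. -/
structure LatticeFlow (δ T : ℝ) : Prop where
  hm : 0 < m
  hN : 0 < N
  hh : 0 < h
  hδ : 0 < δ
  pos : ∀ i < N, ∀ t ∈ Icc 0 T, δ ≤ U i t
  der : ∀ i < N, ∀ t ∈ Icc 0 T, HasDerivAt (U i) (latG m c h N U i t) t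

end Lattice

namespace LatticeFlow

variable {m c h δ T : ℝ} {N : ℕ} {U : ℕ → ℝ → ℝ} (H : LatticeFlow m c h N U δ T)
include H

theorem hasDerivAt_w {t : ℝ} (ht : t ∈ Icc 0 T) (i : ℕ) :
    HasDerivAt (latW c h N U i) (latDG m c h N U i t) t :=
  hasDerivAt_edge h c (fun i hi => H.der i hi t ht) i

theorem hasDerivAt_arctan_w {t : ℝ} (ht : t ∈ Icc 0 T) (i : ℕ) :
    HasDerivAt (fun s => arctan (latW c h N U i s)) (latF m c h N U i t) t := by
  have := (H.hasDerivAt_w ht i).arctan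
  convert this using 1
  rw [latF]; ring

theorem U_pos {t : ℝ} (ht : t ∈ Icc 0 T) {i : ℕ} (hi : i < N) : 0 < U i t :=
  H.hδ.trans_le (H.pos i hi t ht)

theorem hasDerivAt_g {t : ℝ} (ht : t ∈ Icc 0 T) {i : ℕ} (hi : i < N) :
    HasDerivAt (latG m c h N U i) (latA m c h N U i t) t := by
  have hU := (H.U_pos ht hi).ne'
  have := (((H.hasDerivAt_arctan_w ht (i + 1)).sub (H.hasDerivAt_arctan_w ht i)).div_const h).sub
    ((H.der i hi t ht).fun_inv hU |>.const_mul m)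
  refine this.congr_deriv ?_
  rw [latA]; ring

theorem hasDerivAt_dg {t : ℝ} (ht : t ∈ Icc 0 T) (i : ℕ) :
    HasDerivAt (latDG m c h N U i) (latDA m c h N U i t) t :=
  hasDerivAt_edge h 0 (fun _ hi => H.hasDerivAt_g ht hi) i

theorem hasDerivAt_F {t : ℝ} (ht : t ∈ Icc 0 T) (i : ℕ) :
    HasDerivAt (latF m c h N U i) (latF' m c h N U i t) t := by
  have h1 : (1 + latW c h N U i t ^ 2) ≠ 0 := by positivity
  have := (H.hasDerivAt_dg ht i).div (((H.hasDerivAt_w ht i).pow 2).const_add 1) h1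
  refine this.congr_deriv ?_
  rw [latF']
  simp only [Pi.pow_apply]
  field_simp
  ring

theorem hasDerivAt_A {t : ℝ} (ht : t ∈ Icc 0 T) {i : ℕ} (hi : i < N) :
    HasDerivAt (latA m c h N U i) ((latF' m c h N U (i + 1) t - latF' m c h N U i t) / h
      + (m * latA m c h N U i t / U i t ^ 2 - 2 * m * latG m c h N U i t ^ 2 / U i t ^ 3)) t := by
  have hU := (H.U_pos ht hi).ne'
  have := (((H.hasDerivAt_F ht (i + 1)).sub (H.hasDerivAt_F ht i)).div_const h).add
    (((H.hasDerivAt_g ht hi).const_mul m).div ((H.der i hi t ht).pow 2) (pow_ne_zero 2 hU))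
  refine this.congr_deriv ?_
  simp only [Pi.pow_apply]
  field_simp
  ring

omit H in
theorem dg_zero (t : ℝ) : latDG m c h N U 0 t = 0 := rfl

theorem dg_N {i : ℕ} (hi : N ≤ i) (t : ℝ) : latDG m c h N U i t = 0 := edge_of_le H.hN _ _ _ hi

omit H in
theorem F_zero (t : ℝ) : latF m c h N U 0 t = 0 := by simp [latF, dg_zero]

theorem F_N (t : ℝ) : latF m c h N U N t = 0 := by simp [latF, H.dg_N le_rfl]

omit H in
theorem F'_zero (t : ℝ) : latF' m c h N U 0 t = 0 := by
  simp [latF', dg_zero, latDA]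

theorem F'_N (t : ℝ) : latF' m c h N U N t = 0 := by
  simp [latF', H.dg_N le_rfl, latDA, edge_of_le H.hN h 0 _ le_rfl]

theorem w_N {i : ℕ} (hi : N ≤ i) (t : ℝ) : latW c h N U i t = c := edge_of_le H.hN _ _ _ hi

theorem U_succ_sub {i : ℕ} (hi : i + 1 < N) (t : ℝ) :
    U (i + 1) t - U i t = h * latW c h N U (i + 1) t := by
  rw [latW, edge_succ h c _ hi]
  have := H.hh.ne'
  field_simp

theorem g_succ_sub {i : ℕ} (hi : i + 1 < N) (t : ℝ) :
    latG m c h N U (i + 1) t - latG m c h N U i t = h * latDG m c h N U (i + 1) t := by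
  rw [latDG, edge_succ h 0 _ hi]
  have := H.hh.ne'
  field_simp

theorem arctan_succ_sub (i : ℕ) (t : ℝ) :
    arctan (latW c h N U (i + 1) t) - arctan (latW c h N U i t)
      = h * (latG m c h N U i t + m / U i t) := by
  rw [latG]
  have := H.hh.ne'
  field_simp
  ring

theorem F_succ_sub (i : ℕ) (t : ℝ) :
    latF m c h N U (i + 1) t - latF m c h N U i t
      = h * (latA m c h N U i t - m * latG m c h N U i t / U i t ^ 2) := by
  rw [latA]
  have := H.hh.ne'
  field_simp
  ring

/-- The velocity is controlled by its initial values. -/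
theorem abs_g_le {B : ℝ} (hB : 0 ≤ B) (h0 : ∀ i < N, |latG m c h N U i 0| ≤ B) :
    ∀ i < N, ∀ t ∈ Icc 0 T, |latG m c h N U i t| ≤ B * exp (m / δ ^ 2 * t) := by
  have hh := H.hh
  -- at a positive maximum (resp. negative minimum) the flux differences have a sign
  have key : ∀ σ : ℝ, σ = 1 ∨ σ = -1 →
      ∀ i < N, ∀ t ∈ Icc 0 T, σ * latG m c h N U i t ≤ B * exp (m / δ ^ 2 * t) := by
    intro σ hσ
    have hσ1 : |σ| = 1 := by rcases hσ with rfl | rfl <;> simp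
    refine finite_max_principle (φ' := fun i t => σ * latA m c h N U i t) hB
      (fun i hi t ht => (H.hasDerivAt_g ht hi).const_mul σ) (fun i hi => ?_) ?_
    · refine (le_abs_self _).trans ?_
      rw [abs_mul, hσ1, one_mul]; exact h0 i hi
    · intro i hi t ht hpos hmax
      have hdown : 0 ≤ σ * latDG m c h N U i t := by
        rcases i with _ | i
        · simp [dg_zero]
        · have h1 := H.g_succ_sub hi t
          have h2 := hmax i (by omega)
          by_contra! hneg
          have h3 : σ * (latG m c h N U (i + 1) t - latG m c h N U i t)
              = h * (σ * latDG m c h N U (i + 1) t) := by rw [h1]; ring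
          linarith [mul_neg_of_pos_of_neg hh hneg]
      have hup : σ * latDG m c h N U (i + 1) t ≤ 0 := by
        rcases Nat.lt_or_ge (i + 1) N with hi' | hi'
        · have h1 := H.g_succ_sub hi' t
          have h2 := hmax (i + 1) hi'
          by_contra! hneg
          have h3 : σ * (latG m c h N U (i + 1) t - latG m c h N U i t)
              = h * (σ * latDG m c h N U (i + 1) t) := by rw [h1]; ring
          linarith [mul_pos hh hneg]
        · rw [H.dg_N hi']; simp
      have hF1 : σ * latF m c h N U (i + 1) t ≤ 0 := by
        rw [latF, ← mul_div_assoc]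
        exact div_nonpos_of_nonpos_of_nonneg hup (by positivity)
      have hF2 : 0 ≤ σ * latF m c h N U i t := by
        rw [latF, ← mul_div_assoc]
        exact div_nonneg hdown (by positivity)
      have hU := H.U_pos ht hi
      have hδU : δ ^ 2 ≤ U i t ^ 2 := by
        have := H.pos i hi t ht
        have := H.hδ
        gcongr
      have e : σ * latA m c h N U i t = (σ * latF m c h N U (i + 1) t - σ * latF m c h N U i t) / h
          + m / U i t ^ 2 * (σ * latG m c h N U i t) := by
        rw [latA]; ring
      rw [e]
      have e1 : (σ * latF m c h N U (i + 1) t - σ * latF m c h N U i t) / h ≤ 0 :=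
        div_nonpos_of_nonpos_of_nonneg (by linarith) hh.le
      have e2 : m / U i t ^ 2 * (σ * latG m c h N U i t)
          ≤ m / δ ^ 2 * (σ * latG m c h N U i t) := by
        have := H.hδ
        have := H.hm
        gcongr
      linarith
  intro i hi t ht
  refine abs_le.2 ⟨?_, ?_⟩
  · have := key (-1) (Or.inr rfl) i hi t ht; linarith
  · have := key 1 (Or.inl rfl) i hi t ht; linarith

/-- The slope is controlled by its initial values. -/
theorem abs_w_le {B : ℝ} (hB : 0 ≤ B) (hc : |c| ≤ B) (h0 : ∀ i < N, |latW c h N U i 0| ≤ B) :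
    ∀ i, ∀ t ∈ Icc 0 T, |latW c h N U i t| ≤ B * exp (m / δ ^ 2 * t) := by
  have hh := H.hh
  have hk : 0 ≤ m / δ ^ 2 := by have := H.hδ; have := H.hm; positivity
  have key : ∀ σ : ℝ, σ = 1 ∨ σ = -1 →
      ∀ i < N + 1, ∀ t ∈ Icc 0 T, σ * latW c h N U i t ≤ B * exp (m / δ ^ 2 * t) := by
    intro σ hσ
    have hσ1 : |σ| = 1 := by rcases hσ with rfl | rfl <;> simp
    have hσ2 : σ * σ = 1 := by rcases hσ with rfl | rfl <;> simp
    have hb : ∀ x, |x| ≤ B → σ * x ≤ B := fun x hx => by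
      refine (le_abs_self _).trans ?_
      rw [abs_mul, hσ1, one_mul]; exact hx
    refine finite_max_principle (φ' := fun i t => σ * latDG m c h N U i t) hB
      (fun i hi t ht => (H.hasDerivAt_w ht i).const_mul σ) (fun i hi => hb _ ?_) ?_
    · rcases Nat.lt_succ_iff_lt_or_eq.1 hi with hi | rfl
      · exact h0 i hi
      · rw [H.w_N le_rfl]; exact hc
    · intro i hi t ht hpos hmax
      rcases i with _ | i
      · simp [latW] at hpos
      rcases Nat.lt_or_ge (i + 1) N with hi' | hi'
      swap
      · rw [H.dg_N hi', mul_zero]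
        positivity
      have hat : ∀ x y : ℝ, σ * x ≤ σ * y → σ * arctan x ≤ σ * arctan y := by
        intro x y hxy
        rcases hσ with rfl | rfl
        · simpa using arctan_mono (by simpa using hxy)
        · simpa using arctan_mono (by simpa using hxy)
      have h1 := hat _ _ (hmax i (by omega))
      have h2 := hat _ _ (hmax (i + 2) (by omega))
      have hU := H.U_pos ht hi'
      have hU' := H.U_pos ht (show i < N by omega)
      have e : σ * latDG m c h N U (i + 1) t
          = ((σ * arctan (latW c h N U (i + 2) t) - σ * arctan (latW c h N U (i + 1) t))
            - (σ * arctan (latW c h N U (i + 1) t) - σ * arctan (latW c h N U i t))) / h ^ 2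
            + m / (U i t * U (i + 1) t) * (σ * latW c h N U (i + 1) t) := by
        have hs := H.U_succ_sub hi' t
        have hw : latW c h N U (i + 1) t = (U (i + 1) t - U i t) / h := by
          rw [hs]; field_simp
        rw [latDG, edge_succ h 0 _ hi', latG, latG]
        have hw' : m / (U i t * U (i + 1) t) * (σ * latW c h N U (i + 1) t)
            = σ * (m / U i t - m / U (i + 1) t) / h := by
          rw [hw]; field_simp
        rw [hw']
        field_simp
        ring
      rw [e]
      have e1 : ((σ * arctan (latW c h N U (i + 2) t) - σ * arctan (latW c h N U (i + 1) t))
            - (σ * arctan (latW c h N U (i + 1) t) - σ * arctan (latW c h N U i t))) / h ^ 2 ≤ 0 :=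
        div_nonpos_of_nonpos_of_nonneg (by linarith) (by positivity)
      have e2 : m / (U i t * U (i + 1) t) * (σ * latW c h N U (i + 1) t)
          ≤ m / δ ^ 2 * (σ * latW c h N U (i + 1) t) := by
        have hδU : δ ^ 2 ≤ U i t * U (i + 1) t := by
          have := H.pos i (by omega) t ht
          have := H.pos (i + 1) hi' t ht
          have := H.hδ
          rw [pow_two]
          gcongr
        have := H.hδ
        have := H.hm
        gcongr
      linarith
  intro i t ht
  rcases Nat.lt_or_ge i (N + 1) with hi | hi
  · refine abs_le.2 ⟨?_, ?_⟩
    · have := key (-1) (Or.inr rfl) i hi t ht; linarith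
    · have := key 1 (Or.inl rfl) i hi t ht; linarith
  · rw [H.w_N (by omega)]
    refine hc.trans (le_mul_of_one_le_right hB (one_le_exp ?_))
    have := ht.1
    positivity

end LatticeFlow

section Energies

variable (m c h : ℝ) (N : ℕ) (U : ℕ → ℝ → ℝ)

/-- Half the squared norm of the velocity. -/
noncomputable def latJ (t : ℝ) : ℝ := h * ∑ i ∈ Finset.range N, latG m c h N U i t ^ 2 / 2

/-- Half the weighted squared norm of the slope of the velocity. -/
noncomputable def latE (t : ℝ) : ℝ :=
  h * ∑ i ∈ Finset.range N, latF m c h N U i t * latDG m c h N U i t / 2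

/-- The squared norm of the acceleration. -/
noncomputable def latS (t : ℝ) : ℝ := h * ∑ i ∈ Finset.range N, latA m c h N U i t ^ 2

end Energies

/-- A lattice flow whose low order data are bounded by `M`. -/
structure BoundedLatticeFlow (m c h : ℝ) (N : ℕ) (U : ℕ → ℝ → ℝ) (δ T M : ℝ) : Prop
    extends LatticeFlow m c h N U δ T where
  one_le : 1 ≤ M
  length_le : N * h ≤ M
  m_le : m ≤ M
  inv_le : 1 / δ ≤ M
  coeff_le : m / δ ^ 2 ≤ M
  time_le : T ≤ M
  g_le : ∀ i < N, ∀ t ∈ Icc 0 T, |latG m c h N U i t| ≤ M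
  w_le : ∀ i, ∀ t ∈ Icc 0 T, |latW c h N U i t| ≤ M

namespace BoundedLatticeFlow

variable {m c h δ T M : ℝ} {N : ℕ} {U : ℕ → ℝ → ℝ} (H : BoundedLatticeFlow m c h N U δ T M)
include H

theorem sum_le {x : ℕ → ℝ} {y : ℝ} (hy : 0 ≤ y) (hx : ∀ i < N, x i ≤ y) :
    h * ∑ i ∈ Finset.range N, x i ≤ M * y := by
  have h1 : ∑ i ∈ Finset.range N, x i ≤ N * y := by
    have := Finset.sum_le_card_nsmul (Finset.range N) x y (fun i hi => hx i (Finset.mem_range.1 hi))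
    simpa using this
  have := mul_le_mul_of_nonneg_left h1 H.hh.le
  nlinarith [H.length_le]

theorem coeff_le' {t : ℝ} (ht : t ∈ Icc 0 T) {i : ℕ} (hi : i < N) : m / U i t ^ 2 ≤ M := by
  have h1 := H.pos i hi t ht
  have h2 := H.hδ
  have h3 := H.hm
  refine le_trans ?_ H.coeff_le
  gcongr

theorem inv_le' {t : ℝ} (ht : t ∈ Icc 0 T) {i : ℕ} (hi : i < N) : 1 / U i t ≤ M := by
  have h1 := H.pos i hi t ht
  have h2 := H.hδ
  refine le_trans ?_ H.inv_le
  gcongr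

theorem coeff_nonneg {t : ℝ} (ht : t ∈ Icc 0 T) {i : ℕ} (hi : i < N) : 0 ≤ m / U i t ^ 2 := by
  have h1 := H.U_pos ht hi
  have h3 := H.hm
  positivity

theorem zeroth_le {t : ℝ} (ht : t ∈ Icc 0 T) {i : ℕ} (hi : i < N) :
    |m * latG m c h N U i t / U i t ^ 2| ≤ M ^ 2 := by
  have h1 := H.coeff_le' ht hi
  have h2 := H.coeff_nonneg ht hi
  have h3 := H.g_le i hi t ht
  have e : m * latG m c h N U i t / U i t ^ 2 = m / U i t ^ 2 * latG m c h N U i t := by ring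
  have := H.one_le
  rw [e, abs_mul, abs_of_nonneg h2, pow_two M]
  exact mul_le_mul h1 h3 (abs_nonneg _) (by positivity)

theorem hasDerivAt_J {t : ℝ} (ht : t ∈ Icc 0 T) :
    HasDerivAt (latJ m c h N U) (h * ∑ i ∈ Finset.range N,
      latG m c h N U i t * latA m c h N U i t) t := by
  refine (HasDerivAt.fun_sum (fun i hi => ?_)).const_mul h
  have := (H.hasDerivAt_g ht (Finset.mem_range.1 hi)).pow 2 |>.div_const 2
  refine this.congr_deriv ?_
  simp; ring

theorem J_deriv_le {t : ℝ} (ht : t ∈ Icc 0 T) :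
    h * ∑ i ∈ Finset.range N, latG m c h N U i t * latA m c h N U i t
      ≤ -2 * latE m c h N U t + M ^ 4 := by
  have hM := H.one_le
  have e : ∑ i ∈ Finset.range N, latG m c h N U i t * latA m c h N U i t
      = ∑ i ∈ Finset.range N, (latF m c h N U (i + 1) t - latF m c h N U i t) / h
          * latG m c h N U i t
        + ∑ i ∈ Finset.range N, (m * latG m c h N U i t / U i t ^ 2) * latG m c h N U i t := by
    rw [← Finset.sum_add_distrib]
    refine Finset.sum_congr rfl fun i _ => ?_
    rw [latA]; ring
  rw [e, sum_by_parts_edge (F := fun i => latF m c h N U i t) (c := 0) H.hh.ne'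
    (fun i => latG m c h N U i t) (LatticeFlow.F_zero t) (H.F_N t)]
  have h2 : h * ∑ i ∈ Finset.range N, (m * latG m c h N U i t / U i t ^ 2) * latG m c h N U i t
      ≤ M * M ^ 3 := by
    refine H.sum_le (by positivity) fun i hi => ?_
    refine (le_abs_self _).trans ?_
    rw [abs_mul]
    calc _ ≤ M ^ 2 * M := by
          gcongr
          · exact H.zeroth_le ht hi
          · exact H.g_le i hi t ht
      _ = M ^ 3 := by ring
  have h3 : h * ∑ i ∈ Finset.range N, latF m c h N U i t *
      edge N h 0 (fun i => latG m c h N U i t) i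
      = 2 * latE m c h N U t := by
    rw [latE, mul_left_comm]
    congr 1
    rw [Finset.mul_sum]
    refine Finset.sum_congr rfl fun i _ => ?_
    rw [latDG]; ring
  nlinarith

omit H in
theorem flux_nonneg (m c h : ℝ) (N : ℕ) (U : ℕ → ℝ → ℝ) (i : ℕ) (t : ℝ) :
    0 ≤ latF m c h N U i t * latDG m c h N U i t := by
  rw [latF, div_mul_eq_mul_div]
  exact div_nonneg (mul_self_nonneg _) (by positivity)

theorem E_nonneg (t : ℝ) : 0 ≤ latE m c h N U t := by
  have := H.hh.le
  refine mul_nonneg this (Finset.sum_nonneg fun i _ => ?_)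
  have := flux_nonneg m c h N U i t
  positivity

theorem S_nonneg (t : ℝ) : 0 ≤ latS m c h N U t := by
  have := H.hh.le
  exact mul_nonneg this (Finset.sum_nonneg fun i _ => sq_nonneg _)

theorem J_nonneg (t : ℝ) : 0 ≤ latJ m c h N U t := by
  have := H.hh.le
  exact mul_nonneg this (Finset.sum_nonneg fun i _ => by positivity)

theorem abs_F_sub_le {t : ℝ} (ht : t ∈ Icc 0 T) {i j : ℕ} (hij : i ≤ j) (hj : j ≤ N) :
    |latF m c h N U j t - latF m c h N U i t| ≤
      √(((j : ℝ) - i) * h) * √(2 * latS m c h N U t + 2 * M ^ 5) := by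
  have hM := H.one_le
  refine abs_sub_le_sqrt_of_sum_sq H.hh (φ := fun i => latF m c h N U i t)
    (ψ := fun i => latA m c h N U i t - m * latG m c h N U i t / U i t ^ 2) ?_ hij hj ?_
  · calc _ ≤ h * ∑ i ∈ Finset.range N, (2 * latA m c h N U i t ^ 2 + 2 * M ^ 4) := by
          refine mul_le_mul_of_nonneg_left (Finset.sum_le_sum fun i hi => ?_) H.hh.le
          have h1 := H.zeroth_le ht (Finset.mem_range.1 hi)
          have h2 : (m * latG m c h N U i t / U i t ^ 2) ^ 2 ≤ (M ^ 2) ^ 2 := sq_le_sq' (by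
            linarith [(abs_le.1 h1).1]) (abs_le.1 h1).2
          nlinarith [sq_nonneg (latA m c h N U i t + m * latG m c h N U i t / U i t ^ 2)]
      _ ≤ _ := by
          rw [Finset.sum_add_distrib, mul_add, ← Finset.mul_sum, mul_left_comm]
          have := H.sum_le (x := fun _ => 2 * M ^ 4) (y := 2 * M ^ 4) (by positivity)
            (fun i _ => le_rfl)
          rw [latS]
          nlinarith
  · intro l _ _
    rw [H.F_succ_sub, abs_mul, abs_of_pos H.hh]

theorem F_sq_le {t : ℝ} (ht : t ∈ Icc 0 T) {i : ℕ} (hi : i ≤ N) :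
    latF m c h N U i t ^ 2 ≤ 2 * M ^ 6 * (1 + latS m c h N U t) := by
  have hM := H.one_le
  have hS := H.S_nonneg t
  have h1 := H.abs_F_sub_le ht (Nat.zero_le i) hi
  rw [LatticeFlow.F_zero, sub_zero] at h1
  have h2 : latF m c h N U i t ^ 2 ≤
      ((i - (0 : ℕ) : ℝ) * h) * (2 * latS m c h N U t + 2 * M ^ 5) := by
    rw [← sq_abs]
    refine (pow_le_pow_left₀ (abs_nonneg _) h1 2).trans (le_of_eq ?_)
    have := H.hh
    rw [mul_pow, sq_sqrt (by simp; positivity), sq_sqrt (by positivity)]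
  have h3 : (i - (0 : ℕ) : ℝ) * h ≤ M := by
    refine le_trans ?_ H.length_le
    have : (i : ℝ) ≤ N := by exact_mod_cast hi
    have := H.hh
    simp only [Nat.cast_zero, sub_zero]
    gcongr
  calc _ ≤ M * (2 * latS m c h N U t + 2 * M ^ 5) := h2.trans (by gcongr)
    _ ≤ _ := by
      have : M ≤ M ^ 6 := le_self_pow₀ hM (by norm_num)
      nlinarith

theorem hasDerivAt_E {t : ℝ} (ht : t ∈ Icc 0 T) :
    HasDerivAt (latE m c h N U) (h * ∑ i ∈ Finset.range N,
      (latF m c h N U i t * latDA m c h N U i t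
        - latW c h N U i t * latF m c h N U i t ^ 2 * latDG m c h N U i t)) t := by
  refine (HasDerivAt.fun_sum (fun i hi => ?_)).const_mul h
  have := ((H.hasDerivAt_F ht i).mul (H.hasDerivAt_dg ht i)).div_const 2
  refine this.congr_deriv ?_
  rw [latF', latF]
  have h1 : (1 + latW c h N U i t ^ 2) ≠ 0 := by positivity
  field_simp
  ring

theorem E_deriv_le {t : ℝ} (ht : t ∈ Icc 0 T) :
    h * ∑ i ∈ Finset.range N,
      (latF m c h N U i t * latDA m c h N U i t
        - latW c h N U i t * latF m c h N U i t ^ 2 * latDG m c h N U i t)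
      ≤ -(latS m c h N U t / 2) + 16 * M ^ 8 * (1 + latE m c h N U t) ^ 2 := by
  have hM := H.one_le
  have hS := H.S_nonneg t
  have hE := H.E_nonneg t
  set f := √(2 * M ^ 6 * (1 + latS m c h N U t)) with hf
  have hf2 : f ^ 2 = 2 * M ^ 6 * (1 + latS m c h N U t) := sq_sqrt (by positivity)
  have hf0 : 0 ≤ f := sqrt_nonneg _
  have hF : ∀ i ≤ N, |latF m c h N U i t| ≤ f := fun i hi =>
    abs_le_sqrt (H.F_sq_le ht hi)
  have e1 : h * ∑ i ∈ Finset.range N, latF m c h N U i t * latDA m c h N U i t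
      = -latS m c h N U t + h * ∑ i ∈ Finset.range N,
        (m * latG m c h N U i t / U i t ^ 2) * latA m c h N U i t := by
    have := sum_by_parts_edge (F := fun i => latF m c h N U i t) (c := 0) H.hh.ne'
      (fun i => latA m c h N U i t) (LatticeFlow.F_zero t) (H.F_N t)
    have e2 : ∑ i ∈ Finset.range N, latF m c h N U i t * latDA m c h N U i t
        = -∑ i ∈ Finset.range N, (latF m c h N U (i + 1) t - latF m c h N U i t) / h
          * latA m c h N U i t := by
      rw [this, neg_neg]; rfl
    rw [e2, latS, ← mul_neg, ← mul_add, ← Finset.sum_neg_distrib, ← Finset.sum_neg_distrib,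
      ← Finset.sum_add_distrib]
    congr 1
    refine Finset.sum_congr rfl fun i _ => ?_
    rw [latA]; ring
  have h2 : h * ∑ i ∈ Finset.range N, (m * latG m c h N U i t / U i t ^ 2) * latA m c h N U i t
      ≤ latS m c h N U t / 8 + M * (2 * M ^ 4) := by
    have h3 : h * ∑ i ∈ Finset.range N, (m * latG m c h N U i t / U i t ^ 2) * latA m c h N U i t
      ≤ h * ∑ i ∈ Finset.range N, (latA m c h N U i t ^ 2 / 8 + 2 * M ^ 4) := by
      refine mul_le_mul_of_nonneg_left (Finset.sum_le_sum fun i hi => ?_) H.hh.le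
      have h1 := H.zeroth_le ht (Finset.mem_range.1 hi)
      have h2 : (m * latG m c h N U i t / U i t ^ 2) ^ 2 ≤ (M ^ 2) ^ 2 := sq_le_sq' (by
            linarith [(abs_le.1 h1).1]) (abs_le.1 h1).2
      nlinarith [sq_nonneg (latA m c h N U i t - 4 * (m * latG m c h N U i t / U i t ^ 2))]
    refine h3.trans ?_
    rw [Finset.sum_add_distrib, mul_add]
    have := H.sum_le (x := fun _ => 2 * M ^ 4) (y := 2 * M ^ 4) (by positivity)
            (fun i _ => le_rfl)
    rw [latS, mul_div_assoc, Finset.sum_div]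
    linarith
  have h4 : h * ∑ i ∈ Finset.range N,
      -(latW c h N U i t * latF m c h N U i t ^ 2 * latDG m c h N U i t)
      ≤ 2 * M * f * latE m c h N U t := by
    rw [latE, mul_left_comm]
    refine mul_le_mul_of_nonneg_left ?_ H.hh.le
    rw [Finset.mul_sum]
    refine Finset.sum_le_sum fun i hi => ?_
    have hi' := (Finset.mem_range.1 hi).le
    have h1 : -(latW c h N U i t * latF m c h N U i t) ≤ M * f := by
      refine (neg_le_abs _).trans ?_
      rw [abs_mul]
      gcongr
      · exact H.w_le i t ht
      · exact hF i hi'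
    nlinarith [mul_le_mul_of_nonneg_right h1 (flux_nonneg m c h N U i t)]
  have h5 : 2 * M * f * latE m c h N U t
      ≤ (1 + latS m c h N U t) / 8 + 16 * M ^ 8 * latE m c h N U t ^ 2 := by
    have hM6 : (0 : ℝ) < 16 * M ^ 6 := by positivity
    have h6 : f ^ 2 / (16 * M ^ 6) = (1 + latS m c h N U t) / 8 := by
      rw [hf2]; field_simp; norm_num
    rw [← h6]
    have h7 : 0 ≤ (f - 16 * M ^ 7 * latE m c h N U t) ^ 2 / (16 * M ^ 6) := by positivity
    have h8 : (f - 16 * M ^ 7 * latE m c h N U t) ^ 2 / (16 * M ^ 6)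
        = f ^ 2 / (16 * M ^ 6) - 2 * M * f * latE m c h N U t
          + 16 * M ^ 8 * latE m c h N U t ^ 2 := by
      field_simp
      ring
    linarith
  have e3 : h * ∑ i ∈ Finset.range N,
      (latF m c h N U i t * latDA m c h N U i t
        - latW c h N U i t * latF m c h N U i t ^ 2 * latDG m c h N U i t)
      = h * ∑ i ∈ Finset.range N, latF m c h N U i t * latDA m c h N U i t
        + h * ∑ i ∈ Finset.range N,
          -(latW c h N U i t * latF m c h N U i t ^ 2 * latDG m c h N U i t) := by
    rw [← mul_add, ← Finset.sum_add_distrib]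
    rfl
  rw [e3, e1]
  have h9 : M ^ 5 ≤ M ^ 8 := pow_le_pow_right₀ hM (by norm_num)
  have h10 : 1 ≤ M ^ 8 := one_le_pow₀ hM
  nlinarith [mul_nonneg (show (0 : ℝ) ≤ M ^ 8 by positivity) hE]

/-- Bound for the first energy. -/
theorem E_le {B : ℝ} (hB : latE m c h N U 0 ≤ B) {t : ℝ} (ht : t ∈ Icc 0 T) :
    latE m c h N U t ≤ (1 + B) * exp (16 * M ^ 8 * (M ^ 3 + M * (1 + M ^ 4))) := by
  have hM := H.one_le
  have h0 : (0 : ℝ) ∈ Icc 0 T := ⟨le_rfl, ht.1.trans ht.2⟩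
  set C := 16 * M ^ 8 with hC
  have hC0 : 0 ≤ C := by positivity
  have hd : ∀ s ∈ Icc 0 t, HasDerivAt
      (fun s => log (1 + latE m c h N U s) + C / 2 * latJ m c h N U s) _ s := fun s hs =>
    have hs' : s ∈ Icc 0 T := ⟨hs.1, hs.2.trans ht.2⟩
    (((H.hasDerivAt_E hs').const_add 1).log (by have := H.E_nonneg s; positivity)).add
      ((H.hasDerivAt_J hs').const_mul (C / 2))
  have h1 := le_add_mul_of_deriv_le (k := C * (1 + M ^ 4)) ht.1 hd (fun s hs => by
    have hs' : s ∈ Icc 0 T := ⟨hs.1.le, hs.2.le.trans ht.2⟩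
    have hE := H.E_nonneg s
    have e1 : (h * ∑ i ∈ Finset.range N,
      (latF m c h N U i s * latDA m c h N U i s
        - latW c h N U i s * latF m c h N U i s ^ 2 * latDG m c h N U i s))
          / (1 + latE m c h N U s) ≤ C * (1 + latE m c h N U s) := by
      rw [div_le_iff₀ (by positivity)]
      have := H.E_deriv_le hs'
      have := H.S_nonneg s
      nlinarith
    have e2 := mul_le_mul_of_nonneg_left (H.J_deriv_le hs') (show 0 ≤ C / 2 by positivity)
    nlinarith [mul_nonneg hC0 (show 0 ≤ M ^ 4 by positivity)])
  have hJ0 : latJ m c h N U 0 ≤ 2 * M ^ 3 := by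
    have := H.sum_le (x := fun i => latG m c h N U i 0 ^ 2 / 2) (y := 2 * M ^ 2)
      (by positivity) (fun i hi => by
        have := H.g_le i hi 0 h0
        have := sq_le_sq' (by linarith [(abs_le.1 this).1]) (abs_le.1 this).2
        nlinarith)
    rw [latJ]; nlinarith
  have hJt := H.J_nonneg t
  have hEt := H.E_nonneg t
  have hE0 := H.E_nonneg 0
  have ht2 : t ≤ M := ht.2.trans H.time_le
  have h2 : log (1 + latE m c h N U t) ≤ log (1 + B) + C * (M ^ 3 + M * (1 + M ^ 4)) := by
    have h3 : log (1 + latE m c h N U 0) ≤ log (1 + B) := log_le_log (by positivity) (by linarith)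
    have h4 : C * (1 + M ^ 4) * (t - 0) ≤ C * (1 + M ^ 4) * M := by
      rw [sub_zero]; gcongr
    nlinarith [mul_nonneg hC0 hJt, mul_le_mul_of_nonneg_left hJ0 hC0]
  have h5 := (log_le_iff_le_exp (by positivity)).1 h2
  rw [exp_add, exp_log (by linarith)] at h5
  linarith

theorem hasDerivAt_S {t : ℝ} (ht : t ∈ Icc 0 T) :
    HasDerivAt (latS m c h N U) (h * ∑ i ∈ Finset.range N,
      2 * (latA m c h N U i t * ((latF' m c h N U (i + 1) t - latF' m c h N U i t) / h
      + (m * latA m c h N U i t / U i t ^ 2 - 2 * m * latG m c h N U i t ^ 2 / U i t ^ 3)))) t := by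
  refine (HasDerivAt.fun_sum (fun i hi => ?_)).const_mul h
  have := (H.hasDerivAt_A ht (Finset.mem_range.1 hi)).pow 2
  refine this.congr_deriv ?_
  simp only [Nat.cast_ofNat, Nat.add_one_sub_one, pow_one]
  ring

theorem S_deriv_le {B : ℝ} {t : ℝ} (ht : t ∈ Icc 0 T) (hB : latE m c h N U t ≤ B) :
    h * ∑ i ∈ Finset.range N,
      2 * (latA m c h N U i t * ((latF' m c h N U (i + 1) t - latF' m c h N U i t) / h
      + (m * latA m c h N U i t / U i t ^ 2 - 2 * m * latG m c h N U i t ^ 2 / U i t ^ 3)))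
      ≤ (16 * M ^ 8 * B + 4 * M ^ 9) * (1 + latS m c h N U t) := by
  have hM := H.one_le
  have hS := H.S_nonneg t
  have hE := H.E_nonneg t
  have e1 : ∑ i ∈ Finset.range N,
      2 * (latA m c h N U i t * ((latF' m c h N U (i + 1) t - latF' m c h N U i t) / h
      + (m * latA m c h N U i t / U i t ^ 2 - 2 * m * latG m c h N U i t ^ 2 / U i t ^ 3)))
      = 2 * -(∑ i ∈ Finset.range N, latF' m c h N U i t * latDA m c h N U i t)
        + ∑ i ∈ Finset.range N, 2 * (latA m c h N U i t *
          (m * latA m c h N U i t / U i t ^ 2 - 2 * m * latG m c h N U i t ^ 2 / U i t ^ 3)) := by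
    have := sum_by_parts_edge (F := fun i => latF' m c h N U i t) (c := 0) H.hh.ne'
      (fun i => latA m c h N U i t) (LatticeFlow.F'_zero t) (H.F'_N t)
    have e2 : -(∑ i ∈ Finset.range N, latF' m c h N U i t * latDA m c h N U i t)
        = ∑ i ∈ Finset.range N, (latF' m c h N U (i + 1) t - latF' m c h N U i t) / h
          * latA m c h N U i t := by
      rw [this]; rfl
    rw [e2, Finset.mul_sum, ← Finset.sum_add_distrib]
    refine Finset.sum_congr rfl fun i _ => ?_
    ring
  have h1 : h * ∑ i ∈ Finset.range N, 2 * (latA m c h N U i t *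
          (m * latA m c h N U i t / U i t ^ 2 - 2 * m * latG m c h N U i t ^ 2 / U i t ^ 3))
      ≤ 4 * M * latS m c h N U t + 4 * M ^ 9 := by
    have h2 : h * ∑ i ∈ Finset.range N, 2 * (latA m c h N U i t *
          (m * latA m c h N U i t / U i t ^ 2 - 2 * m * latG m c h N U i t ^ 2 / U i t ^ 3))
        ≤ h * ∑ i ∈ Finset.range N, (4 * M * latA m c h N U i t ^ 2 + 4 * M ^ 8) := by
      refine mul_le_mul_of_nonneg_left (Finset.sum_le_sum fun i hi => ?_) H.hh.le
      have hi' := Finset.mem_range.1 hi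
      have a1 := H.coeff_le' ht hi'
      have a2 := H.coeff_nonneg ht hi'
      have a3 := H.inv_le' ht hi'
      have a4 : 0 ≤ 1 / U i t := by have := H.U_pos ht hi'; positivity
      have a5 := H.zeroth_le ht hi'
      have a6 := H.g_le i hi' t ht
      set y := m * latG m c h N U i t / U i t ^ 2 * latG m c h N U i t * (1 / U i t) with hy
      have b1 : |y| ≤ M ^ 4 := by
        rw [hy, abs_mul, abs_mul, abs_of_nonneg a4]
        calc _ ≤ M ^ 2 * M * M := by gcongr
          _ = M ^ 4 := by ring
      have b2 : y ^ 2 ≤ (M ^ 4) ^ 2 := sq_le_sq' (by linarith [(abs_le.1 b1).1]) (abs_le.1 b1).2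
      have b3 : 2 * (latA m c h N U i t *
          (m * latA m c h N U i t / U i t ^ 2 - 2 * m * latG m c h N U i t ^ 2 / U i t ^ 3))
          = 2 * (m / U i t ^ 2) * latA m c h N U i t ^ 2 - 4 * latA m c h N U i t * y := by
        rw [hy]; ring
      rw [b3]
      have b4 : m / U i t ^ 2 * latA m c h N U i t ^ 2 ≤ M * latA m c h N U i t ^ 2 := by gcongr
      have b5 : latA m c h N U i t ^ 2 ≤ M * latA m c h N U i t ^ 2 :=
        le_mul_of_one_le_left (sq_nonneg _) hM
      nlinarith [sq_nonneg (latA m c h N U i t + 2 * y)]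
    refine h2.trans ?_
    rw [Finset.sum_add_distrib, mul_add, ← Finset.mul_sum]
    have := H.sum_le (x := fun _ => 4 * M ^ 8) (y := 4 * M ^ 8) (by positivity)
            (fun i _ => le_rfl)
    rw [latS]
    nlinarith
  have h3 : h * (2 * -(∑ i ∈ Finset.range N, latF' m c h N U i t * latDA m c h N U i t))
      ≤ 16 * M ^ 8 * (1 + latS m c h N U t) * latE m c h N U t := by
    have h4 : -(∑ i ∈ Finset.range N, latF' m c h N U i t * latDA m c h N U i t)
        ≤ ∑ i ∈ Finset.range N, 8 * M ^ 8 * (1 + latS m c h N U t) *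
          (latF m c h N U i t * latDG m c h N U i t / 2) := by
      rw [← Finset.sum_neg_distrib]
      refine Finset.sum_le_sum fun i hi => ?_
      have hi' := (Finset.mem_range.1 hi).le
      have hF := H.F_sq_le ht hi'
      have hw := H.w_le i t ht
      set w := latW c h N U i t with hw0
      set γ := latDG m c h N U i t with hγ0
      set Γ := latDA m c h N U i t with hΓ0
      have hw2 : 1 + w ^ 2 ≤ 2 * M ^ 2 := by
        have := sq_le_sq' (by linarith [(abs_le.1 hw).1]) (abs_le.1 hw).2
        nlinarith
      have e3 : latF m c h N U i t = γ / (1 + w ^ 2) := rfl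
      have e4 : latF' m c h N U i t = Γ / (1 + w ^ 2) - 2 * w * γ ^ 2 / (1 + w ^ 2) ^ 2 := rfl
      have hp : 0 < 1 + w ^ 2 := by positivity
      -- complete the square in `Γ`
      have h5 : -(latF' m c h N U i t * Γ) ≤ latF m c h N U i t ^ 2 * γ ^ 2 := by
        rw [e3, e4]
        have h6 : 0 ≤ (Γ - w * γ ^ 2 / (1 + w ^ 2)) ^ 2 / (1 + w ^ 2)
            + γ ^ 4 / (1 + w ^ 2) ^ 3 := by positivity
        have h7 : (γ / (1 + w ^ 2)) ^ 2 * γ ^ 2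
            - -((Γ / (1 + w ^ 2) - 2 * w * γ ^ 2 / (1 + w ^ 2) ^ 2) * Γ)
            = (Γ - w * γ ^ 2 / (1 + w ^ 2)) ^ 2 / (1 + w ^ 2) + γ ^ 4 / (1 + w ^ 2) ^ 3 := by
          field_simp
          ring
        linarith
      refine h5.trans ?_
      have h8 : γ ^ 2 = (1 + w ^ 2) * (latF m c h N U i t * γ) := by
        rw [e3]; field_simp
      have h9 := flux_nonneg m c h N U i t
      rw [h8]
      calc latF m c h N U i t ^ 2 * ((1 + w ^ 2) * (latF m c h N U i t * γ))
          ≤ (2 * M ^ 6 * (1 + latS m c h N U t)) * (2 * M ^ 2 * (latF m c h N U i t * γ)) := by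
            gcongr
        _ = _ := by ring
    rw [← Finset.mul_sum] at h4
    have := mul_le_mul_of_nonneg_left h4 H.hh.le
    rw [latE]
    nlinarith
  rw [e1, mul_add]
  have h10 : 16 * M ^ 8 * (1 + latS m c h N U t) * latE m c h N U t
      ≤ 16 * M ^ 8 * (1 + latS m c h N U t) * B := by gcongr
  have h11 : M ≤ M ^ 9 := le_self_pow₀ hM (by norm_num)
  nlinarith [mul_le_mul_of_nonneg_right h11 hS]

/-- Smoothing estimate for the second energy. -/
theorem mul_S_le {B : ℝ} (hB : ∀ t ∈ Icc 0 T, latE m c h N U t ≤ B) {t : ℝ} (ht : t ∈ Icc 0 T) :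
    t * latS m c h N U t ≤
      2 * (1 + B) * exp ((16 * M ^ 8 * (1 + B) ^ 2 + M * (16 * M ^ 8 * B + 4 * M ^ 9)) * M) := by
  have hM := H.one_le
  have h0 : (0 : ℝ) ∈ Icc 0 T := ⟨le_rfl, ht.1.trans ht.2⟩
  have hB0 : 0 ≤ B := (H.E_nonneg 0).trans (hB 0 h0)
  set k := 16 * M ^ 8 * (1 + B) ^ 2 + M * (16 * M ^ 8 * B + 4 * M ^ 9) with hk
  have hk0 : 0 ≤ k := by positivity
  have hd : ∀ s ∈ Icc 0 T, HasDerivAt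
      (fun s => s * (latS m c h N U s / 2) + (latE m c h N U s + 1)) _ s := fun s hs =>
    ((hasDerivAt_id s).mul ((H.hasDerivAt_S hs).div_const 2)).add
      ((H.hasDerivAt_E hs).add_const 1)
  have h1 := le_exp_of_deriv_le (k := k) hd (fun s hs => by
    have hs' : s ∈ Icc 0 T := Ioo_subset_Icc_self hs
    have hE := H.E_nonneg s
    have hS := H.S_nonneg s
    have hs0 : 0 ≤ s := hs'.1
    have hsM : s ≤ M := hs'.2.trans H.time_le
    have a1 := H.E_deriv_le hs'
    have a2 := H.S_deriv_le hs' (hB s hs')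
    have a3 : 16 * M ^ 8 * (1 + latE m c h N U s) ^ 2 ≤ 16 * M ^ 8 * (1 + B) ^ 2 := by
      have := hB s hs'
      gcongr
    set a := 16 * M ^ 8 * (1 + B) ^ 2 with ha
    set b := 16 * M ^ 8 * B + 4 * M ^ 9 with hb
    have ha0 : 0 ≤ a := by positivity
    have hb0 : 0 ≤ b := by positivity
    have a4 := mul_le_mul_of_nonneg_left a2 (show 0 ≤ s / 2 by positivity)
    have a5 : s * b ≤ M * b := by gcongr
    have a6 : s / 2 * (b * (1 + latS m c h N U s)) ≤
        M * b / 2 + b * (s * latS m c h N U s / 2) := by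
      nlinarith
    have a7 : b ≤ M * b := le_mul_of_one_le_left hb0 hM
    have a8 : 0 ≤ s * latS m c h N U s / 2 := by positivity
    have a9 := mul_le_mul_of_nonneg_right a7 a8
    have a10 := mul_nonneg ha0 a8
    have a11 := mul_nonneg hk0 hE
    have a12 : 0 ≤ M * b := by positivity
    simp only [id]
    rw [hk] at a11 ⊢
    nlinarith) t ht
  simp only [zero_mul, zero_add] at h1
  have hE := H.E_nonneg t
  have h2 : (latE m c h N U 0 + 1) * exp (k * t) ≤ (1 + B) * exp (k * M) := by
    have a1 := hB 0 h0
    have a2 : t ≤ M := ht.2.trans H.time_le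
    exact mul_le_mul (by linarith) (exp_le_exp.2 (by gcongr)) (exp_pos _).le (by linarith)
  nlinarith

end BoundedLatticeFlow

theorem abs_sub_le_mul_abs_arctan_sub {M x y : ℝ} (hx : |x| ≤ M) (hy : |y| ≤ M) :
    |x - y| ≤ (1 + M ^ 2) * |arctan x - arctan y| := by
  wlog hxy : y ≤ x generalizing x y
  · rw [abs_sub_comm, abs_sub_comm (arctan x)]
    exact this hy hx (le_of_not_ge hxy)
  have hanti : MonotoneOn (fun s => (1 + M ^ 2) * arctan s - s) (Icc y x) := by
    have hd : ∀ s, HasDerivAt (fun s => (1 + M ^ 2) * arctan s - s)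
        ((1 + M ^ 2) * (1 / (1 + s ^ 2)) - 1) s := fun s =>
      ((hasDerivAt_arctan s).const_mul _).sub (hasDerivAt_id s)
    refine monotoneOn_of_deriv_nonneg (convex_Icc y x)
      (fun s hs => (hd s).continuousAt.continuousWithinAt)
      (fun s hs => (hd s).differentiableAt.differentiableWithinAt) fun s hs => ?_
    rw [interior_Icc] at hs
    rw [(hd s).deriv, mul_one_div, sub_nonneg, one_le_div (by positivity)]
    have : |s| ≤ M := abs_le.2 ⟨by linarith [(abs_le.1 hy).1, hs.1],
      by linarith [(abs_le.1 hx).2, hs.2]⟩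
    have := sq_le_sq' (abs_le.1 this).1 (abs_le.1 this).2
    linarith
  have h := hanti ⟨le_rfl, hxy⟩ ⟨hxy, le_rfl⟩ hxy
  simp only at h
  rw [abs_of_nonneg (sub_nonneg.2 hxy), abs_of_nonneg (sub_nonneg.2 (arctan_mono hxy))]
  linarith

namespace BoundedLatticeFlow

variable {m c h δ T M : ℝ} {N : ℕ} {U : ℕ → ℝ → ℝ} (H : BoundedLatticeFlow m c h N U δ T M)
include H

theorem dist_le {i j : ℕ} (hj : j ≤ N) : ((j : ℝ) - i) * h ≤ M := by
  refine le_trans ?_ H.length_le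
  have h1 : (j : ℝ) ≤ N := by exact_mod_cast hj
  have h2 : (0 : ℝ) ≤ i := Nat.cast_nonneg i
  have := H.hh
  gcongr
  linarith

theorem dist_nonneg {i j : ℕ} (hij : i ≤ j) : 0 ≤ ((j : ℝ) - i) * h := by
  have h1 : (i : ℝ) ≤ j := by exact_mod_cast hij
  exact mul_nonneg (by linarith) H.hh.le

theorem dist_le_sqrt {i j : ℕ} (hij : i ≤ j) (hj : j ≤ N) :
    ((j : ℝ) - i) * h ≤ M * √(((j : ℝ) - i) * h) := by
  have hM := H.one_le
  have h1 := H.dist_nonneg hij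
  have h2 := H.dist_le (i := i) hj
  set d := ((j : ℝ) - i) * h
  have h3 : √d ≤ M := by
    rw [sqrt_le_left (by linarith)]
    nlinarith
  calc d = √d * √d := (mul_self_sqrt h1).symm
    _ ≤ M * √d := by gcongr

theorem div_U_le {t : ℝ} (ht : t ∈ Icc 0 T) {i : ℕ} (hi : i < N) : |m / U i t| ≤ M ^ 2 := by
  have h1 := H.inv_le' ht hi
  have h2 := H.U_pos ht hi
  have h3 := H.hm
  have hM := H.one_le
  rw [abs_of_nonneg (by positivity), div_eq_mul_one_div, pow_two]
  exact mul_le_mul H.m_le h1 (by positivity) (by linarith)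

theorem abs_q_le {t : ℝ} (ht : t ∈ Icc 0 T) {i : ℕ} (hi : i < N) :
    |latG m c h N U i t + m / U i t| ≤ 2 * M ^ 2 := by
  have h1 := H.g_le i hi t ht
  have h2 := H.div_U_le ht hi
  have hM := H.one_le
  refine (abs_add_le _ _).trans ?_
  nlinarith

theorem abs_arctan_sub_le {t : ℝ} (ht : t ∈ Icc 0 T) {i j : ℕ} (hij : i ≤ j) (hj : j ≤ N) :
    |arctan (latW c h N U j t) - arctan (latW c h N U i t)| ≤ ((j : ℝ) - i) * h * (2 * M ^ 2) := by
  have := abs_sub_sub_mul_le (P := 0) (ε := 2 * M ^ 2) H.hh.le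
    (φ := fun l => arctan (latW c h N U l t)) (χ := fun l => latG m c h N U l t + m / U l t) hij
    (fun l _ _ => H.arctan_succ_sub l t)
    (fun l _ h2 => by rw [sub_zero]; exact H.abs_q_le ht (by omega))
  simpa using this

theorem abs_w_sub_le {t : ℝ} (ht : t ∈ Icc 0 T) {i j : ℕ} (hij : i ≤ j) (hj : j ≤ N) :
    |latW c h N U j t - latW c h N U i t| ≤ ((j : ℝ) - i) * h * (4 * M ^ 4) := by
  have hM := H.one_le
  have h1 := abs_sub_le_mul_abs_arctan_sub (H.w_le j t ht) (H.w_le i t ht)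
  have h2 := H.abs_arctan_sub_le ht hij hj
  have h3 := H.dist_nonneg hij
  calc _ ≤ (2 * M ^ 2) * (((j : ℝ) - i) * h * (2 * M ^ 2)) := by
        refine h1.trans (mul_le_mul (by nlinarith) h2 (abs_nonneg _) (by positivity))
    _ = _ := by ring

theorem abs_U_sub_le {t : ℝ} (ht : t ∈ Icc 0 T) {i j : ℕ} (hij : i ≤ j) (hj : j < N) :
    |U j t - U i t| ≤ ((j : ℝ) - i) * h * M := by
  have := abs_sub_sub_mul_le (P := 0) (ε := M) H.hh.le
    (φ := fun l => U l t) (χ := fun l => latW c h N U (l + 1) t) hij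
    (fun l _ _ => H.U_succ_sub (by omega) t)
    (fun l _ h2 => by rw [sub_zero]; exact H.w_le _ t ht)
  simpa using this

theorem gridTaylor_U {t : ℝ} (ht : t ∈ Icc 0 T) :
    GridTaylor N h (4 * M ^ 5) (fun i => U i t) (fun i => latW c h N U i t) := by
  have hM := H.one_le
  refine gridTaylor_of_forward H.hh (by positivity)
    (fun l hl => Or.inl (H.U_succ_sub hl t)) fun i j hij hj => ?_
  calc _ ≤ ((j : ℝ) - i) * h * (4 * M ^ 4) := H.abs_w_sub_le ht hij hj.le
    _ ≤ (M * √(((j : ℝ) - i) * h)) * (4 * M ^ 4) := by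
        have := H.dist_le_sqrt hij hj.le
        gcongr
    _ = _ := by ring

theorem sum_dg_sq_le {B t : ℝ} (ht : t ∈ Icc 0 T) (hB : latE m c h N U t ≤ B) :
    h * ∑ i ∈ Finset.range N, latDG m c h N U (i + 1) t ^ 2 ≤ 4 * M ^ 2 * B := by
  have hM := H.one_le
  have h1 : ∑ i ∈ Finset.range N, latDG m c h N U (i + 1) t ^ 2
      = ∑ i ∈ Finset.range N, latDG m c h N U i t ^ 2 := by
    have a1 := Finset.sum_range_succ (fun i => latDG m c h N U i t ^ 2) N
    have a2 := Finset.sum_range_succ' (fun i => latDG m c h N U i t ^ 2) N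
    rw [H.dg_N le_rfl] at a1
    rw [LatticeFlow.dg_zero] at a2
    linarith
  rw [h1]
  have h2 : h * ∑ i ∈ Finset.range N, latDG m c h N U i t ^ 2
      ≤ h * ∑ i ∈ Finset.range N, 4 * M ^ 2 * (latF m c h N U i t * latDG m c h N U i t / 2) := by
    refine mul_le_mul_of_nonneg_left (Finset.sum_le_sum fun i hi => ?_) H.hh.le
    have hw := H.w_le i t ht
    have h9 := flux_nonneg m c h N U i t
    have h8 : latDG m c h N U i t ^ 2
        = (1 + latW c h N U i t ^ 2) * (latF m c h N U i t * latDG m c h N U i t) := by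
      rw [latF]
      have : 1 + latW c h N U i t ^ 2 ≠ 0 := by positivity
      field_simp
    have hw2 : 1 + latW c h N U i t ^ 2 ≤ 2 * M ^ 2 := by
      have := sq_le_sq' (by linarith [(abs_le.1 hw).1]) (abs_le.1 hw).2
      nlinarith
    rw [h8]
    nlinarith
  refine h2.trans ?_
  rw [← Finset.mul_sum, mul_left_comm]
  exact mul_le_mul_of_nonneg_left hB (by positivity)

theorem gridTaylor_arctan {B t : ℝ} (ht : t ∈ Icc 0 T) (hB : latE m c h N U t ≤ B) :
    GridTaylor N h (√(4 * M ^ 2 * B) + M ^ 5) (fun i => arctan (latW c h N U i t))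
      (fun i => latG m c h N U i t + m / U i t) := by
  have hM := H.one_le
  refine gridTaylor_of_forward H.hh (by positivity)
    (fun l hl => Or.inr (H.arctan_succ_sub l t)) fun i j hij hj => ?_
  have h1 := abs_sub_le_sqrt_of_sum_sq H.hh (φ := fun i => latG m c h N U i t)
    (H.sum_dg_sq_le ht hB) hij hj.le (fun l _ h2 => by
      rw [H.g_succ_sub (by omega) t, abs_mul, abs_of_pos H.hh])
  have h2 : |m / U j t - m / U i t| ≤ M ^ 5 * √(((j : ℝ) - i) * h) := by
    have hUi := H.U_pos ht (hij.trans_lt hj)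
    have hUj := H.U_pos ht hj
    have e : m / U j t - m / U i t = -(m / U j t * (1 / U i t) * (U j t - U i t)) := by
      field_simp
      ring
    rw [e, abs_neg, abs_mul, abs_mul]
    have b1 := H.div_U_le ht hj
    have b2 := H.inv_le' ht (hij.trans_lt hj)
    have b3 := H.abs_U_sub_le ht hij hj
    have b4 : |1 / U i t| ≤ M := by rwa [abs_of_pos (by positivity)]
    have b5 := H.dist_le_sqrt hij hj.le
    calc _ ≤ M ^ 2 * M * (((j : ℝ) - i) * h * M) := by gcongr
      _ ≤ M ^ 2 * M * (M * √(((j : ℝ) - i) * h) * M) := by gcongr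
      _ = _ := by ring
  have e : (latG m c h N U j t + m / U j t) - (latG m c h N U i t + m / U i t)
      = (latG m c h N U j t - latG m c h N U i t) + (m / U j t - m / U i t) := by ring
  rw [e]
  refine (abs_add_le _ _).trans ?_
  linarith

theorem abs_dg_le {S t : ℝ} (ht : t ∈ Icc 0 T) (hS : latS m c h N U t ≤ S) {i : ℕ} (hi : i ≤ N) :
    |latDG m c h N U i t| ≤ 2 * M ^ 2 * √(2 * M ^ 6 * (1 + S)) := by
  have hM := H.one_le
  have h1 := H.F_sq_le ht hi
  have hS0 := H.S_nonneg t
  have h2 : |latF m c h N U i t| ≤ √(2 * M ^ 6 * (1 + S)) :=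
    abs_le_sqrt (h1.trans (by gcongr))
  have hw := H.w_le i t ht
  have hw2 : 1 + latW c h N U i t ^ 2 ≤ 2 * M ^ 2 := by
      have := sq_le_sq' (by linarith [(abs_le.1 hw).1]) (abs_le.1 hw).2
      nlinarith
  have e : latDG m c h N U i t = (1 + latW c h N U i t ^ 2) * latF m c h N U i t := by
    rw [latF]
    have : 1 + latW c h N U i t ^ 2 ≠ 0 := by positivity
    field_simp
  rw [e, abs_mul, abs_of_pos (by positivity)]
  gcongr

theorem gridTaylor_g {S t : ℝ} (ht : t ∈ Icc 0 T) (hS : latS m c h N U t ≤ S) :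
    GridTaylor N h (2 * M ^ 2 * √(2 * S + 2 * M ^ 5) + 8 * M ^ 6 * √(2 * M ^ 6 * (1 + S)))
      (fun i => latG m c h N U i t) (fun i => latDG m c h N U i t) := by
  have hM := H.one_le
  have hS0 := H.S_nonneg t
  refine gridTaylor_of_forward H.hh (by positivity)
    (fun l hl => Or.inl (H.g_succ_sub hl t)) fun i j hij hj => ?_
  have h1 : |latF m c h N U j t - latF m c h N U i t| ≤
      √(((j : ℝ) - i) * h) * √(2 * S + 2 * M ^ 5) :=
    (H.abs_F_sub_le ht hij hj.le).trans (by gcongr)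
  have h2 : |latF m c h N U i t| ≤ √(2 * M ^ 6 * (1 + S)) :=
    abs_le_sqrt ((H.F_sq_le ht (hij.trans hj.le)).trans (by gcongr))
  have hw := H.w_le j t ht
  have hw' := H.w_le i t ht
  have hw2 : 1 + latW c h N U j t ^ 2 ≤ 2 * M ^ 2 := by
      have := sq_le_sq' (by linarith [(abs_le.1 hw).1]) (abs_le.1 hw).2
      nlinarith
  have e : ∀ i, latDG m c h N U i t = (1 + latW c h N U i t ^ 2) * latF m c h N U i t := by
    intro i
    rw [latF]
    have : 1 + latW c h N U i t ^ 2 ≠ 0 := by positivity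
    field_simp
  have h3 : |latW c h N U j t - latW c h N U i t| ≤ 4 * M ^ 5 * √(((j : ℝ) - i) * h) := by
    have a1 := H.abs_w_sub_le ht hij hj.le
    have a2 := H.dist_le_sqrt hij hj.le
    calc _ ≤ _ := a1
      _ ≤ (M * √(((j : ℝ) - i) * h)) * (4 * M ^ 4) := by gcongr
      _ = _ := by ring
  have h4 : |latW c h N U j t + latW c h N U i t| ≤ 2 * M :=
    (abs_add_le _ _).trans (by linarith)
  have e2 : latDG m c h N U j t - latDG m c h N U i t
      = (1 + latW c h N U j t ^ 2) * (latF m c h N U j t - latF m c h N U i t)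
        + (latW c h N U j t + latW c h N U i t) * (latW c h N U j t - latW c h N U i t)
          * latF m c h N U i t := by
    rw [e, e]; ring
  rw [e2]
  refine (abs_add_le _ _).trans ?_
  rw [abs_mul, abs_mul, abs_mul, abs_of_pos (show 0 < 1 + latW c h N U j t ^ 2 by positivity)]
  calc _ ≤ 2 * M ^ 2 * (√(((j : ℝ) - i) * h) * √(2 * S + 2 * M ^ 5))
        + 2 * M * (4 * M ^ 5 * √(((j : ℝ) - i) * h)) * √(2 * M ^ 6 * (1 + S)) := by gcongr
    _ = _ := by ring

end BoundedLatticeFlow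

theorem abs_arctan_sub_arctan_le (x y : ℝ) : |arctan x - arctan y| ≤ |x - y| := by
  have h : LipschitzWith 1 arctan := by
    refine lipschitzWith_of_nnnorm_deriv_le differentiable_arctan fun x => ?_
    rw [← NNReal.coe_le_coe, coe_nnnorm, Real.deriv_arctan, Real.norm_eq_abs,
      abs_of_nonneg (by positivity)]
    simp only [NNReal.coe_one]
    rw [div_le_one (by positivity)]
    nlinarith [sq_nonneg x]
  have := h.dist_le_mul x y
  simpa [Real.dist_eq] using this

/-- A bounded Lipschitz autonomous vector field has solutions on `[0, 3]`. -/
theorem exists_solution_of_bounded_lipschitz {E : Type*} [NormedAddCommGroup E]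
    [NormedSpace ℝ E] [CompleteSpace E] {f : E → E} {K L : ℝ}
    (hK : ∀ x y, ‖f x - f y‖ ≤ K * ‖x - y‖) (hL : ∀ x, ‖f x‖ ≤ L) (x₀ : E) :
    ∃ α : ℝ → E, α 0 = x₀ ∧ ∀ t ∈ Icc (0 : ℝ) 3, HasDerivAt α (f (α t)) t := by
  have hlip : LipschitzWith (Real.toNNReal K) f := LipschitzWith.of_dist_le' fun x y => by
    simpa [dist_eq_norm] using hK x y
  have hP : IsPicardLindelof (fun _ : ℝ => f) (tmin := -1) (tmax := 4) ⟨0, by norm_num, by norm_num⟩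
      x₀ (4 * Real.toNNReal L) 0 (Real.toNNReal L) (Real.toNNReal K) :=
    { lipschitzOnWith := fun t _ => hlip.lipschitzOnWith
      continuousOn := fun x _ => continuousOn_const
      norm_le := fun t _ x _ => (hL x).trans (Real.le_coe_toNNReal L)
      mul_max_le := by
        norm_num
        rw [mul_comm] }
  obtain ⟨α, h0, hα⟩ := hP.exists_eq_forall_mem_Icc_hasDerivWithinAt₀
  exact ⟨α, h0, fun t ht => (hα t ⟨by linarith [ht.1], by linarith [ht.2]⟩).hasDerivAt
    (Icc_mem_nhds (by linarith [ht.1]) (by linarith [ht.2]))⟩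

theorem abs_edge_sub_edge_le {N : ℕ} {h c D : ℝ} (hh : 0 < h) {φ ψ : ℕ → ℝ} (hD : 0 ≤ D)
    (hφ : ∀ i < N, |φ i - ψ i| ≤ D) (i : ℕ) :
    |edge N h c φ i - edge N h c ψ i| ≤ 2 / h * D := by
  rcases i with _ | i
  · simp; positivity
  by_cases hi : i + 1 < N
  · rw [edge_succ h c _ hi, edge_succ h c _ hi]
    have h1 := hφ (i + 1) hi
    have h2 := hφ i (by omega)
    have e : (φ (i + 1) - φ i) / h - (ψ (i + 1) - ψ i) / h
        = ((φ (i + 1) - ψ (i + 1)) - (φ i - ψ i)) / h := by ring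
    rw [e, abs_div, abs_of_pos hh, div_mul_eq_mul_div]
    gcongr
    refine (abs_sub _ _).trans ?_
    linarith
  · simp only [edge, hi, if_false, sub_self, abs_zero]; positivity

/-- Solutions of the lattice equation truncated at height `δ`. -/
theorem exists_truncated_lattice_flow {m c h δ : ℝ} {N : ℕ} (hm : 0 < m) (hh : 0 < h) (hδ : 0 < δ)
    (U₀ : ℕ → ℝ) : ∃ U : ℕ → ℝ → ℝ, (∀ i < N, U i 0 = U₀ i) ∧
      ∀ i < N, ∀ t ∈ Icc (0 : ℝ) 3, HasDerivAt (U i)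
        ((arctan (latW c h N U (i + 1) t) - arctan (latW c h N U i t)) / h -
          m / max (U i t) δ) t := by
  let ext : (Fin N → ℝ) → ℕ → ℝ := fun u i => if hi : i < N then u ⟨i, hi⟩ else 0
  let f : (Fin N → ℝ) → Fin N → ℝ := fun u i =>
    (arctan (edge N h c (ext u) (i + 1)) - arctan (edge N h c (ext u) i)) / h - m / max (u i) δ
  have hext : ∀ u v : Fin N → ℝ, ∀ i < N, |ext u i - ext v i| ≤ ‖u - v‖ := fun u v i hi => by
    simp only [ext, hi, dif_pos]
    exact norm_le_pi_norm (u - v) ⟨i, hi⟩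
  have hK : ∀ u v, ‖f u - f v‖ ≤ (4 / h ^ 2 + m / δ ^ 2) * ‖u - v‖ := fun u v => by
    refine (pi_norm_le_iff_of_nonneg (by positivity)).2 fun i => ?_
    have h1 : ∀ j, |arctan (edge N h c (ext u) j) - arctan (edge N h c (ext v) j)|
        ≤ 2 / h * ‖u - v‖ := fun j => (abs_arctan_sub_arctan_le _ _).trans
      (abs_edge_sub_edge_le hh (norm_nonneg _) (hext u v) j)
    have h2 : |m / max (u i) δ - m / max (v i) δ| ≤ m / δ ^ 2 * ‖u - v‖ := by
      have a1 : δ ≤ max (u i) δ := le_max_right _ _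
      have a2 : δ ≤ max (v i) δ := le_max_right _ _
      have a3 : |max (v i) δ - max (u i) δ| ≤ ‖u - v‖ := by
        refine (abs_max_sub_max_le_abs _ _ _).trans ?_
        rw [abs_sub_comm]
        exact norm_le_pi_norm (u - v) i
      have e : m / max (u i) δ - m / max (v i) δ
          = m / (max (u i) δ * max (v i) δ) * (max (v i) δ - max (u i) δ) := by
        have := (hδ.trans_le a1).ne'
        have := (hδ.trans_le a2).ne'
        field_simp
      rw [e, abs_mul, abs_of_pos (by have := hδ.trans_le a1; have := hδ.trans_le a2; positivity)]
      gcongr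
      nlinarith
    have e : (f u - f v) i = ((arctan (edge N h c (ext u) (i + 1))
        - arctan (edge N h c (ext v) (i + 1))) - (arctan (edge N h c (ext u) i)
        - arctan (edge N h c (ext v) i))) / h - (m / max (u i) δ - m / max (v i) δ) := by
      simp only [f, Pi.sub_apply]; ring
    rw [e, Real.norm_eq_abs]
    refine (abs_sub _ _).trans ?_
    rw [abs_div, abs_of_pos hh, add_mul]
    gcongr
    rw [div_le_iff₀ hh]
    refine (abs_sub _ _).trans ((add_le_add (h1 _) (h1 _)).trans_eq ?_)
    field_simp
    ring
  have hL : ∀ u, ‖f u‖ ≤ π / h + m / δ := fun u => by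
    refine (pi_norm_le_iff_of_nonneg (by positivity)).2 fun i => ?_
    refine (abs_sub _ _).trans (add_le_add ?_ ?_)
    · rw [abs_div, abs_of_pos hh]
      gcongr
      rw [abs_le]
      have a1 := arctan_lt_pi_div_two (edge N h c (ext u) (i + 1))
      have a2 := arctan_lt_pi_div_two (edge N h c (ext u) i)
      have a3 := neg_pi_div_two_lt_arctan (edge N h c (ext u) (i + 1))
      have a4 := neg_pi_div_two_lt_arctan (edge N h c (ext u) i)
      constructor <;> linarith
    · have a1 : δ ≤ max (u i) δ := le_max_right _ _
      rw [abs_of_pos (by have := hδ.trans_le a1; positivity)]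
      gcongr
  obtain ⟨α, h0, hα⟩ := exists_solution_of_bounded_lipschitz hK hL (fun i => U₀ i)
  refine ⟨fun i t => ext (α t) i, fun i hi => by simp [ext, hi, h0], fun i hi t ht => ?_⟩
  have := hasDerivAt_pi.1 (hα t ht) ⟨i, hi⟩
  simp only [f] at this
  simpa only [latW, ext, hi, dif_pos] using this

/-- A solution of the lattice equation truncated at height `η`. -/
structure TruncatedFlow (m c h η : ℝ) (N : ℕ) (U : ℕ → ℝ → ℝ) : Prop where
  hm : 0 < m
  hc : 0 ≤ c
  hh : 0 < h
  hη : 0 < η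
  hN : 0 < N
  der : ∀ i < N, ∀ t ∈ Icc (0 : ℝ) 3, HasDerivAt (U i)
    ((arctan (latW c h N U (i + 1) t) - arctan (latW c h N U i t)) / h - m / max (U i t) η) t

namespace TruncatedFlow

variable {m c h η : ℝ} {N : ℕ} {U : ℕ → ℝ → ℝ} (H : TruncatedFlow m c h η N U)
include H

theorem latticeFlow {δ t : ℝ} (hδ : η ≤ δ) (ht : t ≤ 3)
    (hU : ∀ s ∈ Icc 0 t, ∀ i < N, δ ≤ U i s) : LatticeFlow m c h N U δ t where
  hm := H.hm
  hN := H.hN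
  hh := H.hh
  hδ := H.hη.trans_le hδ
  pos := fun i hi s hs => hU s hs i hi
  der := fun i hi s hs => by
    have := H.der i hi s ⟨hs.1, hs.2.trans ht⟩
    rwa [max_eq_left (hδ.trans (hU s hs i hi))] at this

/-- The minimum of a lattice flow cannot decrease too fast. -/
theorem half_le {δ t₀ : ℝ} (hδ : 2 * η ≤ δ) (h0 : 0 ≤ t₀) (hU : ∀ i < N, δ ≤ U i t₀) :
    ∀ t ∈ Icc t₀ 3, t ≤ t₀ + δ ^ 2 / (16 * m) → ∀ i < N, δ / 2 ≤ U i t := by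
  intro t ht htle
  have hm := H.hm
  have hη := H.hη
  have hδ0 : 0 < δ := by linarith
  have hb : ∀ s ≤ t, 4 * m / δ * (s - t₀) ≤ δ / 4 := fun s hs => by
    calc _ ≤ 4 * m / δ * (δ ^ 2 / (16 * m)) := by gcongr; linarith
      _ = δ / 4 := by field_simp; ring
  have key := neg_of_no_first_contact (X := ℕ) (K := {j | j < N}) (a := t₀) (b := t)
    (D := fun i s => 3 / 4 * δ - 4 * m / δ * (s - t₀) - U i s)
    (Set.finite_lt_nat N).isCompact ?_ ?_ ?_ t ⟨ht.1, le_rfl⟩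
  · intro i hi
    have := key i hi
    linarith [hb t le_rfl]
  · rintro ⟨i, s⟩ ⟨hi, hs⟩
    have h1 := (H.der i hi s ⟨h0.trans hs.1, hs.2.trans ht.2⟩).continuousAt
    have h2 : ContinuousAt (fun p : ℕ × ℝ => U p.1 p.2) (i, s) := by
      have : (fun p : ℕ × ℝ => U p.1 p.2) =ᶠ[nhds (i, s)] fun p => U i p.2 := by
        rw [nhds_prod_eq, nhds_discrete]
        filter_upwards [prod_mem_prod (mem_pure.2 (mem_singleton i)) univ_mem] with p hp
        rw [show p.1 = i from hp.1]
      refine ContinuousAt.congr ?_ this.symm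
      exact ContinuousAt.comp (f := fun p : ℕ × ℝ => p.2) h1 continuousAt_snd
    have h3 : ContinuousAt (fun p : ℕ × ℝ => 3 / 4 * δ - 4 * m / δ * (p.2 - t₀)) (i, s) := by
      fun_prop
    exact (h3.sub h2).continuousWithinAt
  · intro i hi
    have := hU i hi
    simp only [sub_self, mul_zero]
    linarith
  · intro s hs i hi hcon hneg hle
    have hi : i < N := hi
    have hsI : s ∈ Icc (0 : ℝ) 3 := ⟨h0.trans hs.1.le, hs.2.trans ht.2⟩
    have hd := H.der i hi s hsI
    have hD := deriv_nonneg_of_first_contact hs.1 (((((hasDerivAt_id s).sub_const t₀).const_mul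
      (4 * m / δ)).const_sub (3 / 4 * δ)).sub hd) hcon (fun r hr => hneg r hr i hi)
    have hUi : δ / 2 ≤ U i s := by linarith [hb s hs.2]
    have hle' : ∀ j < N, U i s ≤ U j s := fun j hj => by
      have h1 := hle j hj
      linarith
    have hw1 : 0 ≤ latW c h N U (i + 1) s := by
      by_cases hi' : i + 1 < N
      · rw [latW, edge_succ h c _ hi']
        exact div_nonneg (by linarith [hle' _ hi']) H.hh.le
      · rw [latW, edge_of_le H.hN h c _ (by omega)]; exact H.hc
    have hw2 : latW c h N U i s ≤ 0 := by
      rcases i with _ | i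
      · simp [latW]
      · rw [latW, edge_succ h c _ hi]
        exact div_nonpos_of_nonpos_of_nonneg (by linarith [hle' i (by omega)]) H.hh.le
    have hflux : 0 ≤ (arctan (latW c h N U (i + 1) s) - arctan (latW c h N U i s)) / h :=
      div_nonneg (sub_nonneg.2 (arctan_mono (hw2.trans hw1))) H.hh.le
    have hmax : m / max (U i s) η ≤ m / (δ / 2) := by
      gcongr
      exact hUi.trans (le_max_left _ _)
    have e : m / (δ / 2) = 2 * m / δ := by field_simp
    have : 0 < 2 * m / δ := by positivity
    have e2 : 4 * m / δ = 2 * (2 * m / δ) := by ring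
    rw [e2] at hD
    linarith

end TruncatedFlow

/-- Admissible initial slopes: `w₀` vanishes at `0`, is bounded and nonnegative, and `arctan ∘ w₀`
has a Lipschitz derivative `α`. -/
structure InitialSlope (m c A u₀ B : ℝ) (w₀ α : ℝ → ℝ) : Prop where
  hm : 0 < m
  hA : 0 < A
  hu : 0 < u₀
  hB : 0 ≤ B
  zero : w₀ 0 = 0
  right : w₀ A = c
  nonneg : ∀ x ∈ Icc 0 A, 0 ≤ w₀ x
  le : ∀ x ∈ Icc 0 A, w₀ x ≤ B
  deriv : ∀ x, HasDerivAt (fun x => arctan (w₀ x)) (α x) x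
  deriv_le : ∀ x ∈ Icc 0 A, |α x| ≤ B
  deriv_lip : ∀ x ∈ Icc 0 A, ∀ y ∈ Icc 0 A, |α x - α y| ≤ B * |x - y|

/-- Discretised initial profile with slope `w₀`. -/
noncomputable def latInit (u₀ h : ℝ) (w₀ : ℝ → ℝ) (i : ℕ) : ℝ :=
  u₀ + h * ∑ j ∈ Finset.range i, w₀ (((j + 1 : ℕ) : ℝ) * h)

namespace InitialSlope

variable {m c A u₀ B h : ℝ} {w₀ α : ℝ → ℝ} (I : InitialSlope m c A u₀ B w₀ α)
include I

theorem hc : 0 ≤ c := by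
  rw [← I.right]; exact I.nonneg A ⟨I.hA.le, le_rfl⟩

theorem c_le : c ≤ B := by
  rw [← I.right]; exact I.le A ⟨I.hA.le, le_rfl⟩

variable {N : ℕ} (hh : 0 < h) (hNA : (N : ℝ) * h = A) (hN : 0 < N) {U : ℕ → ℝ → ℝ}
  (hU : ∀ i < N, U i 0 = latInit u₀ h w₀ i)

include hh hNA

omit I in
theorem node_mem {i : ℕ} (hi : i ≤ N) : (i : ℝ) * h ∈ Icc 0 A := by
  refine ⟨by positivity, ?_⟩
  rw [← hNA]
  gcongr

include hU

theorem le_initial {i : ℕ} (hi : i < N) : u₀ ≤ U i 0 := by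
  rw [hU i hi, latInit]
  have : 0 ≤ ∑ j ∈ Finset.range i, w₀ (((j + 1 : ℕ) : ℝ) * h) :=
    Finset.sum_nonneg fun j hj => I.nonneg _ (node_mem hh hNA (by
      have := Finset.mem_range.1 hj; omega))
  have := mul_nonneg hh.le this
  linarith

include hN

theorem latW_initial {i : ℕ} (hi : i ≤ N) : latW c h N U i 0 = w₀ (i * h) := by
  rcases i with _ | i
  · simp [latW, I.zero]
  by_cases hi' : i + 1 < N
  · rw [latW, edge_succ h c _ hi', hU _ hi', hU _ (by omega), latInit, latInit,
      Finset.sum_range_succ]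
    field_simp
    ring
  · have : i + 1 = N := by omega
    rw [latW, edge_of_le hN h c _ this.ge, this, hNA, I.right]

omit hN hU hNA in
theorem arctan_sub_initial (i : ℕ) : ∃ ξ ∈ Icc ((i : ℝ) * h) ((i + 1 : ℕ) * h),
    arctan (w₀ ((i + 1 : ℕ) * h)) - arctan (w₀ (i * h)) = h * α ξ := by
  have hlt : (i : ℝ) * h < (i + 1 : ℕ) * h := by push_cast; nlinarith
  obtain ⟨ξ, hξ, e⟩ := exists_hasDerivAt_eq_slope (fun x => arctan (w₀ x)) α hlt
    (fun x _ => (I.deriv x).continuousAt.continuousWithinAt) (fun x _ => I.deriv x)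
  refine ⟨ξ, Ioo_subset_Icc_self hξ, ?_⟩
  rw [eq_div_iff (sub_ne_zero.2 hlt.ne')] at e
  rw [← e]
  push_cast
  ring

theorem abs_latG_initial {i : ℕ} (hi : i < N) : |latG m c h N U i 0| ≤ B + m / u₀ := by
  obtain ⟨ξ, hξ, e⟩ := I.arctan_sub_initial hh i
  have hξ' : ξ ∈ Icc 0 A := ⟨(node_mem hh hNA hi.le).1.trans hξ.1,
    hξ.2.trans (node_mem hh hNA hi).2⟩
  have hUi := I.le_initial hh hNA hU hi
  have := I.hu
  have := I.hm
  rw [latG, I.latW_initial hh hNA hN hU hi.le, I.latW_initial hh hNA hN hU (i := i + 1) hi, e,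
    mul_div_cancel_left₀ _ hh.ne']
  refine (abs_sub _ _).trans (add_le_add (I.deriv_le ξ hξ') ?_)
  rw [abs_of_pos (by have := I.hu.trans_le hUi; positivity)]
  gcongr

theorem abs_latDG_initial {i : ℕ} (hi : i ≤ N) :
    |latDG m c h N U i 0| ≤ 2 * B + m * B / u₀ ^ 2 := by
  have hu := I.hu
  have hm := I.hm
  have hB := I.hB
  have hnn : 0 ≤ 2 * B + m * B / u₀ ^ 2 := by positivity
  rcases i with _ | i
  · simpa [latDG] using hnn
  by_cases hi' : i + 1 < N
  swap
  · rw [latDG, edge_of_le hN h 0 _ (by omega), abs_zero]; exact hnn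
  obtain ⟨ξ, hξ, e⟩ := I.arctan_sub_initial hh i
  obtain ⟨ξ', hξ', e'⟩ := I.arctan_sub_initial hh (i + 1)
  have hm1 : ξ ∈ Icc 0 A := ⟨(node_mem hh hNA (by omega)).1.trans hξ.1,
    hξ.2.trans (node_mem hh hNA hi).2⟩
  have hm2 : ξ' ∈ Icc 0 A := ⟨(node_mem hh hNA (by omega)).1.trans hξ'.1,
    hξ'.2.trans (node_mem hh hNA hi').2⟩
  have hU1 := I.le_initial hh hNA hU (show i < N by omega)
  have hU2 := I.le_initial hh hNA hU hi'
  have hw := I.latW_initial hh hNA hN hU hi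
  have hwb : |w₀ ((i + 1 : ℕ) * h)| ≤ B := by
    rw [abs_of_nonneg (I.nonneg _ (node_mem hh hNA hi))]
    exact I.le _ (node_mem hh hNA hi)
  have hpos1 := hu.trans_le hU1
  have hpos2 := hu.trans_le hU2
  have hwe : U (i + 1) 0 - U i 0 = h * w₀ ((i + 1 : ℕ) * h) := by
    rw [← hw, latW, edge_succ h c _ hi']; field_simp
  have eq : latDG m c h N U (i + 1) 0
      = (α ξ' - α ξ) / h + m / (U i 0 * U (i + 1) 0) * w₀ ((i + 1 : ℕ) * h) := by
    rw [latDG, edge_succ h 0 _ hi', latG, latG, I.latW_initial hh hNA hN hU (show i ≤ N by omega),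
      I.latW_initial hh hNA hN hU (i := i + 1 + 1) hi', hw, e, e']
    have : w₀ ((i + 1 : ℕ) * h) = (U (i + 1) 0 - U i 0) / h := by rw [hwe]; field_simp
    rw [this]
    field_simp
    ring
  rw [eq]
  refine (abs_add_le _ _).trans (add_le_add ?_ ?_)
  · rw [abs_div, abs_of_pos hh, div_le_iff₀ hh]
    refine (I.deriv_lip ξ' hm2 ξ hm1).trans ?_
    have : |ξ' - ξ| ≤ 2 * h := by
      have a1 := hξ.1; have a2 := hξ.2; have a3 := hξ'.1; have a4 := hξ'.2
      push_cast at a1 a2 a3 a4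
      rw [abs_le]; constructor <;> nlinarith
    nlinarith
  · rw [abs_mul, abs_of_pos (by positivity), mul_div_right_comm]
    gcongr
    nlinarith

end InitialSlope

/-- Bounds for a lattice flow on `[0, t]`, independent of the mesh size. -/
structure LatticeEstimates (m c h : ℝ) (N : ℕ) (U : ℕ → ℝ → ℝ) (δ t C : ℝ) (S : ℝ → ℝ) : Prop where
  flow : LatticeFlow m c h N U δ t
  nonneg : 0 ≤ C
  U_le : ∀ i < N, ∀ s ∈ Icc 0 t, |U i s| ≤ C
  g_le : ∀ i < N, ∀ s ∈ Icc 0 t, |latG m c h N U i s| ≤ C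
  w_le : ∀ i, ∀ s ∈ Icc 0 t, |latW c h N U i s| ≤ C
  w_last : ∀ s ∈ Icc 0 t, |c - latW c h N U (N - 1) s| ≤ C * h
  U_sub : ∀ s ∈ Icc 0 t, ∀ i < N, ∀ j < N, |U j s - U i s| ≤ C * (|(j : ℝ) - i| * h)
  taylor_U : ∀ s ∈ Icc 0 t, GridTaylor N h C (fun i => U i s) (fun i => latW c h N U i s)
  taylor_arctan : ∀ s ∈ Icc 0 t, GridTaylor N h C (fun i => arctan (latW c h N U i s))
    (fun i => latG m c h N U i s + m / U i s)
  dg_le : ∀ ε > 0, ∀ s ∈ Icc ε t, ∀ i ≤ N, |latDG m c h N U i s| ≤ S ε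
  taylor_g : ∀ ε > 0, ∀ s ∈ Icc ε t,
    GridTaylor N h (S ε) (fun i => latG m c h N U i s) (fun i => latDG m c h N U i s)

theorem GridTaylor.mono {N : ℕ} {h C C' : ℝ} (hC : C ≤ C') {φ ψ : ℕ → ℝ} (hh : 0 ≤ h)
    (H : GridTaylor N h C φ ψ) : GridTaylor N h C' φ ψ := fun i hi j hj =>
  (H i hi j hj).trans (by gcongr)

theorem BoundedLatticeFlow.abs_U_sub_le' {m c h δ T M : ℝ} {N : ℕ} {U : ℕ → ℝ → ℝ}
    (H : BoundedLatticeFlow m c h N U δ T M) {t : ℝ} (ht : t ∈ Icc 0 T) {i j : ℕ} (hi : i < N)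
    (hj : j < N) : |U j t - U i t| ≤ M * (|(j : ℝ) - i| * h) := by
  rcases le_total i j with hij | hij
  · have := H.abs_U_sub_le ht hij hj
    rwa [mul_comm, abs_of_nonneg (a := (j : ℝ) - i) (sub_nonneg.2 (by exact_mod_cast hij))]
  · have := H.abs_U_sub_le ht hij hi
    rw [abs_sub_comm, abs_sub_comm (j : ℝ)]
    rwa [mul_comm, abs_of_nonneg (a := (i : ℝ) - j) (sub_nonneg.2 (by exact_mod_cast hij))]

namespace InitialSlope

variable {m c A u₀ B : ℝ} {w₀ α : ℝ → ℝ} (I : InitialSlope m c A u₀ B w₀ α)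
include I

theorem init_le {h : ℝ} {N i : ℕ} (hh : 0 < h) (hNA : (N : ℝ) * h = A) (hi : i < N) :
    latInit u₀ h w₀ i ≤ u₀ + A * B := by
  have hB := I.hB
  have h1 : ∑ j ∈ Finset.range i, w₀ (((j + 1 : ℕ) : ℝ) * h) ≤ N * B := by
    have : ∑ j ∈ Finset.range i, w₀ (((j + 1 : ℕ) : ℝ) * h) ≤ ∑ j ∈ Finset.range i, B :=
      Finset.sum_le_sum fun j hj => I.le _ (node_mem hh hNA (by
        have := Finset.mem_range.1 hj; omega))
    refine this.trans ?_
    rw [Finset.sum_const, Finset.card_range, nsmul_eq_mul]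
    gcongr
  rw [latInit, ← hNA]
  nlinarith

theorem exists_estimates {δ : ℝ} (hδ : 0 < δ) : ∃ C : ℝ, ∃ S : ℝ → ℝ,
    ∀ (h η t : ℝ) (N : ℕ) (U : ℕ → ℝ → ℝ), TruncatedFlow m c h η N U → η ≤ δ → (N : ℝ) * h = A →
      (∀ i < N, U i 0 = latInit u₀ h w₀ i) → 0 ≤ t → t ≤ 3 →
      (∀ s ∈ Icc 0 t, ∀ i < N, δ ≤ U i s) → LatticeEstimates m c h N U δ t C S := by
  have hm := I.hm
  have hA := I.hA
  have hB := I.hB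
  have hu := I.hu
  obtain ⟨e, he⟩ : ∃ e, e = exp (m / δ ^ 2 * 3) := ⟨_, rfl⟩
  obtain ⟨M, hM⟩ : ∃ M, M = 4 + A + m + 1 / δ + m / δ ^ 2 + (B + m / u₀) * e + B * e := ⟨_, rfl⟩
  obtain ⟨G, hG⟩ : ∃ G, G = 2 * B + m * B / u₀ ^ 2 := ⟨_, rfl⟩
  obtain ⟨B', hB'⟩ : ∃ B', B' = (1 + M * G ^ 2) * exp (16 * M ^ 8 * (M ^ 3 + M * (1 + M ^ 4))) :=
    ⟨_, rfl⟩
  obtain ⟨K, hK⟩ : ∃ K, K = 2 * (1 + B') *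
      exp ((16 * M ^ 8 * (1 + B') ^ 2 + M * (16 * M ^ 8 * B' + 4 * M ^ 9)) * M) := ⟨_, rfl⟩
  have he0 : 0 < e := he ▸ exp_pos _
  have p1 : 0 < 1 / δ := by positivity
  have p2 : 0 < m / δ ^ 2 := by positivity
  have p3 : 0 ≤ (B + m / u₀) * e := by positivity
  have p4 : 0 ≤ B * e := by positivity
  have hM1 : 4 ≤ M := by linarith
  obtain ⟨Q, hQ⟩ : ∃ Q, Q = √(4 * M ^ 2 * B') + M ^ 5 := ⟨_, rfl⟩
  set S₁ : ℝ → ℝ := fun ε => 2 * M ^ 2 * √(2 * M ^ 6 * (1 + K / ε)) with hS₁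
  set S₂ : ℝ → ℝ := fun ε => 2 * M ^ 2 * √(2 * (K / ε) + 2 * M ^ 5)
    + 8 * M ^ 6 * √(2 * M ^ 6 * (1 + K / ε)) with hS₂
  refine ⟨4 * M ^ 5 + Q + (u₀ + A * B + 3 * M), fun ε => S₁ ε + S₂ ε,
    fun h η t N U H hη hNA hU ht0 ht hlow => ?_⟩
  have hh := H.hh
  have hN := H.hN
  have L := H.latticeFlow hη ht hlow
  have hexp : ∀ s ∈ Icc 0 t, exp (m / δ ^ 2 * s) ≤ e := fun s hs => by
    rw [he]; gcongr; linarith [hs.2]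
  have Bd : BoundedLatticeFlow m c h N U δ t M :=
    { L with
      one_le := by linarith
      length_le := by rw [hNA]; linarith
      m_le := by linarith
      inv_le := by linarith
      coeff_le := by linarith
      time_le := by linarith
      g_le := fun i hi s hs => by
        refine (L.abs_g_le (B := B + m / u₀) (by positivity)
          (fun i hi => I.abs_latG_initial hh hNA hN hU hi) i hi s hs).trans ?_
        have : (B + m / u₀) * exp (m / δ ^ 2 * s) ≤ (B + m / u₀) * e := by
          gcongr; exact hexp s hs
        linarith
      w_le := fun i s hs => by
        refine (L.abs_w_le hB (by rw [abs_of_nonneg I.hc]; exact I.c_le)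
          (fun i hi => ?_) i s hs).trans ?_
        · rw [I.latW_initial hh hNA hN hU hi.le, abs_of_nonneg (I.nonneg _ (node_mem hh hNA hi.le))]
          exact I.le _ (node_mem hh hNA hi.le)
        · have : B * exp (m / δ ^ 2 * s) ≤ B * e := by gcongr; exact hexp s hs
          linarith }
  have hE0 : latE m c h N U 0 ≤ M * G ^ 2 := by
    rw [latE]
    refine Bd.sum_le (by positivity) fun i hi => ?_
    have h1 := I.abs_latDG_initial hh hNA hN hU hi.le
    have h2 : latF m c h N U i 0 * latDG m c h N U i 0
        = latDG m c h N U i 0 ^ 2 / (1 + latW c h N U i 0 ^ 2) := by rw [latF]; ring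
    have h3 : latDG m c h N U i 0 ^ 2 / (1 + latW c h N U i 0 ^ 2) ≤ latDG m c h N U i 0 ^ 2 :=
      div_le_self (sq_nonneg _) (by nlinarith [sq_nonneg (latW c h N U i 0)])
    have h4 : latDG m c h N U i 0 ^ 2 ≤ G ^ 2 := by
      rw [← sq_abs, hG]; gcongr
    rw [h2]
    linarith [sq_nonneg G]
  have hE : ∀ s ∈ Icc 0 t, latE m c h N U s ≤ B' := fun s hs => hB' ▸ Bd.E_le hE0 hs
  have hB'0 : 0 ≤ B' := by rw [hB']; positivity
  have hK0 : 0 ≤ K := by rw [hK]; positivity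
  have hS : ∀ ε > 0, ∀ s ∈ Icc ε t, latS m c h N U s ≤ K / ε := fun ε hε s hs => by
    have h1 := Bd.mul_S_le hE (t := s) ⟨hε.le.trans hs.1, hs.2⟩
    rw [← hK] at h1
    have h2 := Bd.S_nonneg s
    rw [le_div_iff₀ hε]
    linarith [mul_le_mul_of_nonneg_right hs.1 h2]
  have hQ0 : 0 ≤ Q := by rw [hQ]; positivity
  have hMM : M ≤ 4 * M ^ 5 := by
    have : M ≤ M ^ 5 := le_self_pow₀ (by linarith) (by norm_num)
    nlinarith
  have hr : 0 ≤ u₀ + A * B + 3 * M := by positivity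
  refine ⟨L, by positivity, fun i hi s hs => ?_, fun i hi s hs => ?_, fun i s hs => ?_,
    fun s hs => ?_, fun s hs i hi j hj => ?_, fun s hs => ?_, fun s hs => ?_,
    fun ε hε s hs i hi => ?_, fun ε hε s hs => ?_⟩
  · have h1 := L.U_pos hs hi
    rw [abs_of_pos h1]
    have h2 := le_add_mul_of_deriv_le (f := U i) (k := M) hs.1
      (fun r hr => L.der i hi r ⟨hr.1, hr.2.trans hs.2⟩)
      (fun r hr => (le_abs_self _).trans (Bd.g_le i hi r ⟨hr.1.le, hr.2.le.trans hs.2⟩))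
    have h3 := I.init_le hh hNA hi
    rw [hU i hi] at h2
    have h4 : M * (s - 0) ≤ M * 3 := by gcongr; linarith [hs.2]
    have : 0 < M ^ 5 := by positivity
    linarith
  · exact (Bd.g_le i hi s hs).trans (by linarith)
  · exact (Bd.w_le i s hs).trans (by linarith)
  · have h1 := Bd.abs_w_sub_le hs (i := N - 1) (j := N) (by omega) le_rfl
    rw [L.w_N le_rfl] at h1
    refine h1.trans ?_
    have : ((N : ℝ) - (N - 1 : ℕ)) = 1 := by
      rw [Nat.cast_sub (by omega)]; simp
    rw [this, one_mul, mul_comm]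
    gcongr
    have : M ^ 4 ≤ M ^ 5 := pow_le_pow_right₀ (by linarith) (by norm_num)
    linarith
  · refine (Bd.abs_U_sub_le' hs hi hj).trans ?_
    gcongr
    linarith
  · exact (Bd.gridTaylor_U hs).mono (by linarith) hh.le
  · exact (Bd.gridTaylor_arctan hs (hE s hs)).mono
      (by rw [← hQ]; linarith [pow_pos (by linarith : 0 < M) 5]) hh.le
  · refine (Bd.abs_dg_le ⟨hε.le.trans hs.1, hs.2⟩ (hS ε hε s hs) hi).trans ?_
    have : 0 ≤ S₂ ε := by simp only [hS₂]; positivity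
    simp only [hS₁] at *
    linarith
  · refine (Bd.gridTaylor_g ⟨hε.le.trans hs.1, hs.2⟩ (hS ε hε s hs)).mono ?_ hh.le
    have : 0 ≤ S₁ ε := by simp only [hS₁]; positivity
    simp only [hS₂] at *
    linarith

end InitialSlope

/-- Limit along a fixed free ultrafilter. -/
noncomputable def ulim (a : ℕ → ℝ) : ℝ := limUnder (hyperfilter ℕ : Filter ℕ) a

theorem tendsto_ulim {a : ℕ → ℝ} {C : ℝ} (h : ∀ᶠ k in (hyperfilter ℕ : Filter ℕ), |a k| ≤ C) :
    Tendsto a (hyperfilter ℕ) (nhds (ulim a)) := by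
  have h1 : ((hyperfilter ℕ).map a : Filter ℝ) ≤ principal (Icc (-C) C) := by
    rw [le_principal_iff, Ultrafilter.coe_map, mem_map]
    filter_upwards [h] with k hk
    exact abs_le.1 hk
  obtain ⟨l, -, hl⟩ := isCompact_Icc.ultrafilter_le_nhds _ h1
  exact tendsto_nhds_limUnder ⟨l, hl⟩

/-- Mesh size of the `k`-th grid on `[0, A]`. -/
noncomputable def mesh (A : ℝ) (k : ℕ) : ℝ := A / (k + 1)

/-- The grid index just below `x`. -/
noncomputable def node (A : ℝ) (x : ℝ) (k : ℕ) : ℕ := min ⌊x / mesh A k⌋₊ k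

theorem mesh_pos {A : ℝ} (hA : 0 < A) (k : ℕ) : 0 < mesh A k := by
  rw [mesh]; positivity

theorem mul_mesh (A : ℝ) (k : ℕ) : ((k + 1 : ℕ) : ℝ) * mesh A k = A := by
  rw [mesh]; push_cast; field_simp

theorem tendsto_mesh (A : ℝ) : Tendsto (mesh A) (hyperfilter ℕ) (nhds 0) :=
  (tendsto_const_div_atTop_nhds_zero_nat A |>.comp (tendsto_add_atTop_nat 1)
    |>.congr fun k => by simp [mesh]).mono_left Nat.hyperfilter_le_atTop

theorem node_lt (A x : ℝ) (k : ℕ) : node A x k < k + 1 :=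
  (min_le_right _ _).trans_lt (Nat.lt_succ_self k)

theorem node_zero (A : ℝ) (k : ℕ) : node A 0 k = 0 := by simp [node]

theorem node_right {A : ℝ} (hA : 0 < A) (k : ℕ) : node A A k = k := by
  have : A / mesh A k = (k + 1 : ℕ) := by
    rw [div_eq_iff (mesh_pos hA k).ne', mul_mesh]
  rw [node, this, Nat.floor_natCast]
  simp

theorem abs_node_sub_le {A x : ℝ} (hA : 0 < A) (hx : x ∈ Icc 0 A) (k : ℕ) :
    |node A x k * mesh A k - x| ≤ mesh A k := by
  have hm := mesh_pos hA k
  have h0 : 0 ≤ x / mesh A k := div_nonneg hx.1 hm.le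
  have h1 := Nat.floor_le h0
  have h2 := Nat.lt_floor_add_one (x / mesh A k)
  rw [le_div_iff₀ hm] at h1
  rw [div_lt_iff₀ hm] at h2
  rcases le_total ⌊x / mesh A k⌋₊ k with h | h
  · rw [node, min_eq_left h, abs_le]
    constructor <;> linarith
  · rw [node, min_eq_right h, abs_le]
    have h3 : (k : ℝ) ≤ ⌊x / mesh A k⌋₊ := by exact_mod_cast h
    have h4 := mul_mesh A k
    push_cast at h4
    have h5 := mul_le_mul_of_nonneg_right h3 hm.le
    constructor <;> linarith [hx.2]

theorem tendsto_node {A x : ℝ} (hA : 0 < A) (hx : x ∈ Icc 0 A) :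
    Tendsto (fun k => node A x k * mesh A k) (hyperfilter ℕ) (nhds x) := by
  rw [tendsto_iff_dist_tendsto_zero]
  exact squeeze_zero (fun k => dist_nonneg) (fun k => by
    rw [Real.dist_eq]; exact abs_node_sub_le hA hx k) (tendsto_mesh A)

/-- First order Taylor expansion on `[0, A]` with uniform remainder of order `3/2`. -/
def TaylorOn (A C : ℝ) (φ ψ : ℝ → ℝ) : Prop :=
  ∀ x ∈ Icc 0 A, ∀ y ∈ Icc 0 A, |φ y - φ x - (y - x) * ψ x| ≤ C * √|y - x| * |y - x|

theorem TaylorOn.hasDerivWithinAt {A C : ℝ} {φ ψ : ℝ → ℝ} (H : TaylorOn A C φ ψ) {x : ℝ}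
    (hx : x ∈ Icc 0 A) : HasDerivWithinAt φ (ψ x) (Icc 0 A) x := by
  rw [hasDerivWithinAt_iff_isLittleO, Asymptotics.isLittleO_iff]
  intro ε hε
  have hc : ContinuousAt (fun y => C * √|y - x|) x := by fun_prop
  have h1 : ∀ᶠ y in nhds x, C * √|y - x| < ε := hc.eventually_lt_const (by simpa using hε)
  filter_upwards [self_mem_nhdsWithin, nhdsWithin_le_nhds h1] with y hy hy1
  rw [smul_eq_mul, Real.norm_eq_abs, Real.norm_eq_abs]
  refine (H x hx y hy).trans ?_
  gcongr

theorem taylorOn_of_grid {A C : ℝ} (hA : 0 < A) {φ ψ : ℕ → ℕ → ℝ} {Φ Ψ : ℝ → ℝ}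
    (hT : ∀ᶠ k in (hyperfilter ℕ : Filter ℕ), GridTaylor (k + 1) (mesh A k) C (φ k) (ψ k))
    (hφ : ∀ x ∈ Icc 0 A, Tendsto (fun k => φ k (node A x k)) (hyperfilter ℕ) (nhds (Φ x)))
    (hψ : ∀ x ∈ Icc 0 A, Tendsto (fun k => ψ k (node A x k)) (hyperfilter ℕ) (nhds (Ψ x))) :
    TaylorOn A C Φ Ψ := by
  intro x hx y hy
  have hd : Tendsto (fun k => ((node A y k : ℝ) - node A x k) * mesh A k) (hyperfilter ℕ)
      (nhds (y - x)) := by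
    refine ((tendsto_node hA hy).sub (tendsto_node hA hx)).congr fun k => ?_
    ring
  have ha : Tendsto (fun k => |(node A y k : ℝ) - node A x k| * mesh A k) (hyperfilter ℕ)
      (nhds |y - x|) := by
    refine hd.abs.congr fun k => ?_
    rw [abs_mul, abs_of_pos (mesh_pos hA k)]
  refine le_of_tendsto_of_tendsto (((hφ y hy).sub (hφ x hx)).sub (hd.mul (hψ x hx))).abs
    ((ha.sqrt.const_mul C).mul ha) ?_
  filter_upwards [hT] with k hk
  exact hk _ (node_lt A x k) _ (node_lt A y k)

theorem eq_of_taylorOn {A C x a : ℝ} (hA : 0 < A) {φ ψ : ℝ → ℝ} (H : TaylorOn A C φ ψ)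
    (hx : x ∈ Icc 0 A) (ha : HasDerivWithinAt φ a (Icc 0 A) x) : ψ x = a :=
  (uniqueDiffOn_Icc hA x hx).eq_deriv _ (H.hasDerivWithinAt hx) ha

/-- If the limit function is differentiable then the discrete derivatives converge. -/
theorem tendsto_of_grid {A C C' : ℝ} (hA : 0 < A) {φ ψ : ℕ → ℕ → ℝ} {Φ : ℝ → ℝ}
    (hT : ∀ᶠ k in (hyperfilter ℕ : Filter ℕ), GridTaylor (k + 1) (mesh A k) C (φ k) (ψ k))
    (hφ : ∀ x ∈ Icc 0 A, Tendsto (fun k => φ k (node A x k)) (hyperfilter ℕ) (nhds (Φ x)))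
    (hψ : ∀ᶠ k in (hyperfilter ℕ : Filter ℕ), ∀ i < k + 1, |ψ k i| ≤ C') {x a : ℝ}
    (hx : x ∈ Icc 0 A) (ha : HasDerivWithinAt Φ a (Icc 0 A) x) :
    Tendsto (fun k => ψ k (node A x k)) (hyperfilter ℕ) (nhds a) := by
  have h1 : ∀ x, Tendsto (fun k => ψ k (node A x k)) (hyperfilter ℕ)
      (nhds (ulim fun k => ψ k (node A x k))) := fun x => tendsto_ulim (C := C') (by
    filter_upwards [hψ] with k hk
    exact hk _ (node_lt A x k))
  have h2 := taylorOn_of_grid hA hT hφ fun x _ => h1 x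
  rw [← eq_of_taylorOn hA h2 hx ha]
  exact h1 x

/-- Uniform Taylor expansions propagate joint continuity to the derivative. -/
theorem continuousOn_of_taylorOn {A C : ℝ} (hA : 0 < A) {K : Set ℝ}
    {φ ψ : ℝ → ℝ → ℝ}
    (hφ : ContinuousOn (fun p : ℝ × ℝ => φ p.1 p.2) (Icc 0 A ×ˢ K))
    (hT : ∀ t ∈ K, TaylorOn A C (fun x => φ x t) (fun x => ψ x t)) :
    ContinuousOn (fun p : ℝ × ℝ => ψ p.1 p.2) (Icc 0 A ×ˢ K) := by
  rintro ⟨x, t⟩ ⟨hx, ht⟩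
  simp only at hx ht
  rw [Metric.continuousWithinAt_iff']
  intro ε hε
  obtain ⟨x', hx', hne, hsmall⟩ : ∃ x' ∈ Icc 0 A, x' ≠ x ∧ C * √|x' - x| < ε / 2 := by
    have hc : ContinuousAt (fun y => C * √|y - x|) x := by fun_prop
    obtain ⟨r, hr, hr'⟩ := Metric.eventually_nhds_iff.1
      (hc.eventually_lt_const (u := ε / 2) (by simpa using hε))
    rcases lt_or_ge x A with h | h
    · refine ⟨x + min (r / 2) (A - x), ⟨?_, ?_⟩, ?_, hr' ?_⟩
      · have : 0 < min (r / 2) (A - x) := lt_min (by linarith) (by linarith)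
        linarith [hx.1]
      · linarith [min_le_right (r / 2) (A - x)]
      · have : 0 < min (r / 2) (A - x) := lt_min (by linarith) (by linarith)
        linarith
      · have : 0 < min (r / 2) (A - x) := lt_min (by linarith) (by linarith)
        rw [Real.dist_eq, add_sub_cancel_left, abs_of_pos this]
        linarith [min_le_left (r / 2) (A - x)]
    · have hxA : x = A := le_antisymm hx.2 h
      have : 0 < min (r / 2) A := lt_min (by linarith) hA
      refine ⟨x - min (r / 2) A, ⟨?_, ?_⟩, ?_, hr' ?_⟩
      · linarith [min_le_right (r / 2) A]
      · linarith
      · linarith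
      · rw [Real.dist_eq, sub_sub_cancel_left, abs_neg, abs_of_pos this]
        linarith [min_le_left (r / 2) A]
  have hq : ContinuousWithinAt (fun p : ℝ × ℝ => (φ x' p.2 - φ p.1 p.2) / (x' - p.1))
      (Icc 0 A ×ˢ K) (x, t) := by
    refine ContinuousWithinAt.div (ContinuousWithinAt.sub ?_ (hφ (x, t) ⟨hx, ht⟩)) ?_
      (sub_ne_zero.2 hne)
    · exact ContinuousWithinAt.comp (g := fun p : ℝ × ℝ => φ p.1 p.2)
        (f := fun p : ℝ × ℝ => (x', p.2))
        (t := Icc 0 A ×ˢ K) (hφ (x', t) ⟨hx', ht⟩) (by fun_prop) fun p hp => ⟨hx', hp.2⟩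
    · fun_prop
  have hr : ContinuousWithinAt (fun p : ℝ × ℝ => |(φ x' p.2 - φ p.1 p.2) / (x' - p.1)
      - (φ x' t - φ x t) / (x' - x)| + C * √|x' - p.1| + C * √|x' - x|) (Icc 0 A ×ˢ K) (x, t) := by
    refine ((hq.sub continuousWithinAt_const).abs.add ?_).add continuousWithinAt_const
    fun_prop
  have hev := hr.tendsto.eventually_lt_const (u := ε) (by
    simp only [sub_self, abs_zero]; linarith)
  have hne' : ∀ᶠ p : ℝ × ℝ in nhdsWithin (x, t) (Icc 0 A ×ˢ K), p.1 ≠ x' :=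
    nhdsWithin_le_nhds ((continuousAt_fst (p := (x, t))).eventually_ne hne.symm)
  filter_upwards [hev, hne', self_mem_nhdsWithin] with p hp hpne hpm
  have key : ∀ y ∈ Icc 0 A, y ≠ x' → ∀ s ∈ K, |ψ y s - (φ x' s - φ y s) / (x' - y)|
      ≤ C * √|x' - y| := by
    intro y hy hyne s hs
    have h := hT s hs y hy x' hx'
    have hpos : 0 < |x' - y| := abs_pos.2 (sub_ne_zero.2 hyne.symm)
    refine le_of_mul_le_mul_right ?_ hpos
    refine le_trans (le_of_eq ?_) h
    rw [← abs_mul, abs_sub_comm, mul_comm]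
    simp only
    have : x' - y ≠ 0 := sub_ne_zero.2 hyne.symm
    congr 1
    field_simp
  have k1 := key p.1 hpm.1 hpne p.2 hpm.2
  have k2 := key x hx hne.symm t ht
  rw [Real.dist_eq]
  refine lt_of_le_of_lt ?_ hp
  have e : ψ p.1 p.2 - ψ x t = ((φ x' p.2 - φ p.1 p.2) / (x' - p.1)
      - (φ x' t - φ x t) / (x' - x)) + (ψ p.1 p.2 - (φ x' p.2 - φ p.1 p.2) / (x' - p.1))
      - (ψ x t - (φ x' t - φ x t) / (x' - x)) := by ring
  rw [e]
  exact (abs_sub _ _).trans (add_le_add ((abs_add_le _ _).trans (add_le_add le_rfl k1)) k2)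

/-- A mean value identity with continuous right hand side yields differentiability. -/
theorem hasDerivAt_of_mean_value {f g : ℝ → ℝ} {a b t : ℝ} (ht : t ∈ Ioo a b)
    (hm : ∀ s ∈ Ioo a b, ∃ σ ∈ uIcc t s, f s - f t = (s - t) * g σ) (hg : ContinuousAt g t) :
    HasDerivAt f (g t) t := by
  rw [hasDerivAt_iff_isLittleO, Asymptotics.isLittleO_iff]
  intro ε hε
  obtain ⟨r, hr, hr'⟩ := Metric.continuousAt_iff.1 hg ε hε
  filter_upwards [Ioo_mem_nhds ht.1 ht.2, Metric.ball_mem_nhds t hr] with s hs hs'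
  obtain ⟨σ, hσ, e⟩ := hm s hs
  have h1 : |σ - t| ≤ |s - t| := abs_sub_left_of_mem_uIcc hσ
  rw [smul_eq_mul, e, ← mul_sub, Real.norm_eq_abs, Real.norm_eq_abs, abs_mul, mul_comm]
  gcongr
  have := hr' (x := σ) (by rw [Real.dist_eq]; exact h1.trans_lt (by rwa [← Real.dist_eq]))
  rw [← Real.dist_eq]
  exact this.le

section LimitFlow

variable (m c A : ℝ) (U : ℕ → ℕ → ℝ → ℝ)

/-- Limit of the lattice solutions. -/
noncomputable def limU (x t : ℝ) : ℝ := ulim fun k => U k (node A x k) t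

/-- Limit of the lattice slopes. -/
noncomputable def limW (x t : ℝ) : ℝ :=
  ulim fun k => latW c (mesh A k) (k + 1) (U k) (node A x k) t

/-- Limit of the lattice velocities. -/
noncomputable def limG (x t : ℝ) : ℝ :=
  ulim fun k => latG m c (mesh A k) (k + 1) (U k) (node A x k) t

/-- Limit of the slopes of the lattice velocities. -/
noncomputable def limD (x t : ℝ) : ℝ :=
  ulim fun k => latDG m c (mesh A k) (k + 1) (U k) (node A x k) t

/-- Eventual uniform estimates on `[0, b]` for a sequence of lattice flows. -/
structure UniformFlow (δ b C : ℝ) (S : ℝ → ℝ) : Prop where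
  hA : 0 < A
  hδ : 0 < δ
  est : ∀ᶠ k in (hyperfilter ℕ : Filter ℕ),
    LatticeEstimates m c (mesh A k) (k + 1) (U k) δ b C S

end LimitFlow

theorem LatticeFlow.exists_mean_value {f f' : ℝ → ℝ} {s t b : ℝ} (hs : s ∈ Icc 0 b)
    (ht : t ∈ Icc 0 b) (hf : ∀ r ∈ Icc 0 b, HasDerivAt f (f' r) r) :
    ∃ σ ∈ uIcc s t, f t - f s = (t - s) * f' σ := by
  have key : ∀ {s t : ℝ}, s ∈ Icc 0 b → t ∈ Icc 0 b → s < t →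
      ∃ σ ∈ uIcc s t, f t - f s = (t - s) * f' σ := by
    intro s t hs ht h
    obtain ⟨σ, hσ, e⟩ := exists_hasDerivAt_eq_slope f f' h
      (fun r hr => (hf r ⟨hs.1.trans hr.1, hr.2.trans ht.2⟩).continuousAt.continuousWithinAt)
      (fun r hr => hf r ⟨hs.1.trans hr.1.le, hr.2.le.trans ht.2⟩)
    refine ⟨σ, Icc_subset_uIcc (Ioo_subset_Icc_self hσ), ?_⟩
    rw [e, mul_div_cancel₀ _ (sub_ne_zero.2 h.ne')]
  rcases lt_trichotomy s t with h | rfl | h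
  · exact key hs ht h
  · exact ⟨s, left_mem_uIcc, by simp⟩
  · obtain ⟨σ, hσ, e⟩ := key ht hs h
    exact ⟨σ, uIcc_comm s t ▸ hσ, by linarith⟩

namespace UniformFlow

variable {m c A δ b C : ℝ} {U : ℕ → ℕ → ℝ → ℝ} {S : ℝ → ℝ} (H : UniformFlow m c A U δ b C S)
include H

theorem tendsto_U {t : ℝ} (ht : t ∈ Icc 0 b) (x : ℝ) :
    Tendsto (fun k => U k (node A x k) t) (hyperfilter ℕ) (nhds (limU A U x t)) :=
  tendsto_ulim (C := C) <| H.est.mono fun k hk => hk.U_le _ (node_lt A x k) t ht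

theorem tendsto_W {t : ℝ} (ht : t ∈ Icc 0 b) (x : ℝ) :
    Tendsto (fun k => latW c (mesh A k) (k + 1) (U k) (node A x k) t) (hyperfilter ℕ)
      (nhds (limW c A U x t)) :=
  tendsto_ulim (C := C) <| H.est.mono fun _ hk => hk.w_le _ t ht

theorem tendsto_G {t : ℝ} (ht : t ∈ Icc 0 b) (x : ℝ) :
    Tendsto (fun k => latG m c (mesh A k) (k + 1) (U k) (node A x k) t) (hyperfilter ℕ)
      (nhds (limG m c A U x t)) :=
  tendsto_ulim (C := C) <| H.est.mono fun k hk => hk.g_le _ (node_lt A x k) t ht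

theorem tendsto_D {t : ℝ} (ht : t ∈ Ioc 0 b) (x : ℝ) :
    Tendsto (fun k => latDG m c (mesh A k) (k + 1) (U k) (node A x k) t) (hyperfilter ℕ)
      (nhds (limD m c A U x t)) :=
  tendsto_ulim (C := S t) <| H.est.mono fun k hk =>
    hk.dg_le t ht.1 t ⟨le_rfl, ht.2⟩ _ (node_lt A x k).le

theorem le_U {t : ℝ} (ht : t ∈ Icc 0 b) (x : ℝ) : δ ≤ limU A U x t :=
  ge_of_tendsto (H.tendsto_U ht x) <| H.est.mono fun k hk => hk.flow.pos _ (node_lt A x k) t ht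

theorem tendsto_inv_U {σ : ℕ → ℝ} {t x : ℝ} (ht : t ∈ Icc 0 b)
    (h : Tendsto (fun k => U k (node A x k) (σ k)) (hyperfilter ℕ) (nhds (limU A U x t))) :
    Tendsto (fun k => m / U k (node A x k) (σ k)) (hyperfilter ℕ) (nhds (m / limU A U x t)) :=
  tendsto_const_nhds.div h (H.hδ.trans_le (H.le_U ht x)).ne'

theorem taylor_U {t : ℝ} (ht : t ∈ Icc 0 b) :
    TaylorOn A C (fun x => limU A U x t) (fun x => limW c A U x t) :=
  taylorOn_of_grid H.hA (H.est.mono fun _ hk => hk.taylor_U t ht)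
    (fun x _ => H.tendsto_U ht x) (fun x _ => H.tendsto_W ht x)

theorem taylor_arctan {t : ℝ} (ht : t ∈ Icc 0 b) :
    TaylorOn A C (fun x => arctan (limW c A U x t))
      (fun x => limG m c A U x t + m / limU A U x t) :=
  taylorOn_of_grid H.hA (H.est.mono fun _ hk => hk.taylor_arctan t ht)
    (fun x _ => (continuous_arctan.tendsto _).comp (H.tendsto_W ht x))
    (fun x _ => (H.tendsto_G ht x).add (H.tendsto_inv_U ht (H.tendsto_U ht x)))

theorem taylor_G {ε t : ℝ} (hε : 0 < ε) (ht : t ∈ Icc ε b) :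
    TaylorOn A (S ε) (fun x => limG m c A U x t) (fun x => limD m c A U x t) :=
  have ht0 : 0 < t := hε.trans_le ht.1
  taylorOn_of_grid H.hA (H.est.mono fun _ hk => hk.taylor_g ε hε t ht)
    (fun x _ => H.tendsto_G ⟨ht0.le, ht.2⟩ x) (fun x _ => H.tendsto_D ⟨ht0, ht.2⟩ x)

section Seq

variable {σ : ℕ → ℝ} (hσ : ∀ k, σ k ∈ Icc 0 b) {t : ℝ}
  (hlim : Tendsto σ (hyperfilter ℕ) (nhds t)) (ht : t ∈ Icc 0 b)
include hσ hlim ht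

theorem tendsto_U_seq (x : ℝ) :
    Tendsto (fun k => U k (node A x k) (σ k)) (hyperfilter ℕ) (nhds (limU A U x t)) := by
  have h1 : Tendsto (fun k => U k (node A x k) (σ k) - U k (node A x k) t)
      (hyperfilter ℕ) (nhds 0) := by
    rw [tendsto_zero_iff_abs_tendsto_zero]
    have h2 : Tendsto (fun k => |σ k - t| * C) (hyperfilter ℕ) (nhds 0) := by
      have := ((hlim.sub_const t).abs).mul_const C
      simpa using this
    refine tendsto_of_tendsto_of_tendsto_of_le_of_le' tendsto_const_nhds h2
      (Eventually.of_forall fun k => abs_nonneg _) (H.est.mono fun k hk => ?_)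
    obtain ⟨r, hr, e⟩ := LatticeFlow.exists_mean_value ht (hσ k)
      (fun r hr => hk.flow.der _ (node_lt A x k) r hr)
    rw [Function.comp, e, abs_mul]
    gcongr
    exact hk.g_le _ (node_lt A x k) r (uIcc_subset_Icc ht (hσ k) hr)
  simpa using h1.add (H.tendsto_U ht x)

theorem tendsto_W_seq {x : ℝ} (hx : x ∈ Icc 0 A) :
    Tendsto (fun k => latW c (mesh A k) (k + 1) (U k) (node A x k) (σ k)) (hyperfilter ℕ)
      (nhds (limW c A U x t)) :=
  tendsto_of_grid (φ := fun k i => U k i (σ k))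
    (ψ := fun k i => latW c (mesh A k) (k + 1) (U k) i (σ k)) H.hA
    (H.est.mono fun k hk => hk.taylor_U (σ k) (hσ k))
    (fun x _ => H.tendsto_U_seq hσ hlim ht x) (H.est.mono fun k hk i _ => hk.w_le i _ (hσ k)) hx
    ((H.taylor_U ht).hasDerivWithinAt hx)

theorem tendsto_G_seq {x : ℝ} (hx : x ∈ Icc 0 A) :
    Tendsto (fun k => latG m c (mesh A k) (k + 1) (U k) (node A x k) (σ k)) (hyperfilter ℕ)
      (nhds (limG m c A U x t)) := by
  have h1 := tendsto_of_grid (C' := C + |m| / δ)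
    (φ := fun k i => arctan (latW c (mesh A k) (k + 1) (U k) i (σ k)))
    (ψ := fun k i => latG m c (mesh A k) (k + 1) (U k) i (σ k) + m / U k i (σ k)) H.hA
    (H.est.mono fun k hk => hk.taylor_arctan (σ k) (hσ k))
    (fun x hx => (continuous_arctan.tendsto _).comp (H.tendsto_W_seq hσ hlim ht hx))
    (H.est.mono fun k hk i hi => ?_) hx ((H.taylor_arctan ht).hasDerivWithinAt hx)
  · have h2 := H.tendsto_inv_U ht (H.tendsto_U_seq hσ hlim ht x)
    simpa using h1.sub h2
  · refine (abs_add_le _ _).trans (add_le_add (hk.g_le i hi _ (hσ k)) ?_)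
    have h3 := hk.flow.pos i hi _ (hσ k)
    have := H.hδ
    rw [abs_div, abs_of_pos (this.trans_le h3)]
    gcongr

theorem tendsto_D_seq (ht0 : 0 < t) {x : ℝ} (hx : x ∈ Icc 0 A) :
    Tendsto (fun k => latDG m c (mesh A k) (k + 1) (U k) (node A x k) (σ k)) (hyperfilter ℕ)
      (nhds (limD m c A U x t)) := by
  have hev : ∀ᶠ k in (hyperfilter ℕ : Filter ℕ), t / 2 ≤ σ k :=
    hlim.eventually_const_le (by linarith)
  exact tendsto_of_grid (C := S (t / 2)) (C' := S (t / 2))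
    (φ := fun k i => latG m c (mesh A k) (k + 1) (U k) i (σ k))
    (ψ := fun k i => latDG m c (mesh A k) (k + 1) (U k) i (σ k)) H.hA
    ((H.est.and hev).mono fun k hk => hk.1.taylor_g (t / 2) (by linarith) _ ⟨hk.2, (hσ k).2⟩)
    (fun x hx => H.tendsto_G_seq hσ hlim ht hx)
    ((H.est.and hev).mono fun k hk i hi =>
      hk.1.dg_le (t / 2) (by linarith) _ ⟨hk.2, (hσ k).2⟩ i hi.le) hx
    ((H.taylor_G (ε := t / 2) (by linarith) ⟨by linarith, ht.2⟩).hasDerivWithinAt hx)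

end Seq

omit H in
theorem exists_seq_limit {s t : ℝ} (σ : ℕ → ℝ) (hσ : ∀ k, σ k ∈ uIcc s t) :
    ∃ r ∈ uIcc s t, Tendsto σ (hyperfilter ℕ) (nhds r) := by
  have h := tendsto_ulim (a := σ) (C := max |s| |t|) (Eventually.of_forall fun k => by
    rcases le_total s t with hst | hst
    · rw [uIcc_of_le hst] at hσ
      exact abs_le_max_abs_abs (hσ k).1 (hσ k).2
    · rw [uIcc_of_ge hst] at hσ
      rw [max_comm]
      exact abs_le_max_abs_abs (hσ k).1 (hσ k).2)
  exact ⟨_, isClosed_Icc.mem_of_tendsto h (Eventually.of_forall hσ), h⟩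

theorem mean_value_U {x s t : ℝ} (hx : x ∈ Icc 0 A) (hs : s ∈ Icc 0 b) (ht : t ∈ Icc 0 b) :
    ∃ σ ∈ uIcc s t, limU A U x t - limU A U x s = (t - s) * limG m c A U x σ := by
  have hsub := uIcc_subset_Icc hs ht
  have h : ∀ k, ∃ σ ∈ uIcc s t, LatticeEstimates m c (mesh A k) (k + 1) (U k) δ b C S →
      U k (node A x k) t - U k (node A x k) s
        = (t - s) * latG m c (mesh A k) (k + 1) (U k) (node A x k) σ := by
    intro k
    by_cases hk : LatticeEstimates m c (mesh A k) (k + 1) (U k) δ b C S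
    · obtain ⟨σ, h1, h2⟩ := LatticeFlow.exists_mean_value hs ht
        (fun r hr => hk.flow.der _ (node_lt A x k) r hr)
      exact ⟨σ, h1, fun _ => h2⟩
    · exact ⟨s, left_mem_uIcc, fun h => absurd h hk⟩
  choose σ hσ he using h
  obtain ⟨r, hr, hlim⟩ := exists_seq_limit σ hσ
  refine ⟨r, hr, tendsto_nhds_unique ((H.tendsto_U ht x).sub (H.tendsto_U hs x)) ?_⟩
  refine ((H.tendsto_G_seq (fun k => hsub (hσ k)) hlim (hsub hr) hx).const_mul (t - s)).congr' ?_
  exact H.est.mono fun k hk => (he k hk).symm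

theorem mean_value_W {x s t : ℝ} (hx : x ∈ Icc 0 A) (hs : s ∈ Ioc 0 b) (ht : t ∈ Ioc 0 b) :
    ∃ σ ∈ uIcc s t, limW c A U x t - limW c A U x s = (t - s) * limD m c A U x σ := by
  have hs' := Ioc_subset_Icc_self hs
  have ht' := Ioc_subset_Icc_self ht
  have hsub := uIcc_subset_Icc hs' ht'
  have h : ∀ k, ∃ σ ∈ uIcc s t, LatticeEstimates m c (mesh A k) (k + 1) (U k) δ b C S →
      latW c (mesh A k) (k + 1) (U k) (node A x k) t -
        latW c (mesh A k) (k + 1) (U k) (node A x k) s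
        = (t - s) * latDG m c (mesh A k) (k + 1) (U k) (node A x k) σ := by
    intro k
    by_cases hk : LatticeEstimates m c (mesh A k) (k + 1) (U k) δ b C S
    · obtain ⟨σ, h1, h2⟩ := LatticeFlow.exists_mean_value hs' ht'
        (fun r hr => hk.flow.hasDerivAt_w hr (node A x k))
      exact ⟨σ, h1, fun _ => h2⟩
    · exact ⟨s, left_mem_uIcc, fun h => absurd h hk⟩
  choose σ hσ he using h
  obtain ⟨r, hr, hlim⟩ := exists_seq_limit σ hσ
  have hr0 : 0 < r := lt_of_lt_of_le (lt_inf_iff.2 ⟨hs.1, ht.1⟩) hr.1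
  refine ⟨r, hr, tendsto_nhds_unique ((H.tendsto_W ht' x).sub (H.tendsto_W hs' x)) ?_⟩
  refine ((H.tendsto_D_seq (fun k => hsub (hσ k)) hlim (hsub hr) hr0 hx).const_mul
    (t - s)).congr' ?_
  exact H.est.mono fun k hk => (he k hk).symm

theorem abs_G_le {t : ℝ} (ht : t ∈ Icc 0 b) (x : ℝ) : |limG m c A U x t| ≤ C :=
  le_of_tendsto (H.tendsto_G ht x).abs <| H.est.mono fun k hk => hk.g_le _ (node_lt A x k) t ht

theorem abs_U_sub_le {t : ℝ} (ht : t ∈ Icc 0 b) {x y : ℝ} (hx : x ∈ Icc 0 A) (hy : y ∈ Icc 0 A) :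
    |limU A U y t - limU A U x t| ≤ C * |y - x| := by
  have ha : Tendsto (fun k => |(node A y k : ℝ) - node A x k| * mesh A k) (hyperfilter ℕ)
      (nhds |y - x|) := by
    refine ((tendsto_node H.hA hy).sub (tendsto_node H.hA hx)).abs.congr fun k => ?_
    rw [← sub_mul, abs_mul, abs_of_pos (mesh_pos H.hA k)]
  exact le_of_tendsto_of_tendsto ((H.tendsto_U ht y).sub (H.tendsto_U ht x)).abs (ha.const_mul C)
    (H.est.mono fun k hk => hk.U_sub t ht _ (node_lt A x k) _ (node_lt A y k))

theorem continuousOn_U :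
    ContinuousOn (fun p : ℝ × ℝ => limU A U p.1 p.2) (Icc 0 A ×ˢ Icc 0 b) := by
  rintro ⟨x, t⟩ ⟨hx, ht⟩
  have h : Tendsto (fun p : ℝ × ℝ => C * |p.1 - x| + |p.2 - t| * C)
      (nhdsWithin (x, t) (Icc 0 A ×ˢ Icc 0 b)) (nhds 0) := by
    have : ContinuousAt (fun p : ℝ × ℝ => C * |p.1 - x| + |p.2 - t| * C) (x, t) := by fun_prop
    have h2 := this.tendsto
    simp only [sub_self, abs_zero, mul_zero, zero_mul, add_zero] at h2
    exact h2.mono_left nhdsWithin_le_nhds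
  rw [ContinuousWithinAt, tendsto_iff_dist_tendsto_zero]
  refine tendsto_of_tendsto_of_tendsto_of_le_of_le' tendsto_const_nhds h
    (Eventually.of_forall fun _ => dist_nonneg) ?_
  filter_upwards [self_mem_nhdsWithin] with p hp
  obtain ⟨σ, hσ, e⟩ := H.mean_value_U hx ht hp.2
  rw [Real.dist_eq, show limU A U p.1 p.2 - limU A U x t
    = (limU A U p.1 p.2 - limU A U x p.2) + (limU A U x p.2 - limU A U x t) by ring, e]
  refine (abs_add_le _ _).trans (add_le_add (H.abs_U_sub_le hp.2 hx hp.1) ?_)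
  rw [abs_mul]
  gcongr
  exact H.abs_G_le (uIcc_subset_Icc ht hp.2 hσ) x

theorem continuousOn_W :
    ContinuousOn (fun p : ℝ × ℝ => limW c A U p.1 p.2) (Icc 0 A ×ˢ Icc 0 b) :=
  continuousOn_of_taylorOn H.hA H.continuousOn_U fun _ ht => H.taylor_U ht

theorem continuousOn_G :
    ContinuousOn (fun p : ℝ × ℝ => limG m c A U p.1 p.2) (Icc 0 A ×ˢ Icc 0 b) := by
  have h1 : ContinuousOn (fun p : ℝ × ℝ => limG m c A U p.1 p.2 + m / limU A U p.1 p.2)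
      (Icc 0 A ×ˢ Icc 0 b) :=
    continuousOn_of_taylorOn (φ := fun x t => arctan (limW c A U x t))
      (ψ := fun x t => limG m c A U x t + m / limU A U x t) H.hA
      (continuous_arctan.comp_continuousOn H.continuousOn_W) fun _ ht => H.taylor_arctan ht
  have h2 : ContinuousOn (fun p : ℝ × ℝ => m / limU A U p.1 p.2) (Icc 0 A ×ˢ Icc 0 b) :=
    continuousOn_const.div H.continuousOn_U fun p hp => (H.hδ.trans_le (H.le_U hp.2 p.1)).ne'
  refine (h1.sub h2).congr fun p _ => ?_
  simp

theorem continuousOn_D {ε : ℝ} (hε : 0 < ε) :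
    ContinuousOn (fun p : ℝ × ℝ => limD m c A U p.1 p.2) (Icc 0 A ×ˢ Icc ε b) :=
  continuousOn_of_taylorOn H.hA
    (H.continuousOn_G.mono (prod_mono le_rfl (Icc_subset_Icc_left hε.le)))
    fun _ ht => H.taylor_G hε ht

theorem hasDerivAt_U {x t : ℝ} (hx : x ∈ Icc 0 A) (ht : t ∈ Ioo 0 b) :
    HasDerivAt (limU A U x) (limG m c A U x t) t := by
  refine hasDerivAt_of_mean_value ht (fun s hs => H.mean_value_U hx (Ioo_subset_Icc_self ht)
    (Ioo_subset_Icc_self hs)) ?_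
  have : ContinuousOn (limG m c A U x) (Icc 0 b) :=
    H.continuousOn_G.comp (f := fun s => (x, s)) (by fun_prop) fun s hs => ⟨hx, hs⟩
  exact this.continuousAt (Icc_mem_nhds ht.1 ht.2)

theorem hasDerivAt_W {x t : ℝ} (hx : x ∈ Icc 0 A) (ht : t ∈ Ioo 0 b) :
    HasDerivAt (limW c A U x) (limD m c A U x t) t := by
  refine hasDerivAt_of_mean_value ht (fun s hs => H.mean_value_W hx (Ioo_subset_Ioc_self ht)
    (Ioo_subset_Ioc_self hs)) ?_
  have ht2 : 0 < t / 2 := half_pos ht.1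
  have : ContinuousOn (limD m c A U x) (Icc (t / 2) b) :=
    (H.continuousOn_D ht2).comp (f := fun s => (x, s)) (by fun_prop) fun s hs => ⟨hx, hs⟩
  exact this.continuousAt (Icc_mem_nhds (by linarith) ht.2)

theorem hasDerivWithinAt_W {x t : ℝ} (hx : x ∈ Icc 0 A) (ht : t ∈ Icc 0 b) :
    HasDerivWithinAt (fun x => limW c A U x t)
      ((1 + limW c A U x t ^ 2) * (limG m c A U x t + m / limU A U x t)) (Icc 0 A) x := by
  have h1 := (H.taylor_arctan ht).hasDerivWithinAt hx
  have hcos : cos (arctan (limW c A U x t)) ≠ 0 := (cos_arctan_pos _).ne'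
  have h2 := (hasDerivAt_tan hcos).comp_hasDerivWithinAt x h1
  simp only [Function.comp_def, tan_arctan] at h2
  refine h2.congr_deriv ?_
  rw [cos_sq_arctan]
  simp

theorem W_zero {t : ℝ} (ht : t ∈ Icc 0 b) : limW c A U 0 t = 0 :=
  tendsto_nhds_unique (H.tendsto_W ht 0) (by simp [node_zero, latW])

theorem W_right {t : ℝ} (ht : t ∈ Icc 0 b) : limW c A U A t = c := by
  have h1 : Tendsto (fun k => c - latW c (mesh A k) (k + 1) (U k) (node A A k) t) (hyperfilter ℕ)
      (nhds 0) := by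
    rw [tendsto_zero_iff_abs_tendsto_zero]
    refine tendsto_of_tendsto_of_tendsto_of_le_of_le' tendsto_const_nhds
      (by simpa using (tendsto_mesh A).const_mul C) (Eventually.of_forall fun k => abs_nonneg _)
      (H.est.mono fun k hk => ?_)
    have := hk.w_last t ht
    rw [Function.comp, node_right H.hA]
    simpa using this
  have h2 := h1.const_sub c
  simp only [sub_sub_cancel, sub_zero] at h2
  exact tendsto_nhds_unique (H.tendsto_W ht A) h2

end UniformFlow

/-- A maximal solution of the graphical flow with Neumann data, together with its derivatives. -/
structure PinchingFlow (m c A u₀ T : ℝ) (w₀ : ℝ → ℝ) (U w g γ : ℝ → ℝ → ℝ) : Prop where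
  hm : 0 < m
  hA : 0 < A
  hT : 0 < T
  T_le : T ≤ 3
  U_pos : ∀ x ∈ Icc 0 A, ∀ t ∈ Ico 0 T, 0 < U x t
  U_x : ∀ x ∈ Icc 0 A, ∀ t ∈ Ico 0 T, HasDerivWithinAt (fun x => U x t) (w x t) (Icc 0 A) x
  w_x : ∀ x ∈ Icc 0 A, ∀ t ∈ Ico 0 T, HasDerivWithinAt (fun x => w x t)
    ((1 + w x t ^ 2) * (g x t + m / U x t)) (Icc 0 A) x
  g_x : ∀ x ∈ Icc 0 A, ∀ t ∈ Ioo 0 T, HasDerivWithinAt (fun x => g x t) (γ x t) (Icc 0 A) x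
  U_t : ∀ x ∈ Icc 0 A, ∀ t ∈ Ioo 0 T, HasDerivAt (U x) (g x t) t
  w_t : ∀ x ∈ Icc 0 A, ∀ t ∈ Ioo 0 T, HasDerivAt (w x) (γ x t) t
  cont_U : ContinuousOn (fun p : ℝ × ℝ => U p.1 p.2) (Icc 0 A ×ˢ Ico 0 T)
  cont_w : ContinuousOn (fun p : ℝ × ℝ => w p.1 p.2) (Icc 0 A ×ˢ Ico 0 T)
  cont_g : ContinuousOn (fun p : ℝ × ℝ => g p.1 p.2) (Icc 0 A ×ˢ Ico 0 T)
  w_zero : ∀ t ∈ Ico 0 T, w 0 t = 0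
  w_right : ∀ t ∈ Ico 0 T, w A t = c
  U_initial : U 0 0 = u₀
  w_initial : ∀ x ∈ Icc 0 A, w x 0 = w₀ x
  maximal : T < 3 → ∀ δ > 0, ∃ x ∈ Icc 0 A, ∃ t ∈ Ico 0 T, U x t < δ

/-- Lattice solutions on finer and finer grids with common initial data. -/
structure ApproxFlow (m c A u₀ : ℝ) (w₀ : ℝ → ℝ) (U : ℕ → ℕ → ℝ → ℝ) : Prop where
  flow : ∀ k, TruncatedFlow m c (mesh A k) (1 / (k + 1)) (k + 1) (U k)
  initial : ∀ k, ∀ i < k + 1, U k i 0 = latInit u₀ (mesh A k) w₀ i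

/-- The lattice solutions stay away from zero on `[0, b]`. -/
def UniformlyPositive (U : ℕ → ℕ → ℝ → ℝ) (b : ℝ) : Prop :=
  0 ≤ b ∧ b ≤ 3 ∧ ∃ δ > 0, ∀ᶠ k in (hyperfilter ℕ : Filter ℕ),
    ∀ s ∈ Icc 0 b, ∀ i < k + 1, δ ≤ U k i s

theorem eventually_inv_le {δ : ℝ} (hδ : 0 < δ) :
    ∀ᶠ k : ℕ in (hyperfilter ℕ : Filter ℕ), 1 / ((k : ℝ) + 1) ≤ δ :=
  ((tendsto_one_div_add_atTop_nhds_zero_nat (𝕜 := ℝ)).eventually_le_const hδ).filter_mono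
    Nat.hyperfilter_le_atTop

theorem UniformFlow.eventually_le {m c A δ b C d t : ℝ} {S : ℝ → ℝ} {U : ℕ → ℕ → ℝ → ℝ} (hd : 0 < d)
    (F : UniformFlow m c A U δ b C S) (ht : t ∈ Icc 0 b) (h : ∀ x ∈ Icc 0 A, d ≤ limU A U x t) :
    ∀ᶠ k in (hyperfilter ℕ : Filter ℕ), ∀ i < k + 1, d / 2 ≤ U k i t := by
  by_contra hne
  rw [← Ultrafilter.eventually_not] at hne
  have hex : ∀ k, ∃ i < k + 1, (¬ ∀ i < k + 1, d / 2 ≤ U k i t) → U k i t < d / 2 := fun k => by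
    by_cases hk : ∀ i < k + 1, d / 2 ≤ U k i t
    · exact ⟨0, k.succ_pos, fun h => absurd hk h⟩
    · push Not at hk
      obtain ⟨i, hi, h⟩ := hk
      exact ⟨i, hi, fun _ => h⟩
  choose j hj hj' using hex
  have hmem : ∀ k, (j k : ℝ) * mesh A k ∈ Icc 0 A := fun k => by
    have := mesh_pos F.hA k
    refine ⟨by positivity, ?_⟩
    refine (mul_le_mul_of_nonneg_right ?_ this.le).trans_eq (mul_mesh A k)
    exact_mod_cast (hj k).le
  have hx := tendsto_ulim (a := fun k => (j k : ℝ) * mesh A k) (C := A)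
    (Eventually.of_forall fun k => by rw [abs_of_nonneg (hmem k).1]; exact (hmem k).2)
  obtain ⟨x, hxd⟩ : ∃ x, x = ulim fun k => (j k : ℝ) * mesh A k := ⟨_, rfl⟩
  rw [← hxd] at hx
  have hxA : x ∈ Icc 0 A :=
    isClosed_Icc.mem_of_tendsto hx (Eventually.of_forall hmem)
  have h1 : Tendsto (fun k => d / 2 + C * |(node A x k : ℝ) * mesh A k - j k * mesh A k|)
      (hyperfilter ℕ) (nhds (d / 2)) := by
    have := ((((tendsto_node F.hA hxA).sub hx).abs).const_mul C).const_add (d / 2)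
    simpa using this
  have h2 : limU A U x t ≤ d / 2 := by
    refine le_of_tendsto_of_tendsto (F.tendsto_U ht x) h1 ?_
    filter_upwards [hne, F.est] with k hk hk'
    have h3 := hk'.U_sub t ht (j k) (hj k) (node A x k) (node_lt A x k)
    rw [← sub_mul, abs_mul, abs_of_pos (mesh_pos F.hA k)]
    have := hj' k hk
    have := abs_le.1 h3
    linarith
  linarith [h x hxA]

namespace InitialSlope

variable {m c A u₀ B : ℝ} {w₀ α : ℝ → ℝ} (I : InitialSlope m c A u₀ B w₀ α)
include I

theorem continuous_slope : Continuous w₀ := by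
  have h : ∀ x, ContinuousAt (fun x => tan (arctan (w₀ x))) x := fun x =>
    ContinuousAt.comp (g := tan) (hasDerivAt_tan (cos_arctan_pos (w₀ x)).ne').continuousAt
      (I.deriv x).continuousAt
  simpa [tan_arctan] using continuous_iff_continuousAt.2 h

theorem exists_approxFlow : ∃ U, ApproxFlow m c A u₀ w₀ U := by
  have h : ∀ k : ℕ, ∃ U : ℕ → ℝ → ℝ, (∀ i < k + 1, U i 0 = latInit u₀ (mesh A k) w₀ i) ∧
      ∀ i < k + 1, ∀ t ∈ Icc (0 : ℝ) 3, HasDerivAt (U i)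
        ((arctan (latW c (mesh A k) (k + 1) U (i + 1) t)
          - arctan (latW c (mesh A k) (k + 1) U i t)) / (mesh A k)
          - m / max (U i t) (1 / ((k : ℝ) + 1))) t := fun k =>
    exists_truncated_lattice_flow I.hm (mesh_pos I.hA k) Nat.one_div_pos_of_nat _
  choose U h1 h2 using h
  exact ⟨U, fun k => ⟨I.hm, I.hc, mesh_pos I.hA k, Nat.one_div_pos_of_nat, k.succ_pos, h2 k⟩, h1⟩

section

variable {U : ℕ → ℕ → ℝ → ℝ} (H : ApproxFlow m c A u₀ w₀ U)
include H

theorem exists_uniformFlow {b : ℝ} (hb : UniformlyPositive U b) :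
    ∃ δ C S, UniformFlow m c A U δ b C S := by
  obtain ⟨h0, h3, δ, hδ, h⟩ := hb
  obtain ⟨C, S, hCS⟩ := I.exists_estimates hδ
  refine ⟨δ, C, S, I.hA, hδ, ?_⟩
  filter_upwards [h, eventually_inv_le hδ] with k hk hk'
  exact hCS _ _ _ _ _ (H.flow k) hk' (mul_mesh A k) (H.initial k) h0 h3 hk

theorem uniformlyPositive_of_le {δ t₀ : ℝ} (hδ : 0 < δ) (ht₀ : UniformlyPositive U t₀)
    (h : ∀ᶠ k in (hyperfilter ℕ : Filter ℕ), ∀ i < k + 1, δ ≤ U k i t₀) :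
    UniformlyPositive U (min 3 (t₀ + δ ^ 2 / (16 * m))) := by
  obtain ⟨h0, h3, δ', hδ', h'⟩ := ht₀
  have hm := I.hm
  have h1 : 0 < δ ^ 2 / (16 * m) := by positivity
  refine ⟨le_min (by norm_num) (by linarith), min_le_left _ _, min δ' (δ / 2),
    lt_min hδ' (by linarith), ?_⟩
  filter_upwards [h, h', eventually_inv_le (half_pos hδ)] with k hk hk' hη s hs i hi
  rcases le_total s t₀ with hst | hst
  · exact (min_le_left _ _).trans (hk' s ⟨hs.1, hst⟩ i hi)
  · exact (min_le_right _ _).trans ((H.flow k).half_le (by linarith) h0 hk s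
      ⟨hst, hs.2.trans (min_le_left _ _)⟩ (hs.2.trans (min_le_right _ _)) i hi)

theorem uniformlyPositive_zero : UniformlyPositive U 0 := by
  refine ⟨le_rfl, by norm_num, u₀, I.hu, Eventually.of_forall fun k s hs i hi => ?_⟩
  obtain rfl : s = 0 := le_antisymm hs.2 hs.1
  exact I.le_initial (mesh_pos I.hA k) (mul_mesh A k) (H.initial k) hi

end

theorem exists_pinchingFlow : ∃ T U w g γ, PinchingFlow m c A u₀ T w₀ U w g γ := by
  obtain ⟨U, H⟩ := I.exists_approxFlow
  have hm := I.hm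
  have hu := I.hu
  obtain ⟨T, hTd⟩ : ∃ T, T = sSup {b | UniformlyPositive U b} := ⟨_, rfl⟩
  have hbdd : BddAbove {b | UniformlyPositive U b} := ⟨3, fun b hb => hb.2.1⟩
  have hle : ∀ b, UniformlyPositive U b → b ≤ T := fun b hb => hTd ▸ le_csSup hbdd hb
  have hz := I.uniformlyPositive_zero H
  have hlt : ∀ t < T, ∃ b, UniformlyPositive U b ∧ t < b := fun t ht =>
    exists_lt_of_lt_csSup ⟨0, hz⟩ (hTd ▸ ht)
  have hT0 : 0 < T := by
    have h1 := hle _ <| I.uniformlyPositive_of_le H hu hz <| Eventually.of_forall fun k i hi =>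
      I.le_initial (mesh_pos I.hA k) (mul_mesh A k) (H.initial k) hi
    have : 0 < u₀ ^ 2 / (16 * m) := by positivity
    exact (lt_min (by norm_num) (by linarith)).trans_le h1
  have hT3 : T ≤ 3 := hTd ▸ csSup_le ⟨0, hz⟩ fun b hb => hb.2.1
  have key : ∀ t ∈ Ico 0 T, ∃ b > t, ∃ δ C S, UniformFlow m c A U δ b C S := fun t ht => by
    obtain ⟨b, hb, htb⟩ := hlt t ht.2
    exact ⟨b, htb, I.exists_uniformFlow H hb⟩
  have kcont : ∀ f : ℝ → ℝ → ℝ, (∀ δ b C S, UniformFlow m c A U δ b C S →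
      ContinuousOn (fun p : ℝ × ℝ => f p.1 p.2) (Icc 0 A ×ˢ Icc 0 b)) →
      ContinuousOn (fun p : ℝ × ℝ => f p.1 p.2) (Icc 0 A ×ˢ Ico 0 T) := by
    rintro f hf ⟨x, t⟩ ⟨hx, ht⟩
    obtain ⟨b, hb, δ, C, S, F⟩ := key t ht
    refine (hf _ _ _ _ F ⟨x, t⟩ ⟨hx, ht.1, hb.le⟩).mono_of_mem_nhdsWithin ?_
    have : Prod.snd ⁻¹' Iio b ∈ nhds (x, t) := (isOpen_Iio.preimage continuous_snd).mem_nhds hb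
    filter_upwards [mem_nhdsWithin_of_mem_nhds this, self_mem_nhdsWithin] with p hp hp'
    exact ⟨hp'.1, hp'.2.1, le_of_lt hp⟩
  refine ⟨T, limU A U, limW c A U, limG m c A U, limD m c A U, hm, I.hA, hT0, hT3, ?_, ?_, ?_, ?_,
    ?_, ?_, kcont _ fun δ b C S F => F.continuousOn_U, kcont _ fun δ b C S F => F.continuousOn_W,
    kcont _ fun δ b C S F => F.continuousOn_G, ?_, ?_, ?_, ?_, ?_⟩
  · intro x hx t ht
    obtain ⟨b, hb, δ, C, S, F⟩ := key t ht
    exact F.hδ.trans_le (F.le_U ⟨ht.1, hb.le⟩ x)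
  · intro x hx t ht
    obtain ⟨b, hb, δ, C, S, F⟩ := key t ht
    exact (F.taylor_U ⟨ht.1, hb.le⟩).hasDerivWithinAt hx
  · intro x hx t ht
    obtain ⟨b, hb, δ, C, S, F⟩ := key t ht
    exact F.hasDerivWithinAt_W hx ⟨ht.1, hb.le⟩
  · intro x hx t ht
    obtain ⟨b, hb, δ, C, S, F⟩ := key t ⟨ht.1.le, ht.2⟩
    exact (F.taylor_G ht.1 ⟨le_rfl, hb.le⟩).hasDerivWithinAt hx
  · intro x hx t ht
    obtain ⟨b, hb, δ, C, S, F⟩ := key t ⟨ht.1.le, ht.2⟩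
    exact F.hasDerivAt_U hx ⟨ht.1, hb⟩
  · intro x hx t ht
    obtain ⟨b, hb, δ, C, S, F⟩ := key t ⟨ht.1.le, ht.2⟩
    exact F.hasDerivAt_W hx ⟨ht.1, hb⟩
  · intro t ht
    obtain ⟨b, hb, δ, C, S, F⟩ := key t ht
    exact F.W_zero ⟨ht.1, hb.le⟩
  · intro t ht
    obtain ⟨b, hb, δ, C, S, F⟩ := key t ht
    exact F.W_right ⟨ht.1, hb.le⟩
  · obtain ⟨b, hb, δ, C, S, F⟩ := key 0 ⟨le_rfl, hT0⟩
    refine tendsto_nhds_unique (F.tendsto_U ⟨le_rfl, hb.le⟩ 0) ?_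
    refine tendsto_const_nhds.congr fun k => ?_
    rw [node_zero, H.initial k 0 k.succ_pos, latInit]
    simp
  · intro x hx
    obtain ⟨b, hb, δ, C, S, F⟩ := key 0 ⟨le_rfl, hT0⟩
    refine tendsto_nhds_unique (F.tendsto_W ⟨le_rfl, hb.le⟩ x) ?_
    refine ((I.continuous_slope.tendsto x).comp (tendsto_node I.hA hx)).congr fun k => ?_
    rw [I.latW_initial (mesh_pos I.hA k) (mul_mesh A k) k.succ_pos (H.initial k) (node_lt A x k).le]
    rfl
  · intro hT δ hδ
    by_contra! hne
    have hs : 0 < (δ / 2) ^ 2 / (16 * m) := by positivity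
    obtain ⟨t, ht, htT⟩ : ∃ t ∈ Ico 0 T, T < t + (δ / 2) ^ 2 / (16 * m) := by
      refine ⟨max 0 (T - (δ / 2) ^ 2 / (16 * m) / 2), ⟨le_max_left _ _, max_lt hT0 (by linarith)⟩,
        ?_⟩
      linarith [le_max_right 0 (T - (δ / 2) ^ 2 / (16 * m) / 2)]
    obtain ⟨b, hb, htb⟩ := hlt t ht.2
    obtain ⟨δ', C, S, F⟩ := I.exists_uniformFlow H hb
    have htg : UniformlyPositive U t := by
      obtain ⟨h0, h3, d, hd, h⟩ := hb
      exact ⟨ht.1, ht.2.le.trans hT3, d, hd, h.mono fun k hk s hs =>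
        hk s ⟨hs.1, hs.2.trans htb.le⟩⟩
    have h1 := F.eventually_le hδ ⟨ht.1, htb.le⟩ fun x hx => hne x hx t ht
    have h2 := hle _ (I.uniformlyPositive_of_le H (half_pos hδ) htg h1)
    exact absurd h2 (not_le.2 (lt_min hT htT))

end InitialSlope

/-- Evolution of the squared radius `V`, with `W = V_x` and `Z = V_xx`. -/
structure SquareFlow (κ τ₀ T : ℝ) (V W Z : ℝ → ℝ → ℝ) : Prop where
  hτ : 0 < τ₀
  hT : 0 < T
  T_le : T ≤ 3
  V_pos : ∀ x ∈ Icc 0 τ₀, ∀ t ∈ Ico 0 T, 0 < V x t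
  V_x : ∀ x ∈ Icc 0 τ₀, ∀ t ∈ Ico 0 T, HasDerivWithinAt (fun x => V x t) (W x t) (Icc 0 τ₀) x
  W_x : ∀ x ∈ Icc 0 τ₀, ∀ t ∈ Ico 0 T, HasDerivWithinAt (fun x => W x t) (Z x t) (Icc 0 τ₀) x
  V_t : ∀ t ∈ Ioo 0 T, HasDerivAt (V 0) (Z 0 t - κ) t
  W_t : ∀ x ∈ Ioo 0 τ₀, ∀ t ∈ Ioo 0 T, ∃ Wt Wxx : ℝ, HasDerivAt (W x) Wt t ∧
    HasDerivAt (fun x => Z x t) Wxx x ∧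
    Wt = Wxx / (1 + W x t ^ 2 / (4 * V x t)) -
      (Z x t + 2) * (W x t * (Z x t - W x t ^ 2 / (2 * V x t)) / (2 * V x t)) /
        (1 + W x t ^ 2 / (4 * V x t)) ^ 2
  cont_V : ContinuousOn (fun p : ℝ × ℝ => V p.1 p.2) (Icc 0 τ₀ ×ˢ Ico 0 T)
  cont_W : ContinuousOn (fun p : ℝ × ℝ => W p.1 p.2) (Icc 0 τ₀ ×ˢ Ico 0 T)
  cont_Z : ContinuousOn (fun p : ℝ × ℝ => Z p.1 p.2) (Icc 0 τ₀ ×ˢ Ico 0 T)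
  W_zero : ∀ t ∈ Ico 0 T, W 0 t = 0
  W_right_nonneg : ∀ t ∈ Ico 0 T, 0 ≤ W τ₀ t
  W_right_sq : ∀ t ∈ Ico 0 T, W τ₀ t ^ 2 * (2 + τ₀) = 2 * κ * V τ₀ t
  V_initial : V 0 0 = κ
  W_initial : ∀ x ∈ Icc 0 τ₀, W x 0 = κ / τ₀ * x
  maximal : T < 3 → ∀ δ > 0, ∃ x ∈ Icc 0 τ₀, ∃ t ∈ Ico 0 T, V x t < δ

theorem le_of_hasDerivWithinAt_nonneg {A x : ℝ} {f f' : ℝ → ℝ}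
    (hf : ∀ y ∈ Icc 0 A, HasDerivWithinAt f (f' y) (Icc 0 A) y) (hx : x ∈ Icc 0 A)
    (h : ∀ y ∈ Icc 0 x, 0 ≤ f' y) : f 0 ≤ f x := by
  have hsub : Icc 0 x ⊆ Icc 0 A := Icc_subset_Icc_right hx.2
  have hm : MonotoneOn f (Icc 0 x) := by
    refine monotoneOn_of_hasDerivWithinAt_nonneg (convex_Icc 0 x)
      (fun y hy => ((hf y (hsub hy)).mono hsub).continuousWithinAt)
      (f' := f') (fun y hy => ?_) fun y hy => h y (interior_subset hy)
    exact (hf y (hsub (interior_subset hy))).mono (interior_subset.trans hsub)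
  exact hm ⟨le_rfl, hx.1⟩ ⟨hx.1, le_rfl⟩ hx.1

/-- Second derivative test at an interior maximum. -/
theorem second_deriv_test {A x f'' : ℝ} {f f' : ℝ → ℝ} (hx : x ∈ Ioo 0 A)
    (hf : ∀ y ∈ Ioo 0 A, HasDerivAt f (f' y) y) (hf' : HasDerivAt f' f'' x)
    (hmax : ∀ y ∈ Icc 0 A, f y ≤ f x) : f' x = 0 ∧ f'' ≤ 0 := by
  have h0 : f' x = 0 := by
    refine IsLocalMax.hasDerivAt_eq_zero ?_ (hf x hx)
    filter_upwards [Icc_mem_nhds hx.1 hx.2] with y hy using hmax y hy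
  refine ⟨h0, ?_⟩
  by_contra! hpos
  have h1 : ∀ᶠ y in nhdsWithin x (Ioi x), 0 < f' y := by
    have h2 := (hasDerivAt_iff_tendsto_slope.1 hf').eventually_const_lt hpos
    have h3 : nhdsWithin x (Ioi x) ≤ nhdsWithin x {x}ᶜ :=
      nhdsWithin_mono x fun y hy => ne_of_gt hy
    filter_upwards [h3 h2, self_mem_nhdsWithin] with y hy hxy
    rw [slope_def_field, h0, sub_zero] at hy
    exact (div_pos_iff_of_pos_right (sub_pos.2 hxy)).1 hy
  obtain ⟨b, hb, hsub⟩ := mem_nhdsGT_iff_exists_Ioo_subset.1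
    (inter_mem h1 (Ioo_mem_nhdsGT hx.2))
  obtain ⟨z, hz1, hz2⟩ := exists_between (mem_Ioi.1 hb)
  have hzA : z ∈ Ioo x A := (hsub ⟨hz1, hz2⟩).2
  have hd : ∀ y ∈ Icc x z, HasDerivAt f (f' y) y := fun y hy =>
    hf y ⟨hx.1.trans_le hy.1, hy.2.trans_lt hzA.2⟩
  have hs : StrictMonoOn f (Icc x z) := by
    refine strictMonoOn_of_hasDerivWithinAt_pos (convex_Icc x z)
      (fun y hy => (hd y hy).continuousAt.continuousWithinAt) (f' := f')
      (fun y hy => (hd y (interior_subset hy)).hasDerivWithinAt) fun y hy => ?_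
    rw [interior_Icc] at hy
    exact (hsub ⟨hy.1, hy.2.trans hz2⟩).1
  have h4 := hs ⟨le_rfl, le_of_lt hz1⟩ ⟨le_of_lt hz1, le_rfl⟩ hz1
  linarith [hmax z ⟨(hx.1.trans hz1).le, hzA.2.le⟩]

theorem PinchingFlow.squareFlow {m c τ₀ T : ℝ} {w₀ : ℝ → ℝ} {U w g γ : ℝ → ℝ → ℝ}
    (H : PinchingFlow m c τ₀ √(2 * m) T w₀ U w g γ) (hc : 0 ≤ c)
    (hw₀ : ∀ x ∈ Icc 0 τ₀, w₀ x = m / τ₀ * x / √(2 * m + m / τ₀ * x ^ 2)) (hcw : w₀ τ₀ = c) :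
    SquareFlow (2 * m) τ₀ T (fun x t => U x t ^ 2) (fun x t => 2 * U x t * w x t)
      (fun x t => 2 * w x t ^ 2 + 2 * U x t * ((1 + w x t ^ 2) * (g x t + m / U x t))) := by
  have hm := H.hm
  have hA := H.hA
  have hT := H.hT
  have h0A : (0 : ℝ) ∈ Icc 0 τ₀ := ⟨le_rfl, hA.le⟩
  have hAA : τ₀ ∈ Icc 0 τ₀ := ⟨hA.le, le_rfl⟩
  have h0T : (0 : ℝ) ∈ Ico 0 T := ⟨le_rfl, hT⟩
  have hcU := H.cont_U
  have hcw' := H.cont_w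
  have hcg := H.cont_g
  have hUinitial : ∀ x ∈ Icc 0 τ₀, U x 0 = √(2 * m + m / τ₀ * x ^ 2) := fun x hx => by
    have hr : ∀ y, HasDerivAt (fun y => √(2 * m + m / τ₀ * y ^ 2))
        (m / τ₀ * y / √(2 * m + m / τ₀ * y ^ 2)) y := fun y => by
      have h1 : HasDerivAt (fun y => 2 * m + m / τ₀ * y ^ 2) (m / τ₀ * (2 * y)) y := by
        simpa using ((hasDerivAt_pow 2 y).const_mul (m / τ₀)).const_add (2 * m)
      convert h1.sqrt (by positivity) using 1
      rw [show m / τ₀ * (2 * y) = 2 * (m / τ₀ * y) by ring, mul_div_mul_left _ _ two_ne_zero]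
    have hd : ∀ y ∈ Icc 0 τ₀, HasDerivWithinAt
        (fun y => U y 0 - √(2 * m + m / τ₀ * y ^ 2)) 0 (Icc 0 τ₀) y := fun y hy => by
      have := (H.U_x y hy 0 h0T).sub (hr y).hasDerivWithinAt
      rw [H.w_initial y hy, hw₀ y hy, sub_self] at this
      exact this
    have h1 := le_of_hasDerivWithinAt_nonneg hd hx fun _ _ => le_rfl
    have h2 := le_of_hasDerivWithinAt_nonneg (fun y hy => (hd y hy).neg) hx fun _ _ => by simp
    simp only [H.U_initial, Pi.neg_apply] at h1 h2
    norm_num at h1 h2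
    linarith
  have hV : ∀ x ∈ Icc 0 τ₀, ∀ t ∈ Ico 0 T,
      HasDerivWithinAt (fun x => U x t ^ 2) (2 * U x t * w x t) (Icc 0 τ₀) x := fun x hx t ht => by
    simpa using (H.U_x x hx t ht).fun_pow 2
  have hmU : ∀ x ∈ Icc 0 τ₀, ∀ t ∈ Ico 0 T, U x t ≠ 0 := fun x hx t ht => (H.U_pos x hx t ht).ne'
  refine ⟨hA, hT, H.T_le, fun x hx t ht => pow_pos (H.U_pos x hx t ht) 2, hV, ?_, ?_, ?_,
    by fun_prop, by fun_prop, ?_, ?_, ?_, ?_, ?_, ?_, ?_⟩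
  · intro x hx t ht
    refine (((H.U_x x hx t ht).const_mul 2).fun_mul (H.w_x x hx t ht)).congr_deriv ?_
    ring
  · intro t ht
    have ht' := Ioo_subset_Ico_self ht
    refine ((H.U_t 0 h0A t ht).fun_pow 2).congr_deriv ?_
    have := hmU 0 h0A t ht'
    simp only [H.w_zero t ht']
    field_simp
    push_cast
    ring
  · intro x hx t ht
    have hx' := Ioo_subset_Icc_self hx
    have ht' := Ioo_subset_Ico_self ht
    have hn : Icc 0 τ₀ ∈ nhds x := Icc_mem_nhds hx.1 hx.2
    have hUx := (H.U_x x hx' t ht').hasDerivAt hn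
    have hwx := (H.w_x x hx' t ht').hasDerivAt hn
    have hgx := (H.g_x x hx' t ht).hasDerivAt hn
    have hU := hmU x hx' t ht'
    have hU0 := H.U_pos x hx' t ht'
    have h1 := ((H.U_t x hx' t ht).const_mul 2).mul (H.w_t x hx' t ht)
    have h2 := ((hwx.pow 2).const_mul 2).add ((hUx.const_mul 2).mul
      (((hwx.pow 2).const_add 1).mul (hgx.add ((hasDerivAt_const x m).div hUx hU))))
    refine ⟨_, _, h1, h2, ?_⟩
    simp only [Pi.pow_apply, Pi.add_apply, Pi.div_apply, Pi.mul_apply]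
    generalize U x t = u at *
    generalize w x t = z at *
    generalize g x t = a at *
    generalize γ x t = b at *
    have e1 : (2 * u * z) ^ 2 / (4 * u ^ 2) = z ^ 2 := by field_simp; ring
    have e2 : (2 * u * z) ^ 2 / (2 * u ^ 2) = 2 * z ^ 2 := by field_simp
    have e3 : (0 : ℝ) < 1 + z ^ 2 := by positivity
    rw [e1, e2]
    field_simp
    push_cast
    ring
  · have : ContinuousOn (fun p : ℝ × ℝ => m / U p.1 p.2) (Icc 0 τ₀ ×ˢ Ico 0 T) :=
      continuousOn_const.div hcU fun p hp => hmU _ hp.1 _ hp.2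
    fun_prop
  · intro t ht
    simp [H.w_zero t ht]
  · intro t ht
    have := H.U_pos τ₀ hAA t ht
    rw [H.w_right t ht]
    positivity
  · intro t ht
    have h1 : c ^ 2 * (2 + τ₀) = m := by
      have h2 : (0 : ℝ) < 2 * m + m / τ₀ * τ₀ ^ 2 := by positivity
      rw [← hcw, hw₀ τ₀ hAA, div_pow, sq_sqrt h2.le]
      field_simp
    simp only [H.w_right t ht]
    linear_combination 4 * U τ₀ t ^ 2 * h1
  · simp only [H.U_initial]
    exact sq_sqrt (by positivity)
  · intro x hx
    have h2 : (0 : ℝ) < 2 * m + m / τ₀ * x ^ 2 := by positivity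
    have h3 := sqrt_pos.2 h2
    simp only [H.w_initial x hx, hw₀ x hx, hUinitial x hx]
    field_simp
  · intro h δ hδ
    obtain ⟨x, hx, t, ht, hlt⟩ := H.maximal h √δ (sqrt_pos.2 hδ)
    refine ⟨x, hx, t, ht, ?_⟩
    have := H.U_pos x hx t ht
    calc U x t ^ 2 < √δ ^ 2 := by gcongr
      _ = δ := sq_sqrt hδ.le

/-- Initial slope of the pinching profile `√(2 m + (m / τ₀) x²)`. -/
noncomputable def pinchSlope (m τ₀ x : ℝ) : ℝ := m / τ₀ * x / √(2 * m + m / τ₀ * x ^ 2)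

theorem exists_initialSlope {m τ₀ : ℝ} (hm : 0 < m) (hτ : 0 < τ₀) : ∃ B α,
    InitialSlope m (pinchSlope m τ₀ τ₀) τ₀ √(2 * m) B (pinchSlope m τ₀) α := by
  obtain ⟨a, ha⟩ : ∃ a, a = m / τ₀ := ⟨_, rfl⟩
  have ha0 : 0 < a := ha ▸ div_pos hm hτ
  have hR : ∀ x : ℝ, 0 < 2 * m + a * x ^ 2 := fun x => by positivity
  have hR' : ∀ x : ℝ, 0 < √(2 * m + a * x ^ 2) := fun x => sqrt_pos.2 (hR x)
  obtain ⟨α, hα⟩ : ∃ α : ℝ → ℝ, α = fun x =>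
      2 * m * a / (√(2 * m + a * x ^ 2) * (2 * m + a * x ^ 2 + a ^ 2 * x ^ 2)) := ⟨_, rfl⟩
  have hαd : ContDiff ℝ 1 α := by
    rw [hα]
    refine contDiff_const.div (((contDiff_const.add (contDiff_const.mul
      (contDiff_id.pow 2))).sqrt fun x => (hR x).ne').mul ?_) fun x => ?_
    · fun_prop
    · have := hR x
      have := hR' x
      positivity
  have hder : ∀ x, HasDerivAt (fun x => arctan (pinchSlope m τ₀ x)) (α x) x := fun x => by
    have h1 : HasDerivAt (fun y => 2 * m + a * y ^ 2) (a * (2 * x)) x := by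
      simpa using ((hasDerivAt_pow 2 x).const_mul a).const_add (2 * m)
    have h2 := (((hasDerivAt_id x).const_mul a).div (h1.sqrt (hR x).ne') (hR' x).ne').arctan
    simp only [pinchSlope, ← ha]
    refine h2.congr_deriv ?_
    have h3 := hR' x
    have h4 : √(2 * m + a * x ^ 2) ^ 2 = 2 * m + a * x ^ 2 := sq_sqrt (hR x).le
    simp only [Pi.div_apply, id, hα]
    generalize √(2 * m + a * x ^ 2) = r at *
    rw [← h4]
    have : 0 < r ^ 2 + a ^ 2 * x ^ 2 := by positivity
    field_simp
    linear_combination h4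
  have hw : ∀ x ∈ Icc 0 τ₀, 0 ≤ pinchSlope m τ₀ x := fun x hx => by
    have := hx.1
    rw [pinchSlope]
    positivity
  have hcont : Continuous (pinchSlope m τ₀) := by
    have : pinchSlope m τ₀ = fun x => a * x / √(2 * m + a * x ^ 2) := by
      funext x; rw [pinchSlope, ha]
    rw [this]
    exact (by fun_prop : Continuous fun x => a * x).div (by fun_prop) fun x => (hR' x).ne'
  obtain ⟨B₁, h₁⟩ := isCompact_Icc.exists_bound_of_continuousOn (s := Icc 0 τ₀) hcont.continuousOn
  obtain ⟨B₂, h₂⟩ := isCompact_Icc.exists_bound_of_continuousOn (s := Icc 0 τ₀)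
    hαd.continuous.continuousOn
  obtain ⟨B₃, h₃⟩ := (LocallyLipschitz.locallyLipschitzOn (s := Icc 0 τ₀)
    hαd.locallyLipschitz).exists_lipschitzOnWith_of_compact isCompact_Icc
  have hB : 0 ≤ B₁ := (norm_nonneg _).trans (h₁ 0 ⟨le_rfl, hτ.le⟩)
  have hB' : 0 ≤ B₂ := (norm_nonneg _).trans (h₂ 0 ⟨le_rfl, hτ.le⟩)
  refine ⟨B₁ + B₂ + B₃, α, hm, hτ, sqrt_pos.2 (by positivity), by positivity, ?_, rfl, hw, ?_,
    hder, ?_, ?_⟩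
  · simp [pinchSlope]
  · intro x hx
    have := (le_abs_self _).trans (h₁ x hx)
    linarith [B₃.coe_nonneg]
  · intro x hx
    have := h₂ x hx
    rw [norm_eq_abs] at this
    linarith [B₃.coe_nonneg]
  · intro x hx y hy
    have := h₃.dist_le_mul x hx y hy
    rw [dist_eq, dist_eq] at this
    refine this.trans ?_
    gcongr
    linarith

theorem exists_pinchingFlow_squareFlow {m τ₀ : ℝ} (hm : 0 < m) (hτ : 0 < τ₀) :
    ∃ T c w₀ U w g γ, PinchingFlow m c τ₀ √(2 * m) T w₀ U w g γ ∧
      SquareFlow (2 * m) τ₀ T (fun x t => U x t ^ 2) (fun x t => 2 * U x t * w x t)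
        (fun x t => 2 * w x t ^ 2 + 2 * U x t * ((1 + w x t ^ 2) * (g x t + m / U x t))) := by
  obtain ⟨B, α, I⟩ := exists_initialSlope hm hτ
  obtain ⟨T, U, w, g, γ, H⟩ := I.exists_pinchingFlow
  exact ⟨T, _, _, U, w, g, γ, H, H.squareFlow I.hc (fun _ _ => rfl) rfl⟩

/-- The initial time parameter is large compared to `κ`. -/
structure LargeTime (κ τ₀ : ℝ) : Prop where
  hκ : 2 ≤ κ
  large : (10 ^ 4 * κ) ^ 2 ≤ τ₀
  hlog : ∀ x, √τ₀ ≤ x → log x ≤ x / 100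

namespace LargeTime

variable {κ τ₀ : ℝ} (L : LargeTime κ τ₀)
include L

theorem tau_ge : 4 * 10 ^ 8 ≤ τ₀ := by nlinarith [L.hκ, L.large]

theorem sqrt_ge {τ : ℝ} (h : τ₀ ≤ τ) : 10 ^ 4 * κ ≤ √τ :=
  le_sqrt_of_sq_le (L.large.trans h)

end LargeTime

theorem exists_largeTime {κ : ℝ} (hκ : 2 ≤ κ) : ∃ τ₀, LargeTime κ τ₀ := by
  have h : ∀ᶠ x : ℝ in atTop, log x ≤ x / 100 := by
    have := isLittleO_log_id_atTop.bound (show (0 : ℝ) < 1 / 100 by norm_num)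
    filter_upwards [this, eventually_ge_atTop 1] with x hx h1
    rw [norm_of_nonneg (log_nonneg h1), id, norm_of_nonneg (by linarith)] at hx
    linarith
  obtain ⟨a, ha⟩ := eventually_atTop.1 h
  refine ⟨max ((10 ^ 4 * κ) ^ 2) (max a 0 ^ 2), hκ, le_max_left _ _, fun x hx => ha x ?_⟩
  have h1 : max a 0 ≤ √(max ((10 ^ 4 * κ) ^ 2) (max a 0 ^ 2)) :=
    le_sqrt_of_sq_le (le_max_right _ _)
  exact (le_max_left _ _).trans (h1.trans hx)

/-- Slope of the lower barrier as a function of the rescaled time. -/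
noncomputable def lowerP (κ τ : ℝ) : ℝ := κ / (τ + 64 * √τ)

theorem lowerP_pos {κ τ : ℝ} (hκ : 0 < κ) (hτ : 0 < τ) : 0 < lowerP κ τ := by
  have := sqrt_pos.2 hτ
  rw [lowerP]; positivity

theorem lowerP_anti {κ τ τ' : ℝ} (hκ : 0 < κ) (hτ : 0 < τ) (h : τ ≤ τ') :
    lowerP κ τ' ≤ lowerP κ τ := by
  have := sqrt_pos.2 hτ
  have := sqrt_le_sqrt h
  rw [lowerP, lowerP]
  gcongr

theorem hasDerivAt_lowerP {κ τ : ℝ} (hτ : 0 < τ) :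
    HasDerivAt (lowerP κ) (-(lowerP κ τ ^ 2 * (1 + 32 / √τ) / κ)) τ := by
  have h0 := sqrt_pos.2 hτ
  have h1 : HasDerivAt (fun τ => τ + 64 * √τ) (1 + 64 * (1 / (2 * √τ))) τ :=
    (hasDerivAt_id τ).add ((hasDerivAt_sqrt hτ.ne').const_mul 64)
  refine ((hasDerivAt_const τ κ).div h1 (by positivity)).congr_deriv ?_
  rw [lowerP]
  field_simp
  ring

/-- At a contact with the lower barrier the flow is faster than the barrier. -/
theorem lower_contact_lt {κ ω θ s v x q qx Wxx P : ℝ} (hκ : 2 ≤ κ) (hω : 10 ^ 4 * κ ≤ ω)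
    (hθ : 1 - 2 / ω ^ 2 ≤ θ) (hs : 0 < s) (hx : 0 < x) (hP : 0 < P) (hPω : P ≤ κ / ω ^ 2)
    (hv : κ * s * (1 - 1 / ω ^ 2) ≤ v) (hq : 0 ≤ q) (hqx : qx ≤ x * P ^ 2 / (2 * v))
    (hW : 0 ≤ Wxx) :
    x * (-(P ^ 2 * (1 + 32 / ω) / κ) * (θ / s)) < Wxx / (1 + q) - (P + 2) * qx / (1 + q) ^ 2 := by
  have hω0 : 0 < ω := by linarith
  have hκ0 : 0 < κ := by linarith
  obtain ⟨ε, hε⟩ : ∃ ε, ε = 1 / ω := ⟨_, rfl⟩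
  have hε0 : 0 < ε := hε ▸ by positivity
  have hεκ : ε * (10 ^ 4 * κ) ≤ 1 := by
    rw [hε, one_div, inv_mul_le_iff₀ hω0]; linarith
  have hε1 : ε ≤ 1 / 20000 := by nlinarith
  have e1 : 1 / ω ^ 2 = ε ^ 2 := by rw [hε]; ring
  have e2 : 2 / ω ^ 2 = 2 * ε ^ 2 := by rw [hε]; ring
  have e3 : 32 / ω = 32 * ε := by rw [hε]; ring
  have e4 : κ / ω ^ 2 = κ * ε ^ 2 := by rw [hε]; ring
  rw [e1] at hv
  rw [e2] at hθ
  rw [e4] at hPω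
  rw [e3]
  have hε2 : ε ^ 2 ≤ ε / 20000 := by nlinarith
  have hv0 : 0 < v := lt_of_lt_of_le (mul_pos (mul_pos hκ0 hs) (by nlinarith)) hv
  have h1 : 0 ≤ Wxx / (1 + q) := by positivity
  have h2 : (P + 2) * qx / (1 + q) ^ 2 ≤ (P + 2) * (x * P ^ 2 / (2 * v)) := by
    rw [div_le_iff₀ (by positivity)]
    have h3 : 0 ≤ (P + 2) * (x * P ^ 2 / (2 * v)) := by positivity
    have h4 : (P + 2) * qx ≤ (P + 2) * (x * P ^ 2 / (2 * v)) := by gcongr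
    nlinarith [mul_nonneg h3 hq, mul_nonneg h3 (sq_nonneg q)]
  have h5 : (1 + P / 2) / v < (1 + 32 * ε) * θ / (κ * s) := by
    rw [div_lt_div_iff₀ hv0 (by positivity)]
    have hκs : 0 < κ * s := by positivity
    have h6 : 1 + P / 2 < (1 + 32 * ε) * θ * (1 - ε ^ 2) := by
      have : P ≤ ε := by nlinarith
      have h7 : (1 + 32 * ε) * (1 - 2 * ε ^ 2) ≤ (1 + 32 * ε) * θ := by gcongr
      have h8 : 1 + 31 * ε ≤ (1 + 32 * ε) * (1 - 2 * ε ^ 2) := by nlinarith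
      nlinarith
    have h9 : 0 < (1 + 32 * ε) * θ := by
      have : 0 < θ := by nlinarith
      positivity
    calc (1 + P / 2) * (κ * s) < (1 + 32 * ε) * θ * (1 - ε ^ 2) * (κ * s) := by gcongr
      _ = (1 + 32 * ε) * θ * (κ * s * (1 - ε ^ 2)) := by ring
      _ ≤ _ := by gcongr
  have h10 : x * P ^ 2 * ((1 + P / 2) / v) < x * P ^ 2 * ((1 + 32 * ε) * θ / (κ * s)) := by gcongr
  have e5 : (P + 2) * (x * P ^ 2 / (2 * v)) = x * P ^ 2 * ((1 + P / 2) / v) := by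
    field_simp; ring
  have e6 : x * (-(P ^ 2 * (1 + 32 * ε) / κ) * (θ / s))
      = -(x * P ^ 2 * ((1 + 32 * ε) * θ / (κ * s))) := by
    field_simp
  linarith

theorem flux_le {w x P η v : ℝ} (hη : 0 ≤ η) (hP : 0 < P) (hv : 0 < v) (hw : w = x * P - η)
    (hx : 0 ≤ x) (h : η ^ 2 ≤ 2 * (v * P)) :
    w * (P - w ^ 2 / (2 * v)) / (2 * v) ≤ x * P ^ 2 / (2 * v) := by
  refine (div_le_div_iff_of_pos_right (by positivity)).2 ?_
  rcases le_total 0 w with hw' | hw'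
  · calc w * (P - w ^ 2 / (2 * v)) ≤ w * P := by
          gcongr
          linarith [show 0 ≤ w ^ 2 / (2 * v) by positivity]
      _ ≤ (x * P) * P := by gcongr; linarith
      _ = x * P ^ 2 := by ring
  · have h6 : w ^ 2 / (2 * v) ≤ P := by
      rw [div_le_iff₀ (by positivity)]
      have : 0 ≤ x * P := by positivity
      nlinarith
    have : w * (P - w ^ 2 / (2 * v)) ≤ 0 := mul_nonpos_of_nonpos_of_nonneg hw' (by linarith)
    have : 0 ≤ x * P ^ 2 := by positivity
    linarith

theorem lower_boundary_absurd {κ x P η w v : ℝ} (hκ : 0 < κ) (hP : 0 < P) (hx : 0 < x)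
    (h3 : 2 * η < P) (h5 : 0 ≤ w) (hw : w ≤ x * P) (h4 : w ^ 2 * (2 + x) = 2 * κ * v)
    (h11 : x ^ 2 * P / 2 - η * x ≤ v) (h8 : 10 ^ 4 * κ ≤ √x) (hκ2 : 2 ≤ κ)
    (h7 : P ≤ lowerP κ x) : False := by
  have h6 : P * (2 + x) ≤ κ * (1 - 1 / x) := by
    have h9 : lowerP κ x * (2 + x) ≤ κ * (1 - 1 / x) := by
      have e : κ * (1 - 1 / x) = κ * (x - 1) / x := by field_simp
      rw [lowerP, e, div_mul_eq_mul_div, div_le_div_iff₀ (by positivity) hx, mul_assoc, mul_assoc]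
      refine mul_le_mul_of_nonneg_left ?_ hκ.le
      have h9 : √x * √x = x := mul_self_sqrt hx.le
      have h10 : 10 ^ 4 ≤ √x := by linarith
      have h11 : √x ≤ x := by nlinarith
      have h12 : 10 ^ 4 * x ≤ √x * x := by gcongr
      nlinarith
    exact (mul_le_mul_of_nonneg_right h7 (by linarith)).trans h9
  have h10 : w ^ 2 ≤ (x * P) ^ 2 := by gcongr
  have h12 : 2 * κ * (x ^ 2 * P / 2 - η * x) ≤ (x * P) ^ 2 * (2 + x) :=
    (mul_le_mul_of_nonneg_left h11 (by positivity)).trans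
      (h4.symm.le.trans (mul_le_mul_of_nonneg_right h10 (by positivity)))
  have h13 : (x * P) ^ 2 * (2 + x) ≤ x ^ 2 * P * (κ * (1 - 1 / x)) := by
    calc (x * P) ^ 2 * (2 + x) = x ^ 2 * P * (P * (2 + x)) := by ring
      _ ≤ _ := by gcongr
  have e : x ^ 2 * P * (κ * (1 - 1 / x)) = x ^ 2 * P * κ - x * κ * P := by field_simp
  have : 0 < x * κ * (P - 2 * η) := mul_pos (by positivity) (by linarith)
  nlinarith

namespace SquareFlow

/-- Bounds on the second derivative at the neck which are propagated by the barriers. -/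
def NeckBound (κ τ₀ : ℝ) (V Z : ℝ → ℝ → ℝ) (b : ℝ) : Prop :=
  ∀ t ∈ Icc 0 b, 0 ≤ Z 0 t ∧ Z 0 t * (τ₀ - log (V 0 t / κ)) ≤ 2 * κ ∧ Z 0 t ≤ κ / 2

variable {κ τ₀ T b : ℝ} {V W Z : ℝ → ℝ → ℝ} (H : SquareFlow κ τ₀ T V W Z) (L : LargeTime κ τ₀)

include H in
theorem zero_mem : (0 : ℝ) ∈ Icc 0 τ₀ := ⟨le_rfl, H.hτ.le⟩

include H L in
theorem clock_pos {t : ℝ} (ht : t ∈ Ico 0 T) : 0 < V 0 t / κ :=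
  div_pos (H.V_pos 0 H.zero_mem t ht) (by linarith [L.hκ])

include H in
theorem hasDerivAt_clock {t : ℝ} (ht : t ∈ Ioo 0 T) (hκ : 0 < κ) :
    HasDerivAt (fun t => V 0 t / κ) (-(1 - Z 0 t / κ)) t := by
  refine ((H.V_t t ht).div_const κ).congr_deriv ?_
  field_simp
  ring

theorem continuousOn_slice {f : ℝ → ℝ → ℝ} {J : Set ℝ} {x : ℝ}
    (hf : ContinuousOn (fun p : ℝ × ℝ => f p.1 p.2) (Icc 0 τ₀ ×ˢ J)) (hx : x ∈ Icc 0 τ₀) :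
    ContinuousOn (f x) J :=
  hf.comp (f := fun s => (x, s)) (by fun_prop) fun s hs => ⟨hx, hs⟩

variable (hb : b ∈ Ico 0 T) (N : NeckBound κ τ₀ V Z b)
include H L hb N

theorem clock_antitone : AntitoneOn (fun t => V 0 t / κ) (Icc 0 b) := by
  have hκ : 0 < κ := by linarith [L.hκ]
  refine antitoneOn_of_hasDerivWithinAt_nonpos (convex_Icc 0 b)
    (f' := fun t => -(1 - Z 0 t / κ)) ?_ (fun t ht => ?_) fun t ht => ?_
  · exact ((continuousOn_slice H.cont_V H.zero_mem).mono
      (Icc_subset_Ico_right hb.2)).div_const κ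
  · rw [interior_Icc] at ht
    exact (H.hasDerivAt_clock ⟨ht.1, ht.2.trans hb.2⟩ hκ).hasDerivWithinAt
  · have h1 := (N t (interior_subset ht)).2.2
    have : Z 0 t / κ ≤ 1 := by rw [div_le_one hκ]; linarith
    linarith

theorem clock_le_one {t : ℝ} (ht : t ∈ Icc 0 b) : V 0 t / κ ≤ 1 := by
  have hκ : 0 < κ := by linarith [L.hκ]
  have := H.clock_antitone L hb N ⟨le_rfl, hb.1⟩ ht ht.1
  simpa [H.V_initial, div_self hκ.ne'] using this

theorem tau_le {t : ℝ} (ht : t ∈ Icc 0 b) : τ₀ ≤ τ₀ - log (V 0 t / κ) := by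
  have := log_nonpos (H.clock_pos L ⟨ht.1, ht.2.trans_lt hb.2⟩).le (H.clock_le_one L hb N ht)
  linarith

theorem speed_bounds {t : ℝ} (ht : t ∈ Icc 0 b) :
    1 - 2 / (τ₀ - log (V 0 t / κ)) ≤ 1 - Z 0 t / κ ∧ 1 - Z 0 t / κ ≤ 1 := by
  have hκ : 0 < κ := by linarith [L.hκ]
  obtain ⟨h1, h2, -⟩ := N t ht
  have h3 := H.tau_le L hb N ht
  have h4 := H.hτ
  have : 0 ≤ Z 0 t / κ := by positivity
  refine ⟨?_, by linarith⟩
  have : Z 0 t / κ ≤ 2 / (τ₀ - log (V 0 t / κ)) := by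
    rw [div_le_div_iff₀ hκ (by linarith)]
    exact h2
  linarith

theorem lower_barrier_strict {η t₀ : ℝ} (ht₀ : t₀ ∈ Icc 0 b) (hη : 0 < η)
    (h1 : η * τ₀ * (τ₀ - log (V 0 b / κ)) ≤ V 0 b)
    (h2 : η ^ 2 ≤ V 0 b * lowerP κ (τ₀ - log (V 0 b / κ)))
    (h3 : 2 * η < lowerP κ (τ₀ - log (V 0 b / κ))) {x₀ : ℝ} (hx₀ : x₀ ∈ Icc 0 τ₀) :
    x₀ * lowerP κ (τ₀ - log (V 0 t₀ / κ)) - η - W x₀ t₀ < 0 := by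
  have hκ2 := L.hκ
  have hκ : 0 < κ := by linarith
  have hτ := L.tau_ge
  have hτ0 := H.hτ
  have hbb : b ∈ Icc 0 b := ⟨hb.1, le_rfl⟩
  have hsub : Icc 0 b ⊆ Ico 0 T := Icc_subset_Ico_right hb.2
  have hPb : ∀ t ∈ Icc 0 b, lowerP κ (τ₀ - log (V 0 b / κ)) ≤ lowerP κ (τ₀ - log (V 0 t / κ)) :=
    fun t ht => by
      refine lowerP_anti hκ (hτ0.trans_le (H.tau_le L hb N ht)) ?_
      have := log_le_log (H.clock_pos L hb) (H.clock_antitone L hb N ht hbb ht.2)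
      linarith
  have hVb : ∀ t ∈ Icc 0 b, V 0 b ≤ V 0 t := fun t ht =>
    (div_le_div_iff_of_pos_right hκ).1 (H.clock_antitone L hb N ht hbb ht.2)
  have hτb : ∀ t ∈ Icc 0 b, τ₀ - log (V 0 t / κ) ≤ τ₀ - log (V 0 b / κ) := fun t ht => by
    have := log_le_log (H.clock_pos L hb) (H.clock_antitone L hb N ht hbb ht.2)
    linarith
  have hcont : ContinuousOn (fun t => lowerP κ (τ₀ - log (V 0 t / κ))) (Icc 0 b) := fun t ht => by
    have h4 := (hasDerivAt_lowerP (κ := κ) (hτ0.trans_le (H.tau_le L hb N ht))).continuousAt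
    have h5 : ContinuousWithinAt (fun t => V 0 t / κ) (Icc 0 b) t :=
      (((continuousOn_slice H.cont_V H.zero_mem).mono hsub).div_const κ) t ht
    exact h4.comp_continuousWithinAt (f := fun t => τ₀ - log (V 0 t / κ))
      (continuousWithinAt_const.sub (h5.log (H.clock_pos L (hsub ht)).ne'))
  have hP0 : ∀ t ∈ Icc 0 b, 0 < lowerP κ (τ₀ - log (V 0 t / κ)) := fun t ht =>
    lowerP_pos hκ (hτ0.trans_le (H.tau_le L hb N ht))
  refine neg_of_no_first_contact (K := Icc 0 τ₀) (a := 0) (b := b)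
    (D := fun x t => x * lowerP κ (τ₀ - log (V 0 t / κ)) - η - W x t) isCompact_Icc ?_ ?_ ?_ t₀ ht₀
    x₀ hx₀
  · have h4 : ContinuousOn (fun p : ℝ × ℝ => lowerP κ (τ₀ - log (V 0 p.2 / κ)))
        (Icc 0 τ₀ ×ˢ Icc 0 b) := hcont.comp continuousOn_snd fun p hp => hp.2
    have h5 := H.cont_W.mono (prod_mono (le_refl (Icc 0 τ₀)) hsub)
    fun_prop
  · intro x hx
    simp only [H.W_initial x hx, H.V_initial, div_self hκ.ne', log_one, sub_zero]
    have h4 : lowerP κ τ₀ ≤ κ / τ₀ := by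
      rw [lowerP]
      gcongr
      linarith [sqrt_nonneg τ₀]
    have := mul_le_mul_of_nonneg_left h4 hx.1
    linarith
  · intro t ht x hx hD0 hDs hDt
    have htI : t ∈ Icc 0 b := ⟨ht.1.le, ht.2⟩
    have htT : t ∈ Ioo 0 T := ⟨ht.1, ht.2.trans_lt hb.2⟩
    have htT' := Ioo_subset_Ico_self htT
    obtain ⟨τ, hτd⟩ : ∃ τ, τ = τ₀ - log (V 0 t / κ) := ⟨_, rfl⟩
    obtain ⟨P, hPd⟩ : ∃ P, P = lowerP κ τ := ⟨_, rfl⟩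
    have hττ : τ₀ ≤ τ := hτd ▸ H.tau_le L hb N htI
    have hτ1 : 0 < τ := by linarith
    have hPP := hPb t htI
    have hPpos := hP0 t htI
    simp only [← hτd, ← hPd] at hD0 hDt hPP hPpos
    have hVlow : ∀ y ∈ Icc 0 τ₀, V 0 t + y ^ 2 * P / 2 - η * y ≤ V y t := fun y hy => by
      have h4 : ∀ z ∈ Icc 0 τ₀, HasDerivWithinAt
          (fun z => V z t - (z ^ 2 * P / 2 - η * z)) (W z t - (z * P - η)) (Icc 0 τ₀) z :=
        fun z hz => by
          refine (H.V_x z hz t htT').sub (HasDerivAt.hasDerivWithinAt ?_)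
          refine ((((hasDerivAt_pow 2 z).mul_const P).div_const 2).sub
            ((hasDerivAt_id z).const_mul η)).congr_deriv ?_
          push_cast
          ring
      have := le_of_hasDerivWithinAt_nonneg h4 hy fun z hz => by
        linarith [hDt z ⟨hz.1, hz.2.trans hy.2⟩]
      norm_num at this
      linarith
    have hVx := hVlow x hx
    have hVbt := hVb t htI
    have h3' : 2 * η < P := h3.trans_le hPP
    have hVb0 : 0 < V 0 b := H.V_pos 0 H.zero_mem b hb
    have hPκ : P ≤ κ / (τ + 64 * √τ) := hPd.le
    have hsq : 10 ^ 4 * κ ≤ √τ := L.sqrt_ge hττ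
    have hPτ : P ≤ κ / τ := hPκ.trans (by gcongr; linarith)
    rcases eq_or_lt_of_le hx.1 with rfl | hx0
    · rw [H.W_zero t htT'] at hD0
      linarith
    rcases eq_or_lt_of_le hx.2 with rfl | hxA
    · have h4 := H.W_right_sq t htT'
      have h5 := H.W_right_nonneg t htT'
      exact lower_boundary_absurd hκ hPpos hx0 h3' h5 (by linarith) h4
        (by linarith) (L.sqrt_ge le_rfl) hκ2 (hPd ▸ lowerP_anti hκ hx0 hττ)
    · obtain ⟨Wt, Wxx, hWt, hWxx, e⟩ := H.W_t x ⟨hx0, hxA⟩ t htT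
      have hs := H.clock_pos L htT'
      have hcd := H.hasDerivAt_clock htT hκ
      have hτt : HasDerivAt (fun t => τ₀ - log (V 0 t / κ))
          ((1 - Z 0 t / κ) / (V 0 t / κ)) t := by
        refine ((hcd.log hs.ne').const_sub τ₀).congr_deriv ?_
        rw [neg_div, neg_neg]
      have hlp : HasDerivAt (lowerP κ) (-(P ^ 2 * (1 + 32 / √τ) / κ)) (τ₀ - log (V 0 t / κ)) := by
        rw [← hτd, hPd]
        exact hasDerivAt_lowerP hτ1
      have hcomp := hlp.comp (h := fun t => τ₀ - log (V 0 t / κ)) t hτt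
      have hDt' := deriv_nonneg_of_first_contact ht.1
        (f := fun t => x * lowerP κ (τ₀ - log (V 0 t / κ)) - η - W x t)
        (((hcomp.const_mul x).sub_const η).fun_sub hWt) (by
          simp only [← hτd, ← hPd]; exact hD0)
        (fun s hs => hDs s hs x hx)
      obtain ⟨h4, h5⟩ := second_deriv_test (f := fun y => y * P - η - W y t)
        (f' := fun y => P - Z y t) (f'' := -Wxx) ⟨hx0, hxA⟩ (fun y hy => by
          have h6 := (H.W_x y (Ioo_subset_Icc_self hy) t htT').hasDerivAt
            (Icc_mem_nhds hy.1 hy.2)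
          simpa using (((hasDerivAt_id y).mul_const P).sub_const η).fun_sub h6)
        (hWxx.const_sub P) (fun y hy => by rw [hD0]; exact hDt y hy)
      have hZ : Z x t = P := by linarith
      have hv0 := H.V_pos x hx t htT'
      have hvκ : κ * (V 0 t / κ) * (1 - 1 / √τ ^ 2) ≤ V x t := by
        rw [sq_sqrt hτ1.le, mul_div_cancel₀ _ hκ.ne']
        have h6 : η * x * τ ≤ V 0 t := by
          have : η * x * τ ≤ η * τ₀ * (τ₀ - log (V 0 b / κ)) := by
            have := hτb t htI
            rw [← hτd] at this
            have := hx.2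
            gcongr
          linarith
        have h7 : η * x ≤ V 0 t / τ := by rwa [le_div_iff₀ hτ1]
        have : V 0 t * (1 - 1 / τ) = V 0 t - V 0 t / τ := by ring
        have : 0 ≤ x ^ 2 * P / 2 := by positivity
        linarith
      have hqx : W x t * (P - W x t ^ 2 / (2 * V x t)) / (2 * V x t)
          ≤ x * P ^ 2 / (2 * V x t) := by
        refine flux_le hη.le hPpos hv0 (by linarith) hx0.le ?_
        have h8 : V 0 t / 2 ≤ V x t := by
          refine le_trans ?_ hvκ
          rw [mul_div_cancel₀ _ hκ.ne', sq_sqrt hτ1.le]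
          have h7 : 1 / τ ≤ 1 / 2 := by gcongr; linarith
          have h6 := mul_le_mul_of_nonneg_left h7 (hVb0.trans_le hVbt).le
          linarith
        have h9 : V 0 b * lowerP κ (τ₀ - log (V 0 b / κ)) ≤ V 0 t * P :=
          mul_le_mul hVbt hPP (hP0 b hbb).le (hVb0.le.trans hVbt)
        have h10 := mul_le_mul_of_nonneg_right h8 hPpos.le
        have := mul_pos hv0 hPpos
        linarith
      have hsp := (H.speed_bounds L hb N htI).1
      rw [← hτd] at hsp
      have key := lower_contact_lt (κ := κ) (ω := √τ) (θ := 1 - Z 0 t / κ) (s := V 0 t / κ)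
        (v := V x t) (x := x) (q := W x t ^ 2 / (4 * V x t)) (Wxx := Wxx) (P := P) hκ2 hsq
        (by rwa [sq_sqrt hτ1.le]) hs hx0 hPpos (by rwa [sq_sqrt hτ1.le]) hvκ (by positivity) hqx
        (by linarith)
      rw [hZ] at e
      rw [← e] at key
      linarith

/-- Lower barrier for the slope of the squared radius. -/
theorem lower_barrier {t x : ℝ} (ht : t ∈ Icc 0 b) (hx : x ∈ Icc 0 τ₀) :
    x * lowerP κ (τ₀ - log (V 0 t / κ)) ≤ W x t := by
  have hκ : 0 < κ := by linarith [L.hκ]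
  have hV := H.V_pos 0 H.zero_mem b hb
  have hP := lowerP_pos hκ (H.hτ.trans_le (H.tau_le L hb N (t := b) ⟨hb.1, le_rfl⟩))
  have h0 : ∀ᶠ η in nhdsWithin (0 : ℝ) (Ioi 0),
      x * lowerP κ (τ₀ - log (V 0 t / κ)) - W x t ≤ η := by
    have hlt : ∀ {f : ℝ → ℝ} {c : ℝ}, Continuous f → f 0 = 0 → 0 < c →
        ∀ᶠ η in nhdsWithin (0 : ℝ) (Ioi 0), f η < c := fun hf h0 hc =>
      mem_nhdsWithin_of_mem_nhds (hf.continuousAt.eventually_lt_const (by rwa [h0]))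
    filter_upwards [self_mem_nhdsWithin,
      hlt (f := fun η => η * τ₀ * (τ₀ - log (V 0 b / κ))) (by fun_prop) (by simp) hV,
      hlt (f := fun η => η ^ 2) (by fun_prop) (by simp) (mul_pos hV hP),
      hlt (f := fun η => 2 * η) (by fun_prop) (by simp) hP] with η h1 h2 h3 h4
    linarith [H.lower_barrier_strict L hb N ht h1 h2.le h3.le h4 hx]
  have := ge_of_tendsto (tendsto_id.mono_left nhdsWithin_le_nhds) h0
  linarith

end SquareFlow

theorem upper_inner_algebra {ε z q v : ℝ} (hε : 0 < ε) (hε1 : ε ≤ 1 / 20000) (hz0 : 0 ≤ z)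
    (hz : z ≤ 8 * ε) (hq0 : 0 ≤ q) (hq : q ≤ ε ^ 2) (hv : v ≤ 1 + 51 / 100 * z) :
    (1 + 63 * ε - 11 / 10 * z) * (v * (1 + q) ^ 2) ≤ (1 + 64 * ε) * (1 - 52 / 100 * z) := by
  have hε2 : ε ^ 2 ≤ ε / 20000 := by nlinarith
  have h6 : (1 + q) ^ 2 ≤ 1 + 3 * ε ^ 2 := by nlinarith
  have h7 : v * (1 + q) ^ 2 ≤ (1 + 51 / 100 * z) * (1 + 3 * ε ^ 2) := by gcongr
  have h8 : 0 ≤ 1 + 63 * ε - 11 / 10 * z := by linarith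
  refine (mul_le_mul_of_nonneg_left h7 h8).trans ?_
  have h9 : (1 + 51 / 100 * z) * (1 + 3 * ε ^ 2) ≤ 1 + 51 / 100 * z + ε / 100 := by nlinarith
  refine (mul_le_mul_of_nonneg_left h9 h8).trans ?_
  nlinarith [mul_nonneg hz0 hε.le]

theorem upper_beta_bounds {ε r β : ℝ} (hε : 0 < ε) (hε1 : ε ≤ 1 / 20000) (hr : 1 - ε / 50 ≤ r)
    (hr1 : r ≤ 1) (hβ : β = 1 / (r ^ 2 * (1 - 64 * ε))) : 1 + 64 * ε ≤ β ∧ β ≤ 101 / 100 := by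
  have hr0 : 0 < r := by linarith
  have h64 : 0 < 1 - 64 * ε := by linarith
  constructor
  · rw [hβ, le_div_iff₀ (by positivity)]
    have : r ^ 2 ≤ 1 := by nlinarith
    nlinarith [mul_le_mul_of_nonneg_right this (show 0 ≤ (1 + 64 * ε) * (1 - 64 * ε) by nlinarith)]
  · rw [hβ, div_le_iff₀ (by positivity)]
    have : 1 - ε / 25 ≤ r ^ 2 := by nlinarith
    nlinarith [mul_le_mul_of_nonneg_right this h64.le]

theorem upper_inner_flux_ge {κ ε Y r β v ν μ q : ℝ} (hκ : 2 ≤ κ) (hε : 0 < ε)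
    (hεκ : ε * (10 ^ 4 * κ) ≤ 1) (hY : 0 ≤ Y) (hY8 : Y ≤ 8)
    (hr : 1 - ε / 50 ≤ r) (hr1 : r ≤ 1) (hβ : β = 1 / (r ^ 2 * (1 - 64 * ε))) (hv : 99 / 100 ≤ v)
    (hv1 : v ≤ 1 + β * Y * ε / 2) (hν : 0 ≤ ν) (hμ : μ = Y * β * ε / (2 * v))
    (hq : q = μ * κ * β * ε ^ 2 / 2) :
    1 + 63 * ε - 11 / 10 * (Y * ε) ≤
        (1 + κ * β * (1 + ν) * ε ^ 2 / 2) * (β / v) * (1 + ν - μ) / (1 + q) ^ 2 := by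
  have hε1 : ε ≤ 1 / 20000 := by nlinarith
  have hε2 : ε ^ 2 ≤ ε / 20000 := by nlinarith
  have hr0 : 0 < r := by linarith
  have h64 : 0 < 1 - 64 * ε := by linarith
  have hv0 : 0 < v := by linarith
  obtain ⟨hβ1, hβ2⟩ := upper_beta_bounds hε hε1 hr hr1 hβ
  have hβ0 : 0 < β := by linarith
  have hμ0 : 0 ≤ μ := by rw [hμ]; positivity
  have hμ1 : μ ≤ 52 / 100 * Y * ε := by
    rw [hμ, div_le_iff₀ (by positivity)]
    have h : Y * β * ε ≤ Y * (101 / 100) * ε := by gcongr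
    have h' : 52 / 100 * Y * ε * (2 * (99 / 100)) ≤ 52 / 100 * Y * ε * (2 * v) := by gcongr
    have : 0 ≤ Y * ε := by positivity
    linarith
  have hq0 : 0 ≤ q := by rw [hq]; positivity
  have hYε : Y * ε ≤ 8 * ε := by gcongr
  have hq1 : q ≤ ε ^ 2 := by
    rw [hq]
    have h1 : μ * κ * β * ε ^ 2 / 2 = μ * (ε * κ) * β * ε / 2 := by ring
    have h2 : μ * (ε * κ) * β * ε / 2 ≤
        (52 / 100 * (8 * ε)) * (1 / 10 ^ 4) * (101 / 100) * ε / 2 := by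
      gcongr
      · linarith
      · linarith
    rw [h1]
    linarith [sq_nonneg ε]
  have hv2 : v ≤ 1 + 51 / 100 * Y * ε := by
    have : β * Y * ε ≤ 101 / 100 * Y * ε := by gcongr
    have : 0 ≤ Y * ε := by positivity
    linarith
  have h0 : 0 ≤ 1 - μ := by linarith
  have h1 : β / v * (1 - μ) / (1 + q) ^ 2 ≤
      (1 + κ * β * (1 + ν) * ε ^ 2 / 2) * (β / v) * (1 + ν - μ) / (1 + q) ^ 2 := by
    have h2 : 1 ≤ 1 + κ * β * (1 + ν) * ε ^ 2 / 2 := by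
      have : 0 ≤ κ * β * (1 + ν) * ε ^ 2 / 2 := by positivity
      linarith
    have h3 : β / v ≤ (1 + κ * β * (1 + ν) * ε ^ 2 / 2) * (β / v) :=
      le_mul_of_one_le_left (by positivity) h2
    gcongr
    linarith
  refine le_trans ?_ h1
  have e0 : β / v * (1 - μ) / (1 + q) ^ 2 = β * (1 - μ) / (v * (1 + q) ^ 2) := by field_simp
  rw [e0, le_div_iff₀ (by positivity)]
  obtain ⟨z, hz⟩ : ∃ z, z = Y * ε := ⟨_, rfl⟩
  have hz0 : 0 ≤ z := hz ▸ by positivity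
  rw [mul_assoc, ← hz] at hμ1 hv2
  rw [← hz] at hYε ⊢
  have h5 : (1 + 64 * ε) * (1 - 52 / 100 * z) ≤ β * (1 - μ) := by
    gcongr
    linarith
  refine le_trans ?_ h5
  exact upper_inner_algebra hε hε1 hz0 hYε hq0 hq1 hv2

theorem upper_inner_bracket {ε θ Y r G : ℝ} (hε : 0 < ε) (hε1 : ε ≤ 1 / 20000)
    (hθ : 1 - 2 * ε ^ 2 ≤ θ) (hθ1 : θ ≤ 1) (hY : 0 ≤ Y) (hY8 : Y ≤ 8)
    (hr : 1 - ε / 50 ≤ r) (hr1 : r ≤ 1) (hG : 1 + 63 * ε - 11 / 10 * (Y * ε) ≤ G) :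
    12 * ε / (r * (1 + Y)) - G
      < θ * ((1 - 96 * ε) / (1 - 64 * ε) - (2 - ε ^ 2) / (r * (1 + Y))) := by
  have hε2 : ε ^ 2 ≤ ε / 20000 := by nlinarith
  have hr0 : 0 < r := by linarith
  have h64 : 0 < 1 - 64 * ε := by linarith
  have hY1 : 0 < 1 + Y := by linarith
  obtain ⟨i, hi⟩ : ∃ i, i = 1 / (1 + Y) := ⟨_, rfl⟩
  have hi0 : 1 / 9 ≤ i := by
    rw [hi]; gcongr; linarith
  have hi1 : i ≤ 1 := by rw [hi, div_le_one hY1]; linarith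
  have hiY : i * (1 + Y) = 1 := by rw [hi]; field_simp
  have hri : 1 / r ≤ 1 + ε / 40 := by
    rw [div_le_iff₀ hr0]
    nlinarith [mul_le_mul_of_nonneg_left hr (show 0 ≤ 1 + ε / 40 by linarith)]
  have e1 : 12 * ε / (r * (1 + Y)) = 12 * ε * (1 / r) * i := by rw [hi]; field_simp
  have e2 : (2 - ε ^ 2) / (r * (1 + Y)) = (2 - ε ^ 2) * (1 / r) * i := by rw [hi]; field_simp
  have hr2 : 1 ≤ 1 / r := by rw [le_div_iff₀ hr0]; linarith
  have h1 : 12 * ε * (1 / r) * i ≤ 13 * ε := by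
    have : 12 * ε * (1 / r) * i ≤ 12 * ε * (1 + ε / 40) * 1 := by gcongr
    linarith
  have h2 : (2 - ε ^ 2) * (1 / r) * i ≤ 2 * i + ε / 20 := by
    have : (2 - ε ^ 2) * (1 / r) * i ≤ 2 * (1 + ε / 40) * i := by
      gcongr
      linarith [sq_nonneg ε]
    have := mul_le_mul_of_nonneg_left hi1 hε.le
    linarith
  have h2' : 0 ≤ (2 - ε ^ 2) * (1 / r) * i := by
    have : 0 ≤ 2 - ε ^ 2 := by linarith
    positivity
  have h3 : 1 - 33 * ε ≤ (1 - 96 * ε) / (1 - 64 * ε) := by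
    rw [le_div_iff₀ h64]; nlinarith
  have h4 : (1 - 96 * ε) / (1 - 64 * ε) ≤ 1 := by
    rw [div_le_one h64]; linarith
  rw [e1, e2]
  obtain ⟨B, hB⟩ : ∃ B, B = (1 - 96 * ε) / (1 - 64 * ε) - (2 - ε ^ 2) * (1 / r) * i := ⟨_, rfl⟩
  have hB1 : 1 - 33 * ε - (2 * i + ε / 20) ≤ B := by linarith
  have hB2 : B ≤ 1 := by linarith
  have h5 : B - 6 * ε ^ 2 ≤ θ * B := by
    have : -3 ≤ B := by linarith
    have h6 : 0 ≤ 1 - θ := by linarith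
    have h7 := mul_le_mul_of_nonneg_left hB2 h6
    linarith [sq_nonneg ε]
  rw [← hB]
  have h7 : 11 / 10 * (Y * ε) ≤ 2 * (Y * i) := by
    have : ε ≤ i := by linarith
    linarith [mul_le_mul_of_nonneg_left this hY, mul_nonneg hY (hε.le.trans this)]
  linarith

/-- Core inequality for the upper barrier in the inner region. -/
theorem upper_core_inner {κ ε θ Y r β v ν μ q : ℝ} (hκ : 2 ≤ κ) (hε : 0 < ε)
    (hεκ : ε * (10 ^ 4 * κ) ≤ 1) (hθ : 1 - 2 * ε ^ 2 ≤ θ) (hθ1 : θ ≤ 1) (hY : 0 ≤ Y) (hY8 : Y ≤ 8)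
    (hr : 1 - ε / 50 ≤ r) (hr1 : r ≤ 1) (hβ : β = 1 / (r ^ 2 * (1 - 64 * ε))) (hv : 99 / 100 ≤ v)
    (hv1 : v ≤ 1 + β * Y * ε / 2) (hν : 0 ≤ ν) (hμ : μ = Y * β * ε / (2 * v))
    (hq : q = μ * κ * β * ε ^ 2 / 2) :
    12 * ε / (r * (1 + Y)) - (1 + κ * β * (1 + ν) * ε ^ 2 / 2) * (β / v) * (1 + ν - μ) / (1 + q) ^ 2
      < θ * ((1 - 96 * ε) / (1 - 64 * ε) - (2 - ε ^ 2) / (r * (1 + Y))) :=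
  upper_inner_bracket hε (by nlinarith) hθ hθ1 hY hY8 hr hr1
    (upper_inner_flux_ge hκ hε hεκ hY hY8 hr hr1 hβ hv hv1 hν hμ hq)

theorem upper_bracket {ε θ ρ G : ℝ} (hε : 0 < ε) (hε1 : ε ≤ 1 / 20000)
    (hθ : 1 - 2 * ε ^ 2 ≤ θ) (hρ : 81 / 10 ≤ ρ) (hG : -(32 / 100) ≤ G) :
    12 * ε / ρ - G < θ * ((1 - 96 * ε) / (1 - 64 * ε) - (2 - ε ^ 2) / ρ) := by
  have hε2 : ε ^ 2 ≤ ε / 20000 := by nlinarith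
  have h64 : 0 < 1 - 64 * ε := by linarith
  have hB : (2 - ε ^ 2) / ρ ≤ 1 / 4 := by
    rw [div_le_iff₀ (by positivity)]
    linarith [sq_nonneg ε]
  have h12 : 12 * ε / ρ ≤ 1 / 100 := by
    rw [div_le_iff₀ (by positivity)]
    linarith
  have h3 : 1 - 33 * ε ≤ (1 - 96 * ε) / (1 - 64 * ε) := by
    rw [le_div_iff₀ h64]; nlinarith
  have hθ0 : 99 / 100 ≤ θ := by linarith
  have hB2 : 7 / 10 ≤ (1 - 96 * ε) / (1 - 64 * ε) - (2 - ε ^ 2) / ρ := by linarith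
  linarith [mul_le_mul_of_nonneg_left hB2 (show (0 : ℝ) ≤ θ by linarith)]

/-- Core inequality for the upper barrier in the intermediate region. -/
theorem upper_core_middle {κ ε θ Y r β v ν μ q : ℝ} (hκ : 2 ≤ κ) (hε : 0 < ε)
    (hεκ : ε * (10 ^ 4 * κ) ≤ 1) (hθ : 1 - 2 * ε ^ 2 ≤ θ) (hY8 : 8 ≤ Y)
    (hr : 9 / 10 ≤ r) (hβ : β = 1 / (r ^ 2 * (1 - 64 * ε)))
    (hv : 99 / 100 + Y * ε / (2 * (1 + 64 * ε)) ≤ v) (hν : 0 ≤ ν) (hν1 : ν ≤ 4 * ε ^ 2 / r)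
    (hμ : μ = Y * β * ε / (2 * v)) (hq : 0 ≤ q) :
    12 * ε / (r * (1 + Y)) - (1 + κ * β * (1 + ν) * ε ^ 2 / 2) * (β / v) * (1 + ν - μ) / (1 + q) ^ 2
      < θ * ((1 - 96 * ε) / (1 - 64 * ε) - (2 - ε ^ 2) / (r * (1 + Y))) := by
  have hε1 : ε ≤ 1 / 20000 := by nlinarith
  have hε2 : ε ^ 2 ≤ ε / 20000 := by nlinarith
  have hr0 : 0 < r := by linarith
  have h64 : 0 < 1 - 64 * ε := by linarith
  have hβ0 : 0 < β := by rw [hβ]; positivity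
  have hβ2 : β ≤ 124 / 100 := by
    rw [hβ, div_le_iff₀ (by positivity)]
    have h1 : 81 / 100 ≤ r ^ 2 := by nlinarith
    have h2 : 81 / 100 * (1 - 64 / 20000) ≤ r ^ 2 * (1 - 64 * ε) := by gcongr; linarith
    norm_num at h2 ⊢
    linarith
  have hY0 : 0 < Y := by linarith
  have hv1 : 99 / 100 ≤ v := by
    have : 0 ≤ Y * ε / (2 * (1 + 64 * ε)) := by positivity
    linarith
  have hv0 : 0 < v := by linarith
  have hμ0 : 0 ≤ μ := by rw [hμ]; positivity
  have hμ1 : μ ≤ 1245 / 1000 := by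
    have h1 : Y * ε / (2 * (1 + 64 * ε)) ≤ v := by linarith
    have h2 : Y * ε ≤ 2 * (1 + 64 * ε) * v := by
      rw [div_le_iff₀ (by positivity)] at h1
      linarith
    have h3 : μ ≤ β * (1 + 64 * ε) := by
      rw [hμ, div_le_iff₀ (by positivity)]
      linarith [mul_le_mul_of_nonneg_right h2 hβ0.le]
    have h4 : β * (1 + 64 * ε) ≤ 124 / 100 * (1 + 64 / 20000) := by gcongr; linarith
    norm_num at h4 ⊢
    linarith
  have hν2 : ν ≤ 1 := by
    refine hν1.trans ?_
    rw [div_le_one hr0]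
    nlinarith
  have hpre : 1 + κ * β * (1 + ν) * ε ^ 2 / 2 ≤ 1001 / 1000 := by
    have : κ * β * (1 + ν) * ε ^ 2 / 2 = (ε * κ) * β * (1 + ν) * ε / 2 := by ring
    have h2 : (ε * κ) * β * (1 + ν) * ε / 2 ≤
        (1 / 10 ^ 4) * (124 / 100) * (1 + 1) * (1 / 20000) / 2 := by
      gcongr
      linarith
    norm_num at h2 ⊢
    linarith
  have hpre0 : 0 ≤ κ * β * (1 + ν) * ε ^ 2 / 2 := by positivity
  have hβv : β / v ≤ 1253 / 1000 := by
    rw [div_le_iff₀ hv0]; linarith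
  have hG : -(32 / 100) ≤
      (1 + κ * β * (1 + ν) * ε ^ 2 / 2) * (β / v) * (1 + ν - μ) / (1 + q) ^ 2 := by
    rw [le_div_iff₀ (by positivity)]
    have h1 : (1 + κ * β * (1 + ν) * ε ^ 2 / 2) * (β / v) ≤ 1001 / 1000 * (1253 / 1000) := by
      gcongr
    have h2 : 0 ≤ (1 + κ * β * (1 + ν) * ε ^ 2 / 2) * (β / v) := by positivity
    have h3 : -(245 / 1000) ≤ 1 + ν - μ := by linarith
    linarith [mul_le_mul_of_nonneg_left h3 h2, sq_nonneg q]
  refine upper_bracket hε hε1 hθ ?_ hG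
  have : 9 / 10 * (1 + 8) ≤ r * (1 + Y) := by gcongr
  linarith

/-- Core inequality for the upper barrier in the outer region. -/
theorem upper_core_outer {κ ε θ Y r β v ν μ q : ℝ} (hκ : 2 ≤ κ) (hε : 0 < ε)
    (hεκ : ε * (10 ^ 4 * κ) ≤ 1) (hθ : 1 - 2 * ε ^ 2 ≤ θ) (hY : 1 ≤ ε ^ 14 * Y)
    (hr : ε ^ 2 ≤ r) (hβ : β = 1 / (r ^ 2 * (1 - 64 * ε)))
    (hv : 99 / 100 + Y * ε / (2 * (1 + 64 * ε)) ≤ v) (hν : 0 ≤ ν) (hν1 : ν ≤ 4 * ε ^ 2 / r)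
    (hμ : μ = Y * β * ε / (2 * v)) (hq : 0 ≤ q) :
    12 * ε / (r * (1 + Y)) - (1 + κ * β * (1 + ν) * ε ^ 2 / 2) * (β / v) * (1 + ν - μ) / (1 + q) ^ 2
      < θ * ((1 - 96 * ε) / (1 - 64 * ε) - (2 - ε ^ 2) / (r * (1 + Y))) := by
  have hε1 : ε ≤ 1 / 20000 := by nlinarith
  have hε2 : ε ^ 2 ≤ ε / 20000 := by nlinarith
  have hr0 : 0 < r := lt_of_lt_of_le (by positivity) hr
  have h64 : 0 < 1 - 64 * ε := by linarith
  have hβ0 : 0 < β := by rw [hβ]; positivity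
  have hβ2 : β * ε ^ 4 ≤ 101 / 100 := by
    rw [hβ, div_mul_eq_mul_div, div_le_iff₀ (by positivity)]
    have h1 : (ε ^ 2) ^ 2 ≤ r ^ 2 := by gcongr
    have h2 : (ε ^ 2) ^ 2 * (1 - 64 / 20000) ≤ r ^ 2 * (1 - 64 * ε) := by gcongr; linarith
    have : 0 < ε ^ 4 := by positivity
    nlinarith
  have hY0 : 0 < Y := pos_of_mul_pos_right (by linarith : 0 < ε ^ 14 * Y) (by positivity)
  have hv1 : Y * ε / 3 ≤ v := by
    have : Y * ε / 3 ≤ Y * ε / (2 * (1 + 64 * ε)) := by gcongr; linarith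
    linarith
  have hv0 : 0 < v := lt_of_lt_of_le (by positivity) hv1
  have hμ0 : 0 ≤ μ := by rw [hμ]; positivity
  have hμ1 : μ * ε ^ 4 ≤ 16 / 10 := by
    rw [hμ, div_mul_eq_mul_div, div_le_iff₀ (by positivity)]
    have h1 : Y * ε * (β * ε ^ 4) ≤ (3 * v) * (101 / 100) :=
      mul_le_mul (by linarith) hβ2 (by positivity) (by positivity)
    linarith
  have hν2 : ν ≤ 4 := by
    refine hν1.trans ?_
    rw [div_le_iff₀ hr0]
    linarith
  obtain ⟨p, hp⟩ : ∃ p, p = 1 + κ * β * (1 + ν) * ε ^ 2 / 2 := ⟨_, rfl⟩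
  have hp0 : 0 ≤ p := by rw [hp]; positivity
  have hp1 : p * ε ^ 4 ≤ 1 := by
    have h1 : p * ε ^ 4 = ε ^ 4 + (ε * κ) * (β * ε ^ 4) * (1 + ν) * ε / 2 := by rw [hp]; ring
    have h2 : (ε * κ) * (β * ε ^ 4) * (1 + ν) * ε / 2 ≤
        (1 / 10 ^ 4) * (101 / 100) * (1 + 4) * (1 / 20000) / 2 := by
      gcongr
      linarith
    have h3 : ε ^ 4 ≤ (1 / 20000) ^ 4 := by gcongr
    rw [h1]
    norm_num at h2 h3 ⊢
    linarith
  have hβv : β / v * (Y * ε ^ 5) ≤ 4 := by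
    rw [div_mul_eq_mul_div, div_le_iff₀ hv0]
    have : (Y * ε) * (β * ε ^ 4) ≤ (3 * v) * (101 / 100) :=
      mul_le_mul (by linarith) hβ2 (by positivity) (by positivity)
    linarith
  rw [← hp]
  have hG : -(1 / 10) ≤ p * (β / v) * (1 + ν - μ) / (1 + q) ^ 2 := by
    rw [le_div_iff₀ (by positivity)]
    have h1 : p * (β / v) * μ ≤ 1 / 10 := by
      have h2 : (p * ε ^ 4) * (β / v * (Y * ε ^ 5)) * (μ * ε ^ 4) ≤ 1 * 4 * (16 / 10) := by gcongr
      have h3 : p * (β / v) * μ * 1 ≤ p * (β / v) * μ * (ε ^ 14 * Y) := by gcongr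
      have h4 : p * (β / v) * μ * (ε ^ 14 * Y) =
        (p * ε ^ 4) * (β / v * (Y * ε ^ 5)) * (μ * ε ^ 4) * ε := by ring
      have h5 := mul_le_mul_of_nonneg_right h2 hε.le
      linarith
    have h2 : 0 ≤ p * (β / v) * (1 + ν) := by positivity
    linarith [sq_nonneg q]
  have hrY : 1 ≤ ε * (r * (1 + Y)) / 20 := by
    have h1 : ε ^ 2 * Y ≤ r * (1 + Y) := by gcongr; linarith
    have h2 : ε ^ 11 ≤ 1 / 20 := by
      calc ε ^ 11 ≤ (1 / 20000) ^ 11 := by gcongr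
        _ ≤ _ := by norm_num
    have h3 : ε ^ 14 * Y = ε ^ 11 * (ε * (ε ^ 2 * Y)) := by ring
    have h4 : ε ^ 11 * (ε * (ε ^ 2 * Y)) ≤ 1 / 20 * (ε * (r * (1 + Y))) := by gcongr
    linarith
  refine upper_bracket hε hε1 hθ ?_ (by linarith)
  have : ε * (r * (1 + Y)) ≤ 1 / 20000 * (r * (1 + Y)) := by gcongr
  linarith

theorem upper_core {κ ε θ Y r β v ν μ q : ℝ} (hκ : 2 ≤ κ) (hε : 0 < ε)
    (hεκ : ε * (10 ^ 4 * κ) ≤ 1) (hθ : 1 - 2 * ε ^ 2 ≤ θ) (hθ1 : θ ≤ 1) (hY : 0 ≤ Y)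
    (hin : Y ≤ 8 → 1 - ε / 50 ≤ r) (hout : r < 9 / 10 → 1 ≤ ε ^ 14 * Y) (hr : ε ^ 2 ≤ r)
    (hr1 : r ≤ 1) (hβ : β = 1 / (r ^ 2 * (1 - 64 * ε)))
    (hv : 99 / 100 + Y * ε / (2 * (1 + 64 * ε)) ≤ v) (hv1 : v ≤ 1 + β * Y * ε / 2) (hν : 0 ≤ ν)
    (hν1 : ν ≤ 4 * ε ^ 2 / r) (hμ : μ = Y * β * ε / (2 * v)) (hq : q = μ * κ * β * ε ^ 2 / 2) :
    12 * ε / (r * (1 + Y)) - (1 + κ * β * (1 + ν) * ε ^ 2 / 2) * (β / v) * (1 + ν - μ) / (1 + q) ^ 2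
      < θ * ((1 - 96 * ε) / (1 - 64 * ε) - (2 - ε ^ 2) / (r * (1 + Y))) := by
  have hvY : 0 ≤ Y * ε / (2 * (1 + 64 * ε)) := by positivity
  have hv0 : 0 < v := by linarith
  have hr0 : 0 < r := lt_of_lt_of_le (by positivity) hr
  have h64 : 0 < 1 - 64 * ε := by nlinarith
  have hβ0 : 0 < β := by rw [hβ]; positivity
  have hq0 : 0 ≤ q := by rw [hq, hμ]; positivity
  rcases le_total Y 8 with h8 | h8
  · exact upper_core_inner hκ hε hεκ hθ hθ1 hY h8 (hin h8) hr1 hβ (by linarith) hv1 hν hμ hq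
  rcases le_or_gt (9 / 10) r with h9 | h9
  · exact upper_core_middle hκ hε hεκ hθ h8 h9 hβ hv hν hν1 hμ hq0
  · exact upper_core_outer hκ hε hεκ hθ (hout h9) hr hβ hv hν hν1 hμ hq0

/-- At a contact with the upper barrier the flow is slower than the barrier. -/
theorem upper_contact_lt {κ ω θ s X S ζ P v ν Wxx : ℝ} (hκ : 2 ≤ κ) (hω : 10 ^ 4 * κ ≤ ω)
    (hθ : 1 - 2 / ω ^ 2 ≤ θ) (hθ1 : θ ≤ 1) (hs : 0 < s) (hX : 0 < X) (hS : S = s * ω + X ^ 2)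
    (hζ : 1 ≤ ζ) (hζ1 : ζ ≤ ω ^ 2) (hin : X ^ 2 ≤ 8 * (s * ω) → ω ^ 2 - ω / 50 ≤ ζ)
    (hout : ζ < 9 / 10 * ω ^ 2 → s * ω ^ 15 ≤ X ^ 2) (hP : P = κ * ω ^ 3 / ((ω - 64) * ζ ^ 2))
    (hν : ν = 4 * X ^ 2 / (S * ζ))
    (hv : 99 / 100 * (κ * s) + X ^ 2 * (κ / (ω ^ 2 + 64 * ω)) / 2 ≤ v)
    (hv1 : v ≤ κ * s + X ^ 2 * P / 2) (hWxx : Wxx ≤ 12 * X * P / (S * ζ)) :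
    Wxx / (1 + (X * P) ^ 2 / (4 * v)) - (P * (1 + ν) + 2) *
        (X * P * (P * (1 + ν) - (X * P) ^ 2 / (2 * v)) / (2 * v)) / (1 + (X * P) ^ 2 / (4 * v)) ^ 2
      < X * (P * (2 * (ω - 1 / (2 * ω)) / (S * ζ) - (ω - 96) / (s * ω ^ 2 * (ω - 64))) * -θ) := by
  have hω0 : 0 < ω := by linarith
  have hω64 : 0 < ω - 64 := by linarith
  have hκ0 : 0 < κ := by linarith
  have hζ0 : 0 < ζ := by linarith
  have hS0 : 0 < S := by rw [hS]; positivity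
  have hP0 : 0 < P := by rw [hP]; positivity
  have hv0 : 0 < v := lt_of_lt_of_le (by positivity) hv
  have hν0 : 0 ≤ ν := by rw [hν]; positivity
  obtain ⟨q, hq⟩ : ∃ q, q = (X * P) ^ 2 / (4 * v) := ⟨_, rfl⟩
  have hq0 : 0 ≤ q := by rw [hq]; positivity
  have hk : 0 < X * P / (s * ω ^ 2) := by positivity
  have key := upper_core (κ := κ) (ε := 1 / ω) (θ := θ) (Y := X ^ 2 / (s * ω)) (r := ζ / ω ^ 2)
    (β := P * ω ^ 2 / κ) (v := v / (κ * s)) (ν := ν) (μ := X ^ 2 * P / (2 * v)) (q := q)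
    hκ (by positivity) (by rw [one_div, inv_mul_le_iff₀ hω0]; linarith)
    (by rw [one_div_pow]; simpa [div_eq_mul_inv] using hθ) hθ1 (by positivity)
    (fun h => by
      rw [div_le_iff₀ (by positivity)] at h
      rw [le_div_iff₀ (by positivity)]
      refine le_trans (le_of_eq ?_) (hin h)
      field_simp)
    (fun h => by
      rw [div_lt_iff₀ (by positivity)] at h
      have e : (1 / ω) ^ 14 * (X ^ 2 / (s * ω)) = X ^ 2 / (s * ω ^ 15) := by field_simp
      rw [e, le_div_iff₀ (by positivity), one_mul]
      exact hout h)
    (by rw [one_div_pow]; gcongr)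
    (by rwa [div_le_one (by positivity)])
    (by rw [hP]; field_simp)
    (by
      rw [le_div_iff₀ (by positivity)]
      refine le_trans (le_of_eq ?_) hv
      field_simp)
    (by
      rw [div_le_iff₀ (by positivity)]
      refine hv1.trans (le_of_eq ?_)
      field_simp)
    hν0
    (by
      have e : 4 * (1 / ω) ^ 2 / (ζ / ω ^ 2) = 4 / ζ := by field_simp
      rw [e, hν, div_le_div_iff₀ (by positivity) hζ0, hS]
      have : 0 ≤ s * ω * ζ := by positivity
      linarith)
    (by field_simp)
    (by rw [hq]; field_simp; ring)
  have h1 : Wxx / (1 + q) ≤ 12 * X * P / (S * ζ) := by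
    refine (div_le_div_of_nonneg_right hWxx (by positivity)).trans (div_le_self (by positivity) ?_)
    linarith
  rw [← hq]
  have h2 := mul_lt_mul_of_pos_left key hk
  have hYS : 1 + X ^ 2 / (s * ω) = S / (s * ω) := by rw [hS]; field_simp
  rw [hYS] at h2
  have e1 : X * P / (s * ω ^ 2) * (12 * (1 / ω) / (ζ / ω ^ 2 * (S / (s * ω)))) =
      12 * X * P / (S * ζ) := by field_simp
  have e2 : X * P / (s * ω ^ 2) * ((1 + κ * (P * ω ^ 2 / κ) * (1 + ν) * (1 / ω) ^ 2 / 2) *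
      (P * ω ^ 2 / κ / (v / (κ * s))) * (1 + ν - X ^ 2 * P / (2 * v)) / (1 + q) ^ 2) =
      (P * (1 + ν) + 2) *
        (X * P * (P * (1 + ν) - (X * P) ^ 2 / (2 * v)) / (2 * v)) / (1 + q) ^ 2 := by
    have : 1 + q ≠ 0 := by positivity
    clear hin hout hP hν hq key h2 hYS e1
    field_simp
    ring
  have e3 : X * P / (s * ω ^ 2) * (θ * ((1 - 96 * (1 / ω)) / (1 - 64 * (1 / ω)) -
      (2 - (1 / ω) ^ 2) / (ζ / ω ^ 2 * (S / (s * ω))))) =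
      X * (P * (2 * (ω - 1 / (2 * ω)) / (S * ζ) - (ω - 96) / (s * ω ^ 2 * (ω - 64))) * -θ) := by
    have h3 : (1 - 96 * (1 / ω)) / (1 - 64 * (1 / ω)) = (ω - 96) / (ω - 64) := by
      have : 1 - 64 * (1 / ω) = (ω - 64) / ω := by field_simp
      rw [this]
      field_simp
    rw [h3]
    clear hin hout hP hν hq key h2 hYS e1 e2 h3
    have := hω64.ne'
    field_simp
    ring
  rw [mul_sub, e1, e2, e3] at h2
  linarith

/-- The length scale squared in the upper barrier. -/
noncomputable def upperS (τ₀ x s : ℝ) : ℝ := s * √(τ₀ - log s) + x ^ 2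

/-- The logarithmic factor in the upper barrier. -/
noncomputable def upperZeta (τ₀ x s : ℝ) : ℝ := τ₀ - log (upperS τ₀ x s)

/-- The upper barrier for the quotient of the slope of the squared radius by `x`. -/
noncomputable def upperP (κ τ₀ x s : ℝ) : ℝ :=
  κ * √(τ₀ - log s) ^ 3 / ((√(τ₀ - log s) - 64) * upperZeta τ₀ x s ^ 2)

section
variable {κ τ₀ x s : ℝ}

theorem hasDerivAt_upperS_x : HasDerivAt (fun x => upperS τ₀ x s) (2 * x) x := by
  refine ((hasDerivAt_pow 2 x).const_add _).congr_deriv ?_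
  norm_num

theorem hasDerivAt_upperZeta_x (hS : upperS τ₀ x s ≠ 0) :
    HasDerivAt (fun x => upperZeta τ₀ x s) (-(2 * x / upperS τ₀ x s)) x :=
  (hasDerivAt_upperS_x.log hS).const_sub τ₀

theorem hasDerivAt_upperP_x (hS : upperS τ₀ x s ≠ 0) (hζ : upperZeta τ₀ x s ≠ 0)
    (hω : 64 < √(τ₀ - log s)) :
    HasDerivAt (fun x => upperP κ τ₀ x s)
      (upperP κ τ₀ x s * (4 * x / (upperS τ₀ x s * upperZeta τ₀ x s))) x := by
  have h64 : √(τ₀ - log s) - 64 ≠ 0 := by linarith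
  refine ((hasDerivAt_const x (κ * √(τ₀ - log s) ^ 3)).fun_div
    (((hasDerivAt_upperZeta_x hS).fun_pow 2).const_mul (√(τ₀ - log s) - 64))
    (by positivity)).congr_deriv ?_
  rw [upperP]
  field_simp
  norm_num
  ring

theorem hasDerivAt_mul_upperP (hS : upperS τ₀ x s ≠ 0) (hζ : upperZeta τ₀ x s ≠ 0)
    (hω : 64 < √(τ₀ - log s)) :
    HasDerivAt (fun x => x * upperP κ τ₀ x s)
      (upperP κ τ₀ x s * (1 + 4 * x ^ 2 / (upperS τ₀ x s * upperZeta τ₀ x s))) x := by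
  refine ((hasDerivAt_id x).fun_mul (hasDerivAt_upperP_x hS hζ hω)).congr_deriv ?_
  simp only [id]
  ring

theorem hasDerivAt_deriv_mul_upperP (hS : upperS τ₀ x s ≠ 0) (hζ : upperZeta τ₀ x s ≠ 0)
    (hω : 64 < √(τ₀ - log s)) :
    HasDerivAt (fun x => upperP κ τ₀ x s * (1 + 4 * x ^ 2 / (upperS τ₀ x s * upperZeta τ₀ x s)))
      (4 * x * upperP κ τ₀ x s / (upperS τ₀ x s * upperZeta τ₀ x s) *
        (3 - 2 * x ^ 2 / upperS τ₀ x s + 6 * x ^ 2 / (upperS τ₀ x s * upperZeta τ₀ x s))) x := by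
  have h1 := (((hasDerivAt_pow 2 x).const_mul 4).fun_div
    (hasDerivAt_upperS_x.fun_mul (hasDerivAt_upperZeta_x hS)) (mul_ne_zero hS hζ)).const_add 1
  refine ((hasDerivAt_upperP_x hS hζ hω).fun_mul h1).congr_deriv ?_
  norm_num
  field_simp
  ring

theorem hasDerivAt_sqrt_clock (hs : 0 < s) (hω : 0 < √(τ₀ - log s)) :
    HasDerivAt (fun s => √(τ₀ - log s)) (-(1 / (2 * √(τ₀ - log s) * s))) s := by
  have h := ((hasDerivAt_log hs.ne').const_sub τ₀).sqrt (sqrt_pos.1 hω).ne'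
  refine h.congr_deriv ?_
  field_simp

theorem hasDerivAt_upperP_s (hs : 0 < s) (hS : upperS τ₀ x s ≠ 0) (hζ : upperZeta τ₀ x s ≠ 0)
    (hω : 64 < √(τ₀ - log s)) :
    HasDerivAt (fun s => upperP κ τ₀ x s)
      (upperP κ τ₀ x s * (2 * (√(τ₀ - log s) - 1 / (2 * √(τ₀ - log s))) /
        (upperS τ₀ x s * upperZeta τ₀ x s) -
        (√(τ₀ - log s) - 96) / (s * √(τ₀ - log s) ^ 2 * (√(τ₀ - log s) - 64)))) s := by
  have h64 : √(τ₀ - log s) - 64 ≠ 0 := by linarith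
  have hω0 : 0 < √(τ₀ - log s) := by linarith
  have h0 := hasDerivAt_sqrt_clock hs hω0
  have h1 : HasDerivAt (fun s => upperS τ₀ x s) (√(τ₀ - log s) - 1 / (2 * √(τ₀ - log s))) s := by
    refine (((hasDerivAt_id s).fun_mul h0).add_const (x ^ 2)).congr_deriv ?_
    simp only [id]
    field_simp
    ring
  have h2 : HasDerivAt (fun s => upperZeta τ₀ x s)
      (-((√(τ₀ - log s) - 1 / (2 * √(τ₀ - log s))) / upperS τ₀ x s)) s :=
    (h1.log hS).const_sub τ₀
  refine (((h0.fun_pow 3).const_mul κ).fun_div ((h0.sub_const 64).fun_mul (h2.fun_pow 2))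
    (by positivity)).congr_deriv ?_
  rw [upperP]
  generalize √(τ₀ - log s) = ω at *
  generalize upperS τ₀ x s = S at *
  generalize upperZeta τ₀ x s = ζ at *
  norm_num
  field_simp
  ring

end

namespace LargeTime

variable {κ τ₀ x s : ℝ} (L : LargeTime κ τ₀)

theorem tau_le_clock (hs : 0 < s) (hs1 : s ≤ 1) : τ₀ ≤ τ₀ - log s := by
  linarith [log_nonpos hs.le hs1]

include L

theorem omega_ge (hs : 0 < s) (hs1 : s ≤ 1) : 10 ^ 4 * κ ≤ √(τ₀ - log s) :=
  L.sqrt_ge (tau_le_clock (τ₀ := τ₀) hs hs1)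

theorem omega_gt (hs : 0 < s) (hs1 : s ≤ 1) : 10000 < √(τ₀ - log s) := by
  linarith [L.omega_ge hs hs1, L.hκ]

theorem upperS_pos (hs : 0 < s) (hs1 : s ≤ 1) : 0 < upperS τ₀ x s := by
  have := L.omega_gt hs hs1
  rw [upperS]
  positivity

theorem upperZeta_ge (hs : 0 < s) (hs1 : s ≤ 1) (hx : 0 ≤ x) (hx1 : x ≤ τ₀ + 1) :
    τ₀ / 2 ≤ upperZeta τ₀ x s := by
  have h0 := L.tau_ge
  have h1 : upperS τ₀ x s ≤ (τ₀ + 2) ^ 2 := by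
    have h2 : s * √(τ₀ - log s) ≤ τ₀ := by
      have h3 := tau_le_clock (τ₀ := τ₀) hs hs1
      have h4 : √(τ₀ - log s) ≤ τ₀ - log s := by
        rw [sqrt_le_left (by linarith)]
        nlinarith
      have h5 : -log s ≤ 1 / s - 1 := by
        have := log_le_sub_one_of_pos (inv_pos.2 hs)
        rw [log_inv] at this
        rwa [one_div]
      have h6 : s * √(τ₀ - log s) ≤ s * (τ₀ + (1 / s - 1)) := by gcongr; linarith
      have h7 : s * (τ₀ + (1 / s - 1)) = s * (τ₀ - 1) + 1 := by field_simp; ring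
      nlinarith
    have h3 : x ^ 2 ≤ (τ₀ + 1) ^ 2 := by gcongr
    rw [upperS]
    linarith
  have h2 : log (upperS τ₀ x s) ≤ 2 * log (τ₀ + 2) := by
    have := log_le_log (L.upperS_pos hs hs1) h1
    rwa [log_pow] at this
  have h3 := L.hlog (τ₀ + 2) (by
    rw [sqrt_le_left (by linarith)]
    nlinarith)
  rw [upperZeta]
  linarith

theorem upperZeta_eq (hs : 0 < s) (hs1 : s ≤ 1) :
    upperZeta τ₀ x s = √(τ₀ - log s) ^ 2 -
      log (√(τ₀ - log s) * (1 + x ^ 2 / (s * √(τ₀ - log s)))) := by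
  have h0 := L.omega_gt hs hs1
  have h1 : 0 ≤ τ₀ - log s := by linarith [tau_le_clock (τ₀ := τ₀) hs hs1, L.tau_ge]
  have e : upperS τ₀ x s = s * (√(τ₀ - log s) * (1 + x ^ 2 / (s * √(τ₀ - log s)))) := by
    rw [upperS]
    field_simp
  rw [upperZeta, e, log_mul hs.ne' (by positivity), sq_sqrt h1]
  ring

theorem upperZeta_le (hs : 0 < s) (hs1 : s ≤ 1) : upperZeta τ₀ x s ≤ √(τ₀ - log s) ^ 2 := by
  rw [L.upperZeta_eq hs hs1]
  have h0 := L.omega_gt hs hs1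
  have : 0 ≤ x ^ 2 / (s * √(τ₀ - log s)) := by positivity
  have := log_nonneg (show 1 ≤ √(τ₀ - log s) * (1 + x ^ 2 / (s * √(τ₀ - log s))) by nlinarith)
  linarith

theorem log_omega_le (hs : 0 < s) (hs1 : s ≤ 1) :
    log √(τ₀ - log s) ≤ √(τ₀ - log s) / 100 :=
  L.hlog _ (sqrt_le_sqrt (tau_le_clock (τ₀ := τ₀) hs hs1))

theorem upperZeta_inner (hs : 0 < s) (hs1 : s ≤ 1) (hx : x ^ 2 ≤ 8 * (s * √(τ₀ - log s))) :
    √(τ₀ - log s) ^ 2 - √(τ₀ - log s) / 50 ≤ upperZeta τ₀ x s := by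
  rw [L.upperZeta_eq hs hs1]
  have h0 := L.omega_gt hs hs1
  have h1 := L.log_omega_le hs hs1
  have h2 : x ^ 2 / (s * √(τ₀ - log s)) ≤ 8 := by rwa [div_le_iff₀ (by positivity)]
  have h3 : 0 ≤ x ^ 2 / (s * √(τ₀ - log s)) := by positivity
  rw [log_mul (by positivity) (by positivity)]
  have h4 := log_le_sub_one_of_pos (show 0 < 1 + x ^ 2 / (s * √(τ₀ - log s)) by positivity)
  linarith

theorem upperZeta_outer (hs : 0 < s) (hs1 : s ≤ 1)
    (hζ : upperZeta τ₀ x s < 9 / 10 * √(τ₀ - log s) ^ 2) : s * √(τ₀ - log s) ^ 15 ≤ x ^ 2 := by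
  rw [L.upperZeta_eq hs hs1] at hζ
  have h0 := L.omega_gt hs hs1
  have h1 := L.log_omega_le hs hs1
  generalize √(τ₀ - log s) = ω at *
  by_contra! h
  have h2 : x ^ 2 / (s * ω) ≤ ω ^ 14 := by
    rw [div_le_iff₀ (by positivity)]
    linarith
  have h3 : 1 ≤ ω ^ 14 := one_le_pow₀ (by linarith)
  have h4 : log (ω * (1 + x ^ 2 / (s * ω))) ≤ log (2 * ω ^ 15) := by
    refine log_le_log (by positivity) ?_
    have : ω * (1 + x ^ 2 / (s * ω)) ≤ ω * (ω ^ 14 + ω ^ 14) := by gcongr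
    linarith
  rw [log_mul (x := 2) (by norm_num) (by positivity), log_pow] at h4
  have h5 := log_le_sub_one_of_pos (show (0 : ℝ) < 2 by norm_num)
  push_cast at h4
  nlinarith

theorem upperP_pos (hs : 0 < s) (hs1 : s ≤ 1) (hx : 0 ≤ x) (hx1 : x ≤ τ₀ + 1) :
    0 < upperP κ τ₀ x s := by
  have h0 := L.omega_gt hs hs1
  have h1 := L.upperZeta_ge hs hs1 hx hx1
  have h2 := L.hκ
  have h3 : 0 < √(τ₀ - log s) - 64 := by linarith
  have h4 : 0 < upperZeta τ₀ x s := by linarith [L.tau_ge]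
  rw [upperP]
  positivity

theorem upperP_mono {y : ℝ} (hs : 0 < s) (hs1 : s ≤ 1) (hy : 0 ≤ y) (hyx : y ≤ x)
    (hx1 : x ≤ τ₀ + 1) : upperP κ τ₀ y s ≤ upperP κ τ₀ x s := by
  have h0 := L.omega_gt hs hs1
  have h1 := L.upperZeta_ge hs hs1 (hy.trans hyx) hx1
  have h2 := L.hκ
  have h3 : 0 < √(τ₀ - log s) - 64 := by linarith
  have h4 : 0 < upperZeta τ₀ x s := by linarith [L.tau_ge]
  have h5 : upperZeta τ₀ x s ≤ upperZeta τ₀ y s := by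
    have := L.upperS_pos (x := y) hs hs1
    rw [upperZeta, upperZeta, upperS, upperS] at *
    gcongr
  rw [upperP, upperP]
  gcongr

theorem upperP_gt (hs : 0 < s) (hs1 : s ≤ 1) (hx : 0 ≤ x) (hx1 : x ≤ τ₀ + 1)
    (hS : 1 ≤ upperS τ₀ x s) : κ / τ₀ < upperP κ τ₀ x s := by
  have h0 := L.omega_gt hs hs1
  have h1 := L.upperZeta_ge hs hs1 hx hx1
  have h2 := L.hκ
  have h3 : 0 < √(τ₀ - log s) - 64 := by linarith
  have hτ := L.tau_ge
  have h4 : 0 < upperZeta τ₀ x s := by linarith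
  have h5 : upperZeta τ₀ x s ≤ τ₀ := by
    rw [upperZeta]
    linarith [log_nonneg hS]
  have h6 : τ₀ ≤ √(τ₀ - log s) ^ 2 := by
    rw [sq_sqrt (by linarith [tau_le_clock (τ₀ := τ₀) hs hs1])]
    exact tau_le_clock (τ₀ := τ₀) hs hs1
  rw [upperP, div_lt_div_iff₀ (by linarith) (by positivity)]
  generalize √(τ₀ - log s) = ω at *
  have h7 : upperZeta τ₀ x s ^ 2 ≤ τ₀ * τ₀ := by nlinarith
  have h8 : (ω - 64) * upperZeta τ₀ x s ^ 2 ≤ (ω - 64) * (ω ^ 2 * τ₀) := by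
    gcongr
    exact h7.trans (by gcongr)
  have h9 : (ω - 64) * (ω ^ 2 * τ₀) < ω * (ω ^ 2 * τ₀) := by
    have : 0 < ω ^ 2 * τ₀ := by positivity
    gcongr
    linarith
  have h10 : 0 < κ := by linarith
  calc κ * ((ω - 64) * upperZeta τ₀ x s ^ 2) < κ * (ω * (ω ^ 2 * τ₀)) :=
        mul_lt_mul_of_pos_left (h8.trans_lt h9) h10
    _ = _ := by ring

end LargeTime

theorem upper_boundary_absurd {κ A X P p s w v : ℝ} (hκ : 0 < κ) (hA : 0 < A) (hX : A ≤ X)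
    (hp : p = κ / A) (hP : p < P) (hs1 : s ≤ 1) (hw : w = X * P) (h4 : w ^ 2 * (2 + A) = 2 * κ * v)
    (hv : v ≤ κ * s + X ^ 2 * P / 2) : False := by
  have hpA : p * A = κ := by rw [hp]; field_simp
  have hp0 : 0 < p := by rw [hp]; positivity
  have hP0 : 0 < P := by linarith
  have hX0 : 0 < X := by linarith
  have h1 : X ^ 2 * P * (P * (2 + A)) ≤ X ^ 2 * P * κ + 2 * κ ^ 2 := by
    have h2 : 2 * κ * v ≤ 2 * κ * (κ * 1 + X ^ 2 * P / 2) := by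
      gcongr
      exact hv.trans (by gcongr)
    calc X ^ 2 * P * (P * (2 + A)) = w ^ 2 * (2 + A) := by rw [hw]; ring
      _ ≤ _ := by rw [h4]; linarith
  have h2 : A ^ 2 * p ≤ X ^ 2 * P := by gcongr
  have h3 : A ^ 2 * p = A * κ := by rw [← hpA]; ring
  have h4 : p * (2 + A) < P * (2 + A) := by gcongr
  have h5 : X ^ 2 * P * (p * (2 + A)) < X ^ 2 * P * (P * (2 + A)) := by gcongr
  have h6 : A ^ 2 * p * (2 * p) ≤ X ^ 2 * P * (2 * p) := by gcongr
  have h7 : A ^ 2 * p * (2 * p) = 2 * κ ^ 2 := by rw [← hpA]; ring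
  have h8 : X ^ 2 * P * (p * (2 + A)) = X ^ 2 * P * (2 * p) + X ^ 2 * P * κ := by
    rw [← hpA]; ring
  linarith

namespace SquareFlow

variable {κ τ₀ T b : ℝ} {V W Z : ℝ → ℝ → ℝ} (H : SquareFlow κ τ₀ T V W Z) (L : LargeTime κ τ₀)
  (hb : b ∈ Ico 0 T) (N : NeckBound κ τ₀ V Z b)
include H L hb N

theorem continuousOn_upperP {η : ℝ} (hη : 0 < η) (hη1 : η ≤ 1) :
    ContinuousOn (fun p : ℝ × ℝ => upperP κ τ₀ (p.1 + η) (V 0 p.2 / κ)) (Icc 0 τ₀ ×ˢ Icc 0 b) := by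
  intro p hp
  have hsub : Icc 0 b ⊆ Ico 0 T := Icc_subset_Ico_right hb.2
  have hs := H.clock_pos L (hsub hp.2)
  have hs1 := H.clock_le_one L hb N hp.2
  have hc : ContinuousWithinAt (fun p : ℝ × ℝ => V 0 p.2 / κ) (Icc 0 τ₀ ×ˢ Icc 0 b) p :=
    ((((continuousOn_slice H.cont_V H.zero_mem).mono hsub).div_const κ).comp continuousOn_snd
      fun q hq => hq.2) p hp
  have hω : ContinuousWithinAt (fun p : ℝ × ℝ => √(τ₀ - log (V 0 p.2 / κ)))
      (Icc 0 τ₀ ×ˢ Icc 0 b) p := (continuousWithinAt_const.sub (hc.log hs.ne')).sqrt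
  have hx : ContinuousWithinAt (fun p : ℝ × ℝ => p.1 + η) (Icc 0 τ₀ ×ˢ Icc 0 b) p := by fun_prop
  have hS : ContinuousWithinAt (fun p : ℝ × ℝ => upperS τ₀ (p.1 + η) (V 0 p.2 / κ))
      (Icc 0 τ₀ ×ˢ Icc 0 b) p := (hc.mul hω).add (hx.pow 2)
  have hζ : ContinuousWithinAt (fun p : ℝ × ℝ => upperZeta τ₀ (p.1 + η) (V 0 p.2 / κ))
      (Icc 0 τ₀ ×ˢ Icc 0 b) p := continuousWithinAt_const.sub (hS.log (L.upperS_pos hs hs1).ne')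
  refine ((hω.pow 3).const_mul κ).div ((hω.sub continuousWithinAt_const).mul (hζ.pow 2)) ?_
  have h1 := L.omega_gt hs hs1
  have h2 := L.upperZeta_ge hs hs1 (x := p.1 + η) (by linarith [hp.1.1]) (by linarith [hp.1.2])
  have h3 : √(τ₀ - log (V 0 p.2 / κ)) - 64 ≠ 0 := by linarith
  have h4 : upperZeta τ₀ (p.1 + η) (V 0 p.2 / κ) ≠ 0 := by linarith [L.tau_ge]
  positivity

theorem upper_barrier_strict {η t₀ : ℝ} (ht₀ : t₀ ∈ Icc 0 b) (hη : 0 < η) (hη1 : η ≤ 1)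
    (h1 : η * (2 * τ₀ + 1) ≤ V 0 b / κ / 50) {x₀ : ℝ} (hx₀ : x₀ ∈ Icc 0 τ₀) :
    W x₀ t₀ - (x₀ + η) * upperP κ τ₀ (x₀ + η) (V 0 t₀ / κ) < 0 := by
  have hκ2 := L.hκ
  have hκ : 0 < κ := by linarith
  have hτ := L.tau_ge
  have hbb : b ∈ Icc 0 b := ⟨hb.1, le_rfl⟩
  have hsub : Icc 0 b ⊆ Ico 0 T := Icc_subset_Ico_right hb.2
  refine neg_of_no_first_contact (K := Icc 0 τ₀) (a := 0) (b := b)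
    (D := fun x t => W x t - (x + η) * upperP κ τ₀ (x + η) (V 0 t / κ)) isCompact_Icc ?_ ?_ ?_ t₀
    ht₀ x₀ hx₀
  · have h4 := H.continuousOn_upperP L hb N hη hη1
    have h5 := H.cont_W.mono (prod_mono (le_refl (Icc 0 τ₀)) hsub)
    fun_prop
  · intro x hx
    simp only [H.W_initial x hx, H.V_initial, div_self hκ.ne']
    have h4 : κ / τ₀ < upperP κ τ₀ (x + η) 1 := by
      refine L.upperP_gt one_pos le_rfl (by linarith [hx.1]) (by linarith [hx.2]) ?_
      have := L.omega_gt one_pos le_rfl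
      rw [upperS]
      linarith [sq_nonneg (x + η)]
    have h5 : x * (κ / τ₀) ≤ x * upperP κ τ₀ (x + η) 1 := by
      have := hx.1
      gcongr
    have h6 : 0 < κ / τ₀ := by positivity
    have h7 : 0 < η * upperP κ τ₀ (x + η) 1 := mul_pos hη (by linarith)
    linarith
  · intro t ht x hx hD0 hDs hDt
    have htI : t ∈ Icc 0 b := ⟨ht.1.le, ht.2⟩
    have htT : t ∈ Ioo 0 T := ⟨ht.1, ht.2.trans_lt hb.2⟩
    have htT' := Ioo_subset_Ico_self htT
    have hs := H.clock_pos L htT'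
    have hs1 := H.clock_le_one L hb N htI
    have hcd := H.hasDerivAt_clock htT hκ
    have hsp := H.speed_bounds L hb N htI
    have hsb : V 0 b / κ ≤ V 0 t / κ := H.clock_antitone L hb N htI hbb ht.2
    have hlow := fun y (hy : y ∈ Icc 0 τ₀) => H.lower_barrier L hb N htI hy
    have hV0 : V 0 t = κ * (V 0 t / κ) := by field_simp
    have hθ0 : 0 ≤ τ₀ - log (V 0 t / κ) := by linarith [LargeTime.tau_le_clock (τ₀ := τ₀) hs hs1]
    rw [← sq_sqrt hθ0] at hsp
    obtain ⟨s, hsd⟩ : ∃ s, s = V 0 t / κ := ⟨_, rfl⟩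
    simp only [← hsd] at hD0 hDt hs hs1 hsb hlow hV0 hsp hθ0
    have hω := L.omega_gt hs hs1
    have hX0 : 0 < x + η := by linarith [hx.1]
    have hX1 : x + η ≤ τ₀ + 1 := by linarith [hx.2]
    have hP0 := L.upperP_pos hs hs1 hX0.le hX1
    have hζ := L.upperZeta_ge hs hs1 hX0.le hX1
    have hS := L.upperS_pos (x := x + η) hs hs1
    have hvlow : κ * s + x ^ 2 * lowerP κ (τ₀ - log s) / 2 ≤ V x t := by
      have h4 : ∀ z ∈ Icc 0 τ₀, HasDerivWithinAt
          (fun z => V z t - z ^ 2 * lowerP κ (τ₀ - log s) / 2)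
          (W z t - z * lowerP κ (τ₀ - log s)) (Icc 0 τ₀) z := fun z hz => by
        refine (H.V_x z hz t htT').sub (HasDerivAt.hasDerivWithinAt ?_)
        refine (((hasDerivAt_pow 2 z).mul_const _).div_const 2).congr_deriv ?_
        push_cast
        ring
      have := le_of_hasDerivWithinAt_nonneg h4 hx fun z hz => by
        linarith [hlow z ⟨hz.1, hz.2.trans hx.2⟩]
      norm_num at this
      linarith
    have hvup : V x t ≤ κ * s + (x + η) ^ 2 * upperP κ τ₀ (x + η) s / 2 := by
      have h4 : ∀ z ∈ Icc 0 τ₀, HasDerivWithinAt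
          (fun z => (z + η) ^ 2 * upperP κ τ₀ (x + η) s / 2 - V z t)
          ((z + η) * upperP κ τ₀ (x + η) s - W z t) (Icc 0 τ₀) z := fun z hz => by
        refine (HasDerivAt.hasDerivWithinAt ?_).fun_sub (H.V_x z hz t htT')
        refine (((((hasDerivAt_id z).add_const η).fun_pow 2).mul_const _).div_const
          2).congr_deriv ?_
        simp only [id]
        push_cast
        ring
      have := le_of_hasDerivWithinAt_nonneg h4 hx fun z hz => by
        have h5 := hDt z ⟨hz.1, hz.2.trans hx.2⟩
        have h6 := L.upperP_mono hs hs1 (y := z + η) (x := x + η) (by linarith [hz.1])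
          (by linarith [hz.2]) hX1
        have h7 := mul_le_mul_of_nonneg_left h6 (show 0 ≤ z + η by linarith [hz.1])
        linarith
      have h8 : 0 ≤ (0 + η) ^ 2 * upperP κ τ₀ (x + η) s / 2 := by positivity
      linarith
    rcases eq_or_lt_of_le hx.1 with rfl | hx0
    · rw [H.W_zero t htT'] at hD0
      have := mul_pos hX0 hP0
      linarith
    rcases eq_or_lt_of_le hx.2 with rfl | hxA
    · have h4 := H.W_right_sq t htT'
      refine upper_boundary_absurd hκ hx0 (by linarith) rfl
        (L.upperP_gt hs hs1 hX0.le hX1 ?_) hs1 (by linarith) h4 hvup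
      rw [upperS]
      have : 0 ≤ s * √(x - log s) := by positivity
      nlinarith
    · obtain ⟨Wt, Wxx, hWt, hWxx, e⟩ := H.W_t x ⟨hx0, hxA⟩ t htT
      have hζ0 : 0 < upperZeta τ₀ (x + η) s := by linarith
      have hsder : HasDerivAt (fun s => upperP κ τ₀ (x + η) s) _ (V 0 t / κ) :=
        hsd ▸ hasDerivAt_upperP_s hs hS.ne' hζ0.ne' (by linarith)
      have hcomp := hsder.comp (h := fun t => V 0 t / κ) t hcd
      have hDt' := deriv_nonneg_of_first_contact ht.1
        (f := fun t => W x t - (x + η) * upperP κ τ₀ (x + η) (V 0 t / κ))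
        (hWt.fun_sub (hcomp.const_mul (x + η))) (by simp only [← hsd]; exact hD0)
        (fun s hs => hDs s hs x hx)
      have hne : ∀ y ∈ Icc 0 τ₀, upperS τ₀ (y + η) s ≠ 0 ∧ upperZeta τ₀ (y + η) s ≠ 0 :=
        fun y hy => ⟨(L.upperS_pos hs hs1).ne', by
          have := L.upperZeta_ge hs hs1 (x := y + η) (by linarith [hy.1]) (by linarith [hy.2])
          linarith⟩
      obtain ⟨h4, h5⟩ := second_deriv_test
        (f := fun y => W y t - (y + η) * upperP κ τ₀ (y + η) s) ⟨hx0, hxA⟩ (fun y hy => by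
          have hyI := Ioo_subset_Icc_self hy
          have h6 := (H.W_x y hyI t htT').hasDerivAt (Icc_mem_nhds hy.1 hy.2)
          have h7 := (hasDerivAt_mul_upperP (κ := κ) (hne y hyI).1 (hne y hyI).2
            (by linarith)).comp_add_const y η
          exact h6.fun_sub h7)
        (hWxx.fun_sub ((hasDerivAt_deriv_mul_upperP (κ := κ) hS.ne' hζ0.ne'
          (by linarith)).comp_add_const x η)) (fun y hy => by rw [hD0]; exact hDt y hy)
      have hZ : Z x t = upperP κ τ₀ (x + η) s * (1 + 4 * (x + η) ^ 2 /
        (upperS τ₀ (x + η) s * upperZeta τ₀ (x + η) s)) := by linarith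
      have hXS : (x + η) ^ 2 ≤ upperS τ₀ (x + η) s := by
        rw [upperS]
        have : 0 ≤ s * √(τ₀ - log s) := by positivity
        linarith
      have key := upper_contact_lt (κ := κ) (ω := √(τ₀ - log s)) (θ := 1 - Z 0 t / κ) (s := s)
        (X := x + η) (S := upperS τ₀ (x + η) s) (ζ := upperZeta τ₀ (x + η) s)
        (P := upperP κ τ₀ (x + η) s) (v := V x t) (ν := 4 * (x + η) ^ 2 /
        (upperS τ₀ (x + η) s * upperZeta τ₀ (x + η) s)) (Wxx := Wxx) hκ2 (L.omega_ge hs hs1)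
        hsp.1 hsp.2 hs hX0 rfl (by linarith) (L.upperZeta_le hs hs1) (L.upperZeta_inner hs hs1)
        (L.upperZeta_outer hs hs1) rfl rfl (by
          rw [sq_sqrt hθ0]
          have h6 : (x + η) ^ 2 ≤ x ^ 2 + η * (2 * τ₀ + 1) := by
            have := mul_le_mul_of_nonneg_left hxA.le hη.le
            have := mul_le_mul_of_nonneg_left hη1 hη.le
            linarith
          have h7 : 0 ≤ lowerP κ (τ₀ - log s) := by
            rw [lowerP]; positivity
          have h8 : lowerP κ (τ₀ - log s) ≤ κ := by
            rw [lowerP]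
            refine div_le_self hκ.le ?_
            linarith
          have h9 := mul_le_mul_of_nonneg_right h6 h7
          have h10 : η * (2 * τ₀ + 1) * lowerP κ (τ₀ - log s) ≤ s / 50 * κ := by
            have : η * (2 * τ₀ + 1) ≤ s / 50 := by linarith
            gcongr
          rw [lowerP] at *
          linarith) hvup (by
          have h6 : 6 * (x + η) ^ 2 / (upperS τ₀ (x + η) s * upperZeta τ₀ (x + η) s)
              ≤ 2 * (x + η) ^ 2 / upperS τ₀ (x + η) s := by
            rw [div_le_div_iff₀ (by positivity) hS]
            have : upperS τ₀ (x + η) s * 3 ≤ upperS τ₀ (x + η) s * upperZeta τ₀ (x + η) s := by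
              gcongr
              linarith
            nlinarith [mul_le_mul_of_nonneg_left this (sq_nonneg (x + η))]
          have h7 : 0 ≤ 4 * (x + η) * upperP κ τ₀ (x + η) s /
            (upperS τ₀ (x + η) s * upperZeta τ₀ (x + η) s) := by positivity
          have h8 := mul_le_mul_of_nonneg_left (show 3 - 2 * (x + η) ^ 2 / upperS τ₀ (x + η) s +
            6 * (x + η) ^ 2 / (upperS τ₀ (x + η) s * upperZeta τ₀ (x + η) s) ≤ 3 by linarith) h7
          refine (sub_nonpos.1 h5).trans (h8.trans (le_of_eq ?_))
          ring)
      have hW : W x t = (x + η) * upperP κ τ₀ (x + η) s := by linarith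
      rw [hZ, hW] at e
      rw [← e] at key
      simp only [← hsd] at hDt'
      linarith

/-- Upper barrier for the slope of the squared radius. -/
theorem upper_barrier {t x : ℝ} (ht : t ∈ Icc 0 b) (hx : x ∈ Icc 0 τ₀) :
    W x t ≤ x * upperP κ τ₀ x (V 0 t / κ) := by
  have hκ : 0 < κ := by linarith [L.hκ]
  have hτ := L.tau_ge
  have htT : t ∈ Ico 0 T := ⟨ht.1, ht.2.trans_lt hb.2⟩
  have hs := H.clock_pos L htT
  have hs1 := H.clock_le_one L hb N ht
  have hζ := L.upperZeta_ge hs hs1 hx.1 (by linarith [hx.2])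
  have h0 : ∀ᶠ η in nhdsWithin (0 : ℝ) (Ioi 0),
      W x t ≤ (η + x) * upperP κ τ₀ (η + x) (V 0 t / κ) := by
    have h1 : ∀ᶠ η in nhdsWithin (0 : ℝ) (Ioi 0), η < 1 :=
      mem_nhdsWithin_of_mem_nhds (Iio_mem_nhds one_pos)
    have h2 : ∀ᶠ η in nhdsWithin (0 : ℝ) (Ioi 0), η * (2 * τ₀ + 1) < V 0 b / κ / 50 := by
      refine mem_nhdsWithin_of_mem_nhds ?_
      have : ContinuousAt (fun η : ℝ => η * (2 * τ₀ + 1)) 0 := by fun_prop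
      refine this.eventually_lt_const ?_
      have := H.clock_pos L hb
      simp only [zero_mul]
      positivity
    filter_upwards [self_mem_nhdsWithin, h1, h2] with η h3 h4 h5
    have := H.upper_barrier_strict L hb N ht h3 h4.le h5.le hx
    rw [add_comm η]
    linarith
  have h1 := (hasDerivAt_mul_upperP (κ := κ) (x := x) (L.upperS_pos hs hs1).ne'
    (show upperZeta τ₀ x (V 0 t / κ) ≠ 0 by linarith)
      (by linarith [L.omega_gt hs hs1])).continuousAt
  have h2 : Tendsto (fun η : ℝ => η + x) (nhdsWithin 0 (Ioi 0)) (nhds x) := by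
    have : Tendsto (fun η : ℝ => η + x) (nhds 0) (nhds (0 + x)) := tendsto_id.add_const x
    rw [zero_add] at this
    exact this.mono_left nhdsWithin_le_nhds
  exact ge_of_tendsto (h1.tendsto.comp h2) h0

end SquareFlow

theorem hasDerivWithinAt_zero_nonneg {A f' : ℝ} {f : ℝ → ℝ} (hA : 0 < A)
    (hf : HasDerivWithinAt f f' (Icc 0 A) 0) (h0 : f 0 = 0) (h : ∀ x ∈ Icc 0 A, 0 ≤ f x) :
    0 ≤ f' := by
  have h1 : HasDerivWithinAt f f' (Ioi 0) 0 := 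
    hf.mono_of_mem_nhdsWithin (Icc_mem_nhdsGT hA)
  rw [hasDerivWithinAt_iff_tendsto_slope' (by simp)] at h1
  refine ge_of_tendsto h1 ?_
  filter_upwards [Ioo_mem_nhdsGT hA] with x hx
  rw [slope_def_field, h0, sub_zero, sub_zero]
  exact div_nonneg (h x ⟨hx.1.le, hx.2.le⟩) hx.1.le

theorem LargeTime.upperP_le {κ τ₀ x s : ℝ} (L : LargeTime κ τ₀) (hs : 0 < s) (hs1 : s ≤ 1)
    (hx : x ^ 2 ≤ 8 * (s * √(τ₀ - log s))) :
    upperP κ τ₀ x s ≤ κ / (√(τ₀ - log s) ^ 2 - 65 * √(τ₀ - log s)) := by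
  have h0 := L.omega_gt hs hs1
  have h1 := L.upperZeta_inner hs hs1 hx
  have hκ : 0 < κ := by linarith [L.hκ]
  rw [upperP]
  generalize upperZeta τ₀ x s = ζ at *
  generalize √(τ₀ - log s) = ω at *
  have h2 : ω * (ω - 1 / 50) ≤ ζ := by linarith
  have h3 : 0 < ω - 65 := by linarith
  have h4 : 0 < ω - 64 := by linarith
  have h5 : 0 < ω - 1 / 50 := by linarith
  have h6 : 0 < ω := by linarith
  have h7 : (ω * (ω - 1 / 50)) ^ 2 ≤ ζ ^ 2 := by gcongr
  have h8 : 0 < ζ := lt_of_lt_of_le (by positivity) h2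
  have e : ω ^ 2 - 65 * ω = ω * (ω - 65) := by ring
  rw [e, div_le_div_iff₀ (by positivity) (by positivity)]
  have h9 : ω ^ 2 * (ω - 65) ≤ (ω - 64) * (ω - 1 / 50) ^ 2 := by nlinarith
  calc κ * ω ^ 3 * (ω * (ω - 65)) = κ * ω ^ 2 * (ω ^ 2 * (ω - 65)) := by ring
    _ ≤ κ * ω ^ 2 * ((ω - 64) * (ω - 1 / 50) ^ 2) := by gcongr
    _ = κ * ((ω - 64) * (ω * (ω - 1 / 50)) ^ 2) := by ring
    _ ≤ _ := by gcongr

namespace SquareFlow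

variable {κ τ₀ T : ℝ} {V W Z : ℝ → ℝ → ℝ} (H : SquareFlow κ τ₀ T V W Z) (L : LargeTime κ τ₀)
include H L

theorem neck_second_deriv_bounds {b t : ℝ} (hb : b ∈ Ico 0 T) (N : NeckBound κ τ₀ V Z b)
    (ht : t ∈ Icc 0 b) :
    lowerP κ (τ₀ - log (V 0 t / κ)) ≤ Z 0 t ∧
      Z 0 t ≤ κ / (√(τ₀ - log (V 0 t / κ)) ^ 2 - 65 * √(τ₀ - log (V 0 t / κ))) := by
  have htT : t ∈ Ico 0 T := ⟨ht.1, ht.2.trans_lt hb.2⟩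
  have hs := H.clock_pos L htT
  have hs1 := H.clock_le_one L hb N ht
  have hW := H.W_x 0 H.zero_mem t htT
  have hW0 := H.W_zero t htT
  have hω := L.omega_gt hs hs1
  constructor
  · have h1 := hasDerivWithinAt_zero_nonneg H.hτ (f := fun x => W x t - x * _)
      (hW.fun_sub (((hasDerivAt_id (0 : ℝ)).mul_const
        (lowerP κ (τ₀ - log (V 0 t / κ)))).hasDerivWithinAt)) (by simp [hW0]) fun x hx => by
        have := H.lower_barrier L hb N ht hx
        linarith
    linarith
  · have h2 := L.upperZeta_ge hs hs1 (x := 0) le_rfl (by linarith [H.hτ])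
    have h1 := hasDerivWithinAt_zero_nonneg H.hτ
      (f := fun x => x * upperP κ τ₀ x (V 0 t / κ) - W x t)
      ((hasDerivAt_mul_upperP (κ := κ) (x := 0) (L.upperS_pos hs hs1).ne'
        (by linarith [H.hτ]) (by linarith)).hasDerivWithinAt.fun_sub hW) (by simp [hW0])
      fun x hx => by
        have := H.upper_barrier L hb N ht hx
        linarith
    have h3 := L.upperP_le hs hs1 (x := 0) (by
      rw [zero_pow two_ne_zero]; positivity)
    norm_num at h1
    linarith

theorem neckBound {b : ℝ} (hb : b ∈ Ico 0 T) : NeckBound κ τ₀ V Z b := by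
  have hκ : 0 < κ := by linarith [L.hκ]
  have hτ := L.tau_ge
  have hsub : Icc 0 b ⊆ Ico 0 T := Icc_subset_Ico_right hb.2
  have key := neg_of_no_first_contact (K := {()}) (a := 0) (b := b)
    (D := fun _ t => max (-Z 0 t) (max (Z 0 t * (τ₀ - log (V 0 t / κ)) - 2 * κ)
      (Z 0 t - κ / 2))) isCompact_singleton ?_ ?_ ?_
  · intro t ht
    have := key t ht () rfl
    simp only [max_lt_iff] at this
    exact ⟨by linarith, by linarith, by linarith⟩
  · have h1 : ContinuousOn (fun p : Unit × ℝ => Z 0 p.2) ({()} ×ˢ Icc 0 b) :=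
      ((continuousOn_slice H.cont_Z H.zero_mem).mono hsub).comp continuousOn_snd fun p hp => hp.2
    have h2 : ContinuousOn (fun p : Unit × ℝ => V 0 p.2) ({()} ×ˢ Icc 0 b) :=
      ((continuousOn_slice H.cont_V H.zero_mem).mono hsub).comp continuousOn_snd fun p hp => hp.2
    have h3 : ContinuousOn (fun p : Unit × ℝ => log (V 0 p.2 / κ)) ({()} ×ˢ Icc 0 b) :=
      (h2.div_const κ).log fun p hp => (H.clock_pos L (hsub hp.2)).ne'
    exact h1.neg.sup (((h1.mul (continuousOn_const.sub h3)).sub continuousOn_const).sup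
      (h1.sub continuousOn_const))
  · intro _ _
    have h0 : (0 : ℝ) ∈ Ico 0 T := ⟨le_rfl, H.hT⟩
    have h1 : Z 0 0 = κ / τ₀ := by
      have h2 := H.W_x 0 H.zero_mem 0 h0
      have h3 : HasDerivWithinAt (fun x => W x 0) (κ / τ₀ * 1) (Icc 0 τ₀) 0 :=
        (((hasDerivAt_id (0 : ℝ)).const_mul (κ / τ₀)).hasDerivWithinAt).congr
          (fun x hx => H.W_initial x hx) (H.W_initial 0 H.zero_mem)
      rw [(uniqueDiffOn_Icc H.hτ 0 H.zero_mem).eq_deriv _ h2 h3, mul_one]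
    have h4 : κ / τ₀ * τ₀ = κ := by field_simp
    have h5 : 0 < κ / τ₀ := by positivity
    have h6 : κ / τ₀ < κ / 2 := by gcongr; linarith
    simp only [h1, H.V_initial, div_self hκ.ne', log_one, sub_zero, h4, max_lt_iff]
    exact ⟨by linarith, by linarith, by linarith⟩
  · intro t ht _ _ h0 hlt hle
    have htT : t ∈ Ico 0 T := hsub (Ioc_subset_Icc_self ht)
    have N : NeckBound κ τ₀ V Z t := fun r hr => by
      have h1 : max (-Z 0 r) (max (Z 0 r * (τ₀ - log (V 0 r / κ)) - 2 * κ)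
          (Z 0 r - κ / 2)) ≤ 0 := by
        rcases eq_or_lt_of_le hr.2 with rfl | h
        · exact h0.le
        · exact (hlt r ⟨hr.1, h⟩ () rfl).le
      simp only [max_le_iff] at h1
      exact ⟨by linarith, by linarith, by linarith⟩
    obtain ⟨h1, h2⟩ := H.neck_second_deriv_bounds L htT N (t := t) ⟨ht.1.le, le_rfl⟩
    have hs := H.clock_pos L htT
    have hs1 := H.clock_le_one L htT N ⟨ht.1.le, le_rfl⟩
    have hω := L.omega_gt hs hs1
    have hθ := LargeTime.tau_le_clock (τ₀ := τ₀) hs hs1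
    have h3 := lowerP_pos hκ (show 0 < τ₀ - log (V 0 t / κ) by linarith)
    have e := sq_sqrt (show 0 ≤ τ₀ - log (V 0 t / κ) by linarith)
    refine absurd h0 (ne_of_lt ?_)
    generalize √(τ₀ - log (V 0 t / κ)) = ω at *
    rw [le_div_iff₀ (by nlinarith)] at h2
    simp only [max_lt_iff]
    rw [← e]
    have h4 : 0 < Z 0 t := by linarith
    refine ⟨by linarith, ?_, ?_⟩ <;> nlinarith [mul_pos h4 (show 0 < ω by linarith)]

end SquareFlow

/-- Expansion of a clock running at speed `1 - z` with `z ~ 1 / (τ₀ - log s)` before extinction. -/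
theorem clock_expansion {s z : ℝ → ℝ} {τ₀ T : ℝ} (hT : 0 < T) (hs : ∀ t ∈ Ico 0 T, 0 < s t)
    (hd : ∀ t ∈ Ioo 0 T, HasDerivAt s (-(1 - z t)) t)
    (h0 : Tendsto s (nhdsWithin T (Iio T)) (nhds 0))
    (hz : Tendsto (fun t => z t * (τ₀ - log (s t))) (nhdsWithin T (Iio T)) (nhds 1)) :
    Tendsto (fun t => (τ₀ - log (s t)) * (s t / (T - t) - 1)) (nhdsWithin T (Iio T))
      (nhds (-1)) := by
  obtain ⟨θ, hθ⟩ : ∃ θ : ℝ → ℝ, ∀ t, θ t = τ₀ - log (s t) := ⟨_, fun _ => rfl⟩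
  simp only [← hθ] at hz ⊢
  have hev : ∀ᶠ t in nhdsWithin T (Iio T), t ∈ Ioo 0 T := Ioo_mem_nhdsLT hT
  have h0' : Tendsto s (nhdsWithin T (Iio T)) (nhdsWithin 0 (Ioi 0)) :=
    tendsto_nhdsWithin_iff.2 ⟨h0, hev.mono fun t ht => hs t (Ioo_subset_Ico_self ht)⟩
  have hθT : Tendsto θ (nhdsWithin T (Iio T)) atTop := by
    have h1 := tendsto_atTop_add_const_left _ τ₀
      (tendsto_neg_atBot_atTop.comp (tendsto_log_nhdsGT_zero.comp h0'))
    refine h1.congr fun t => ?_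
    simp only [Function.comp, hθ]
    ring
  have hinv : Tendsto (fun t => (θ t)⁻¹) (nhdsWithin T (Iio T)) (nhds 0) :=
    tendsto_inv_atTop_zero.comp hθT
  have hpos : ∀ᶠ t in nhdsWithin T (Iio T), 1 < θ t := hθT.eventually_gt_atTop 1
  have hz0 : Tendsto z (nhdsWithin T (Iio T)) (nhds 0) := by
    have h1 := hz.mul hinv
    rw [mul_zero] at h1
    refine h1.congr' ?_
    filter_upwards [hpos] with t ht
    have : θ t ≠ 0 := by linarith
    field_simp
  obtain ⟨k, hk⟩ : ∃ k : ℝ → ℝ, ∀ t, k t = 1 - (1 - z t) * (1 + (θ t)⁻¹ + (θ t)⁻¹ ^ 2) :=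
    ⟨_, fun _ => rfl⟩
  have hk0 : Tendsto (fun t => θ t * k t) (nhdsWithin T (Iio T)) (nhds 0) := by
    have h1 := (hz.mul ((hinv.const_add 1).add (hinv.pow 2))).sub (hinv.const_add 1)
    norm_num at h1
    refine h1.congr' ?_
    filter_upwards [hpos] with t ht
    have : θ t ≠ 0 := by linarith
    simp only [hk]
    field_simp
    ring
  have hG : ∀ t ∈ Ioo 0 T, 0 < θ t →
      HasDerivAt (fun t => s t * (1 + (θ t)⁻¹) + t) (k t) t := fun t ht h => by
    have hst := hs t (Ioo_subset_Ico_self ht)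
    have h1 : HasDerivAt θ (-(-(1 - z t) / s t)) t := by
      rw [funext hθ]
      exact ((hd t ht).log hst.ne').const_sub τ₀
    refine (((hd t ht).fun_mul ((h1.fun_inv h.ne').const_add 1)).add
      (hasDerivAt_id t)).congr_deriv ?_
    rw [hk]
    field_simp
    ring
  have hlim : Tendsto (fun t => s t * (1 + (θ t)⁻¹) + t) (nhdsWithin T (Iio T)) (nhds T) := by
    have h1 := (h0.mul (hinv.const_add 1)).add (tendsto_id.mono_left
      (nhdsWithin_le_nhds (a := T) (s := Iio T)))
    simpa using h1
  have hq : Tendsto (fun t => θ t * (s t * (1 + (θ t)⁻¹) / (T - t) - 1)) (nhdsWithin T (Iio T))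
      (nhds 0) := by
    rw [Metric.tendsto_nhds]
    intro ε hε
    have h1 : ∀ᶠ t in nhdsWithin T (Iio T), |θ t * k t| ≤ ε / 2 := by
      filter_upwards [(Metric.tendsto_nhds.1 hk0) (ε / 2) (by positivity)] with t ht
      rw [dist_zero_right, norm_eq_abs] at ht
      exact ht.le
    have h2 : ∀ᶠ t in nhdsWithin T (Iio T), z t < 1 := hz0.eventually_lt_const one_pos
    obtain ⟨a, ha, hsub⟩ := mem_nhdsLT_iff_exists_Ioo_subset.1
      (inter_mem (inter_mem h1 h2) (inter_mem hpos hev))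
    filter_upwards [Ioo_mem_nhdsLT ha] with t ht
    obtain ⟨⟨-, -⟩, hθt, htT⟩ := hsub ht
    simp only [mem_ofPred_eq] at hθt
    have hIco : ∀ r ∈ Ico t T, r ∈ Ioo a T := fun r hr => ⟨ht.1.trans_le hr.1, hr.2⟩
    have hanti : AntitoneOn s (Ico t T) := by
      refine antitoneOn_of_hasDerivWithinAt_nonpos (convex_Ico t T) (f' := fun t => -(1 - z t))
        (fun r hr => ?_) (fun r hr => ?_) fun r hr => ?_
      · exact (hd r (hsub (hIco r hr)).2.2).continuousAt.continuousWithinAt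
      · exact (hd r (hsub (hIco r (interior_subset hr))).2.2).hasDerivWithinAt
      · have : z r < 1 := (hsub (hIco r (interior_subset hr))).1.2
        linarith
    have hbd : ∀ r ∈ Ico t T, ‖k r‖ ≤ ε / 2 / θ t := fun r hr => by
      have h3 : |θ r * k r| ≤ ε / 2 := (hsub (hIco r hr)).1.1
      have h4 : θ t ≤ θ r := by
        rw [hθ, hθ]
        have := log_le_log (hs r (Ioo_subset_Ico_self (hsub (hIco r hr)).2.2))
          (hanti ⟨le_rfl, ht.2⟩ hr hr.1)
        linarith
      have h5 : 0 < θ r := by linarith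
      rw [abs_mul, abs_of_pos h5] at h3
      rw [norm_eq_abs, le_div_iff₀ (by linarith)]
      calc |k r| * θ t ≤ |k r| * θ r := by gcongr
        _ ≤ _ := by linarith
    have h6 : ∀ r ∈ Ico t T, ‖s r * (1 + (θ r)⁻¹) + r - (s t * (1 + (θ t)⁻¹) + t)‖
        ≤ ε / 2 / θ t * ‖r - t‖ := fun r hr =>
      (convex_Ico t T).norm_image_sub_le_of_norm_hasDerivWithin_le
        (f := fun t => s t * (1 + (θ t)⁻¹) + t) (f' := k)
        (fun r hr => (hG r (hsub (hIco r hr)).2.2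
          (one_pos.trans (hsub (hIco r hr)).2.1)).hasDerivWithinAt) hbd ⟨le_rfl, ht.2⟩ hr
    have h7 : ‖T - (s t * (1 + (θ t)⁻¹) + t)‖ ≤ ε / 2 / θ t * ‖T - t‖ := by
      refine le_of_tendsto_of_tendsto (hlim.sub_const _).norm
        (((tendsto_id.mono_left nhdsWithin_le_nhds).sub_const t).norm.const_mul _) ?_
      filter_upwards [Ioo_mem_nhdsLT ht.2] with r hr using h6 r ⟨hr.1.le, hr.2⟩
    have hr0 : 0 < T - t := by linarith [ht.2]
    have hθ0 : 0 < θ t := by linarith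
    rw [norm_eq_abs, norm_eq_abs, abs_of_pos hr0] at h7
    rw [dist_zero_right, norm_eq_abs]
    have e : θ t * (s t * (1 + (θ t)⁻¹) / (T - t) - 1) =
        -(θ t / (T - t) * (T - (s t * (1 + (θ t)⁻¹) + t))) := by
      field_simp
      ring
    rw [e, abs_neg, abs_mul, abs_of_pos (by positivity)]
    calc θ t / (T - t) * |T - (s t * (1 + (θ t)⁻¹) + t)|
        ≤ θ t / (T - t) * (ε / 2 / θ t * (T - t)) := by gcongr
      _ = ε / 2 := by field_simp
      _ < ε := by linarith
  have h8 := (hq.sub_const 1).div (hinv.const_add 1) (by norm_num)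
  norm_num at h8
  refine h8.congr' ?_
  filter_upwards [hpos, hev] with t ht ht'
  have h9 : 0 < θ t := by linarith
  have h10 : 0 < T - t := by linarith [ht'.2]
  simp only [Pi.div_apply]
  have h11 : θ t + 1 ≠ 0 := by linarith
  field_simp
  ring

namespace SquareFlow

variable {κ τ₀ T : ℝ} {V W Z : ℝ → ℝ → ℝ} (H : SquareFlow κ τ₀ T V W Z) (L : LargeTime κ τ₀)
include H L

theorem clock_antitoneOn : AntitoneOn (fun t => V 0 t / κ) (Ico 0 T) := fun _ ha _ hb hab =>
  H.clock_antitone L hb (H.neckBound L hb) ⟨ha.1, hab⟩ ⟨hb.1, le_rfl⟩ hab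

theorem clock_le_one' {t : ℝ} (ht : t ∈ Ico 0 T) : V 0 t / κ ≤ 1 :=
  H.clock_le_one L ht (H.neckBound L ht) ⟨ht.1, le_rfl⟩

theorem T_lt_three : T < 3 := by
  have hκ : 0 < κ := by linarith [L.hκ]
  suffices h : T ≤ 2 by linarith
  by_contra! h2
  have hb : (2 : ℝ) ∈ Ico 0 T := ⟨by norm_num, h2⟩
  have N := H.neckBound L hb
  have h3 : AntitoneOn (fun t => V 0 t / κ + t / 2) (Icc 0 2) := by
    refine antitoneOn_of_hasDerivWithinAt_nonpos (convex_Icc 0 2)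
      (f' := fun t => -(1 - Z 0 t / κ) + 1 / 2) ?_ (fun t ht => ?_) fun t ht => ?_
    · exact (((continuousOn_slice H.cont_V H.zero_mem).mono
        (Icc_subset_Ico_right h2)).div_const κ).add (by fun_prop)
    · rw [interior_Icc] at ht
      exact ((H.hasDerivAt_clock ⟨ht.1, ht.2.trans h2⟩ hκ).add
        ((hasDerivAt_id t).div_const 2)).hasDerivWithinAt
    · have h1 := (N t (interior_subset ht)).2.2
      have : Z 0 t / κ ≤ 1 / 2 := by rw [div_le_div_iff₀ hκ two_pos]; linarith
      linarith
  have h3 := h3 (a := 0) (b := 2) (by simp) (by simp) two_pos.le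
  have h4 := H.clock_pos L hb
  simp only [H.V_initial, div_self hκ.ne'] at h3
  linarith

theorem tendsto_clock : Tendsto (fun t => V 0 t / κ) (nhdsWithin T (Iio T)) (nhds 0) := by
  have hκ : 0 < κ := by linarith [L.hκ]
  rw [Metric.tendsto_nhds]
  intro ε hε
  obtain ⟨x, hx, t, ht, hlt⟩ := H.maximal (H.T_lt_three L) (ε * κ) (by positivity)
  have N := H.neckBound L ht
  have h1 : V 0 t ≤ V x t := le_of_hasDerivWithinAt_nonneg (fun y hy => H.V_x y hy t ht) hx
    fun y hy => by
      have h2 := H.lower_barrier L ht N (t := t) ⟨ht.1, le_rfl⟩ ⟨hy.1, hy.2.trans hx.2⟩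
      have h3 := lowerP_pos hκ (H.hτ.trans_le (H.tau_le L ht N (t := t) ⟨ht.1, le_rfl⟩))
      have := mul_nonneg hy.1 h3.le
      linarith
  filter_upwards [Ioo_mem_nhdsLT ht.2] with r hr
  have hrT : r ∈ Ico 0 T := ⟨ht.1.trans hr.1.le, hr.2⟩
  rw [dist_zero_right, norm_eq_abs, abs_of_pos (H.clock_pos L hrT)]
  refine (H.clock_antitoneOn L ht hrT hr.1.le).trans_lt ?_
  rw [div_lt_iff₀ hκ]
  linarith

end SquareFlow

theorem abs_sq_sub_le {κ τ σ y M p q v : ℝ} (hτ : 0 < τ) (hy : y ^ 2 ≤ M)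
    (h1 : κ * σ + y ^ 2 * p / 2 ≤ v) (h2 : v ≤ κ * σ + y ^ 2 * q / 2) :
    |v - (κ + κ * (y ^ 2 - 2) / (2 * τ))| ≤
      (|κ * (τ * (σ - 1) + 1)| + M * (|τ * p - κ| + |τ * q - κ|) / 2) / τ := by
  rw [le_div_iff₀ hτ]
  nth_rewrite 2 [← abs_of_pos hτ]
  rw [← abs_mul]
  have e : (v - (κ + κ * (y ^ 2 - 2) / (2 * τ))) * τ = τ * v - κ * τ - κ * (y ^ 2 - 2) / 2 := by
    field_simp
    ring
  have h3 := mul_le_mul_of_nonneg_left h1 hτ.le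
  have h4 := mul_le_mul_of_nonneg_left h2 hτ.le
  have hM : 0 ≤ M := (sq_nonneg y).trans hy
  have h5 : y ^ 2 * |τ * p - κ| ≤ M * |τ * p - κ| := by gcongr
  have h6 : y ^ 2 * |τ * q - κ| ≤ M * |τ * q - κ| := by gcongr
  have h7 := mul_le_mul_of_nonneg_left (neg_abs_le (τ * p - κ)) (sq_nonneg y)
  have h8 := mul_le_mul_of_nonneg_left (le_abs_self (τ * q - κ)) (sq_nonneg y)
  have h9 := neg_abs_le (κ * (τ * (σ - 1) + 1))
  have h10 := le_abs_self (κ * (τ * (σ - 1) + 1))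
  have h11 : 0 ≤ M * |τ * p - κ| := by positivity
  have h12 : 0 ≤ M * |τ * q - κ| := by positivity
  rw [e, abs_le]
  constructor <;> linarith

theorem abs_sub_profile_le {κ τ y M e u : ℝ} (hκ : 2 ≤ κ) (hτ : 0 < τ) (hy : y ^ 2 ≤ M)
    (hM : M + 2 ≤ 2 * τ) (hu : 0 < u) (h : |u ^ 2 - (κ + κ * (y ^ 2 - 2) / (2 * τ))| ≤ e / τ) :
    |u - √κ - √κ / (4 * τ) * (y ^ 2 - 2)| ≤ 2 * (e + κ * (M + 2) ^ 2 / (16 * τ)) / τ := by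
  have hk : √κ ^ 2 = κ := sq_sqrt (by linarith)
  have hk1 : 1 ≤ √κ := by rw [one_le_sqrt]; linarith
  obtain ⟨δ, hδ⟩ : ∃ δ, δ = √κ / (4 * τ) * (y ^ 2 - 2) := ⟨_, rfl⟩
  have hyM : |y ^ 2 - 2| ≤ M + 2 := by
    rw [abs_le]
    constructor <;> linarith [sq_nonneg y]
  have hδ1 : |δ| ≤ √κ / (4 * τ) * (M + 2) := by
    rw [hδ, abs_mul, abs_of_pos (by positivity)]
    gcongr
  have hδ2 : √κ / (4 * τ) * (M + 2) ≤ √κ / 2 := by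
    calc √κ / (4 * τ) * (M + 2) ≤ √κ / (4 * τ) * (2 * τ) := by gcongr
      _ = _ := by field_simp; norm_num
  have hδ3 : δ ^ 2 ≤ κ * (M + 2) ^ 2 / (16 * τ) / τ := by
    rw [← sq_abs]
    calc |δ| ^ 2 ≤ (√κ / (4 * τ) * (M + 2)) ^ 2 := by gcongr
      _ = √κ ^ 2 * (M + 2) ^ 2 / (16 * τ) / τ := by field_simp; ring
      _ = _ := by rw [hk]
  have hδ4 := neg_abs_le δ
  have e1 : u ^ 2 - (κ + κ * (y ^ 2 - 2) / (2 * τ)) = (u - √κ - δ) * (u + √κ + δ) + δ ^ 2 := by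
    have : κ * (y ^ 2 - 2) / (2 * τ) = 2 * √κ * δ := by
      rw [hδ, ← hk]
      simp only [hk]
      field_simp
      rw [hk]
      ring
    rw [this]
    linear_combination hk
  rw [e1] at h
  have h5 : |(u - √κ - δ) * (u + √κ + δ)| ≤ e / τ + δ ^ 2 := by
    have h6 := abs_add_le ((u - √κ - δ) * (u + √κ + δ) + δ ^ 2) (-δ ^ 2)
    rw [abs_neg, abs_of_nonneg (sq_nonneg δ)] at h6
    have e2 : (u - √κ - δ) * (u + √κ + δ) + δ ^ 2 + -δ ^ 2 = (u - √κ - δ) * (u + √κ + δ) := by ring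
    rw [e2] at h6
    linarith
  rw [abs_mul, abs_of_pos (show 0 < u + √κ + δ by linarith)] at h5
  have h7 : |u - √κ - δ| * (1 / 2) ≤ |u - √κ - δ| * (u + √κ + δ) := by
    gcongr
    linarith
  have e3 : 2 * (e + κ * (M + 2) ^ 2 / (16 * τ)) / τ =
      2 * (e / τ + κ * (M + 2) ^ 2 / (16 * τ) / τ) := by ring
  rw [← hδ, e3]
  linarith

theorem tendsto_div_add_sqrt (c : ℝ) :
    Tendsto (fun θ : ℝ => θ / (θ + c * √θ)) atTop (nhds 1) := by
  have h1 : Tendsto (fun θ : ℝ => (√θ)⁻¹) atTop (nhds 0) :=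
    tendsto_inv_atTop_zero.comp tendsto_sqrt_atTop
  have h2 := ((h1.const_mul c).const_add 1).inv₀ (by norm_num)
  norm_num at h2
  refine h2.congr' ?_
  filter_upwards [eventually_gt_atTop 0] with θ hθ
  have h3 := sqrt_pos.2 hθ
  nth_rewrite 2 3 [← sq_sqrt hθ.le]
  have e : √θ ^ 2 + c * √θ = √θ ^ 2 * (1 + c * (√θ)⁻¹) := by field_simp
  rw [e, ← div_div, div_self (by positivity), one_div]

namespace SquareFlow

variable {κ τ₀ T : ℝ} {V W Z : ℝ → ℝ → ℝ} (H : SquareFlow κ τ₀ T V W Z) (L : LargeTime κ τ₀)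
include H L

theorem space_bounds {t x : ℝ} (ht : t ∈ Ico 0 T) (hx : x ∈ Icc 0 τ₀)
    (hxs : x ^ 2 ≤ 8 * (V 0 t / κ * √(τ₀ - log (V 0 t / κ)))) :
    κ * (V 0 t / κ) + x ^ 2 * lowerP κ (τ₀ - log (V 0 t / κ)) / 2 ≤ V x t ∧
      V x t ≤ κ * (V 0 t / κ) + x ^ 2 *
        (κ / (√(τ₀ - log (V 0 t / κ)) ^ 2 - 65 * √(τ₀ - log (V 0 t / κ)))) / 2 := by
  have hκ : 0 < κ := by linarith [L.hκ]
  have hs := H.clock_pos L ht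
  have hs1 := H.clock_le_one' L ht
  have N := H.neckBound L ht
  have htt : t ∈ Icc 0 t := ⟨ht.1, le_rfl⟩
  have hV0 : V 0 t = κ * (V 0 t / κ) := by field_simp
  generalize hPl : lowerP κ (τ₀ - log (V 0 t / κ)) = p
  generalize hPu : κ / (√(τ₀ - log (V 0 t / κ)) ^ 2 - 65 * √(τ₀ - log (V 0 t / κ))) = q
  have hd : ∀ (c : ℝ), ∀ z ∈ Icc 0 τ₀, HasDerivWithinAt (fun z => z ^ 2 * c / 2) (z * c)
      (Icc 0 τ₀) z := fun c z _ => by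
    refine (((hasDerivAt_pow 2 z).mul_const c).div_const 2).hasDerivWithinAt.congr_deriv ?_
    push_cast
    ring
  have h1 := le_of_hasDerivWithinAt_nonneg (f := fun z => V z t - z ^ 2 * p / 2)
    (fun z hz => (H.V_x z hz t ht).sub (hd p z hz)) hx fun z hz => by
      have := H.lower_barrier L ht N htt ⟨hz.1, hz.2.trans hx.2⟩
      rw [hPl] at this
      linarith
  have h2 := le_of_hasDerivWithinAt_nonneg (f := fun z => z ^ 2 * q / 2 - V z t)
    (fun z hz => (hd q z hz).sub (H.V_x z hz t ht)) hx fun z hz => by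
      have h3 := H.upper_barrier L ht N htt ⟨hz.1, hz.2.trans hx.2⟩
      have h4 := L.upperP_mono hs hs1 hz.1 hz.2 (by linarith [hx.2])
      have h5 := L.upperP_le hs hs1 hxs
      rw [hPu] at h5
      have h6 := mul_le_mul_of_nonneg_left (h4.trans h5) hz.1
      linarith
  norm_num at h1 h2
  rw [← hV0]
  constructor <;> linarith

theorem tendsto_theta :
    Tendsto (fun t => τ₀ - log (V 0 t / κ)) (nhdsWithin T (Iio T)) atTop := by
  have h0' : Tendsto (fun t => V 0 t / κ) (nhdsWithin T (Iio T)) (nhdsWithin 0 (Ioi 0)) :=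
    tendsto_nhdsWithin_iff.2 ⟨H.tendsto_clock L, by
      filter_upwards [Ioo_mem_nhdsLT H.hT] with t ht using H.clock_pos L (Ioo_subset_Ico_self ht)⟩
  refine (tendsto_atTop_add_const_left _ τ₀
    (tendsto_neg_atBot_atTop.comp (tendsto_log_nhdsGT_zero.comp h0'))).congr fun t => ?_
  simp only [Function.comp]
  ring

theorem tendsto_mul_lowerP : Tendsto (fun t => (τ₀ - log (V 0 t / κ)) *
    lowerP κ (τ₀ - log (V 0 t / κ))) (nhdsWithin T (Iio T)) (nhds κ) := by
  have h := ((tendsto_div_add_sqrt 64).comp (H.tendsto_theta L)).const_mul κ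
  rw [mul_one] at h
  refine h.congr fun t => ?_
  simp only [Function.comp, lowerP]
  ring

theorem tendsto_mul_upper : Tendsto (fun t => (τ₀ - log (V 0 t / κ)) *
    (κ / (√(τ₀ - log (V 0 t / κ)) ^ 2 - 65 * √(τ₀ - log (V 0 t / κ)))))
    (nhdsWithin T (Iio T)) (nhds κ) := by
  have h := ((tendsto_div_add_sqrt (-65)).comp (H.tendsto_theta L)).const_mul κ
  rw [mul_one] at h
  refine h.congr' ?_
  filter_upwards [(H.tendsto_theta L).eventually_ge_atTop 0] with t ht
  simp only [Function.comp]
  rw [sq_sqrt ht]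
  ring

theorem tendsto_clock_expansion : Tendsto (fun t => (τ₀ - log (V 0 t / κ)) *
    (V 0 t / κ / (T - t) - 1)) (nhdsWithin T (Iio T)) (nhds (-1)) := by
  have hκ : 0 < κ := by linarith [L.hκ]
  refine clock_expansion H.hT (fun t ht => H.clock_pos L ht) (z := fun t => Z 0 t / κ)
    (fun t ht => H.hasDerivAt_clock ht hκ) (H.tendsto_clock L) ?_
  have h1 := (H.tendsto_mul_lowerP L).div_const κ
  have h2 := (H.tendsto_mul_upper L).div_const κ
  rw [div_self hκ.ne'] at h1 h2
  refine tendsto_of_tendsto_of_tendsto_of_le_of_le' h1 h2 ?_ ?_ <;>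
  filter_upwards [Ioo_mem_nhdsLT H.hT, (H.tendsto_theta L).eventually_ge_atTop 0] with t ht hθ <;>
  have htT := Ioo_subset_Ico_self ht <;>
  obtain ⟨h3, h4⟩ := H.neck_second_deriv_bounds L htT (H.neckBound L htT) (t := t)
    ⟨ht.1.le, le_rfl⟩ <;>
  rw [div_mul_eq_mul_div, mul_comm (Z 0 t)] <;>
  gcongr

theorem tendsto_clock_ratio :
    Tendsto (fun t => V 0 t / κ / (T - t)) (nhdsWithin T (Iio T)) (nhds 1) := by
  have h1 := ((H.tendsto_clock_expansion L).mul
    (tendsto_inv_atTop_zero.comp (H.tendsto_theta L))).const_add 1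
  norm_num at h1
  refine h1.congr' ?_
  filter_upwards [(H.tendsto_theta L).eventually_gt_atTop 0] with t ht
  rw [mul_right_comm, mul_inv_cancel₀ ht.ne']
  ring

theorem tendsto_time_ratio : Tendsto (fun t => -log (T - t) / (τ₀ - log (V 0 t / κ)))
    (nhdsWithin T (Iio T)) (nhds 1) := by
  have h1 := ((H.tendsto_clock_ratio L).log one_ne_zero).sub_const τ₀
  have h2 := (h1.mul (tendsto_inv_atTop_zero.comp (H.tendsto_theta L))).const_add 1
  norm_num at h2
  refine h2.congr' ?_
  filter_upwards [(H.tendsto_theta L).eventually_gt_atTop 0, Ioo_mem_nhdsLT H.hT] with t ht htT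
  rw [log_div (H.clock_pos L (Ioo_subset_Ico_self htT)).ne' (by linarith [htT.2])]
  field_simp
  ring

omit H L in
theorem tendsto_sub_exp (T : ℝ) :
    Tendsto (fun τ : ℝ => T - exp (-τ)) atTop (nhdsWithin T (Iio T)) := by
  refine tendsto_nhdsWithin_iff.2 ⟨?_, Eventually.of_forall fun τ => ?_⟩
  · simpa using (tendsto_exp_neg_atTop_nhds_zero).const_sub T
  · simp [exp_pos]

end SquareFlow

/-- The rescaled radius converges to the nondegenerate neckpinch profile. -/
theorem SquareFlow.tendsto_profile {κ τ₀ T : ℝ} {U W Z : ℝ → ℝ → ℝ}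
    (H : SquareFlow κ τ₀ T (fun x t => U x t ^ 2) W Z) (L : LargeTime κ τ₀)
    (hU : ∀ x ∈ Icc 0 τ₀, ∀ t ∈ Ico 0 T, 0 < U x t) {R : ℝ} (hR : 0 < R) :
    Tendsto (fun τ : ℝ => τ * ⨆ y : Icc (-R) R,
      |exp (τ / 2) * U |exp (-τ / 2) * (y : ℝ)| (T - exp (-τ)) - √κ
        - √κ / (4 * τ) * ((y : ℝ) ^ 2 - 2)|) atTop (nhds 0) := by
  have hκ : 0 < κ := by linarith [L.hκ]
  obtain ⟨s, hs⟩ : ∃ s : ℝ → ℝ, ∀ t, s t = U 0 t ^ 2 / κ := ⟨_, fun _ => rfl⟩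
  obtain ⟨θ, hθ⟩ : ∃ θ : ℝ → ℝ, ∀ t, θ t = τ₀ - log (s t) := ⟨_, fun _ => rfl⟩
  have hθT := H.tendsto_theta L
  have hlow := H.tendsto_mul_lowerP L
  have hupp := H.tendsto_mul_upper L
  have hexp := H.tendsto_clock_expansion L
  have hrat := H.tendsto_clock_ratio L
  have htime := H.tendsto_time_ratio L
  have hsp := fun x t => H.space_bounds L (x := x) (t := t)
  simp only [← hs, ← hθ] at hθT hlow hupp hexp hrat htime hsp
  have scale : ∀ {f : ℝ → ℝ} {c : ℝ},
      Tendsto (fun t => θ t * f t) (nhdsWithin T (Iio T)) (nhds c) →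
      Tendsto (fun τ => τ * f (T - exp (-τ))) atTop (nhds c) := fun {f c} hf => by
    have h1 := (hf.mul htime).comp (tendsto_sub_exp T)
    rw [mul_one] at h1
    refine h1.congr' ?_
    filter_upwards [(hθT.comp (tendsto_sub_exp T)).eventually_gt_atTop 0] with τ h2
    simp only [Function.comp, sub_sub_cancel, log_exp, neg_neg] at h2 ⊢
    field_simp
  obtain ⟨e, he⟩ : ∃ e : ℝ → ℝ, ∀ τ, e τ =
      |κ * (τ * (s (T - exp (-τ)) / exp (-τ) - 1) + 1)| +
      R ^ 2 * (|τ * lowerP κ (θ (T - exp (-τ))) - κ| +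
        |τ * (κ / (√(θ (T - exp (-τ))) ^ 2 - 65 * √(θ (T - exp (-τ))))) - κ|) / 2 :=
    ⟨_, fun _ => rfl⟩
  have he0 : Tendsto e atTop (nhds 0) := by
    have h1 := (((scale hexp).add_const 1).const_mul κ).abs
    have h2 := ((scale hlow).sub_const κ).abs
    have h3 := ((scale hupp).sub_const κ).abs
    have h4 := h1.add (((h2.add h3).const_mul (R ^ 2)).div_const 2)
    simp only [sub_sub_cancel] at h4
    norm_num at h4
    exact h4.congr fun τ => by rw [he, abs_mul κ]
  have hlim : Tendsto (fun τ => 2 * (e τ + κ * (R ^ 2 + 2) ^ 2 / (16 * τ))) atTop (nhds 0) := by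
    have h1 : Tendsto (fun τ : ℝ => κ * (R ^ 2 + 2) ^ 2 / (16 * τ)) atTop (nhds 0) :=
      tendsto_const_nhds.div_atTop (tendsto_id.const_mul_atTop (by norm_num))
    have h2 := (he0.add h1).const_mul 2
    norm_num at h2
    exact h2
  refine squeeze_zero' ?_ ?_ hlim
  · filter_upwards [eventually_ge_atTop 0] with τ hτ
    exact mul_nonneg hτ (iSup_nonneg fun _ => abs_nonneg _)
  have hT : ∀ᶠ τ in atTop, T - exp (-τ) ∈ Ioo 0 T :=
    (tendsto_sub_exp T).eventually (Ioo_mem_nhdsLT H.hT)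
  have hω : ∀ᶠ τ in atTop, R ^ 2 ≤ 4 * √(θ (T - exp (-τ))) :=
    ((tendsto_sqrt_atTop.comp (hθT.comp (tendsto_sub_exp T))).const_mul_atTop
      (show (0 : ℝ) < 4 by norm_num)).eventually_ge_atTop _
  have hsr : ∀ᶠ τ in atTop, 1 / 2 < s (T - exp (-τ)) / exp (-τ) := by
    have := (hrat.comp (tendsto_sub_exp T)).eventually_const_lt (show (1 / 2 : ℝ) < 1 by norm_num)
    simpa only [Function.comp, sub_sub_cancel] using this
  have hR0 : ∀ᶠ τ in atTop, exp (-τ / 2) * R ≤ τ₀ := by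
    have h1 : Tendsto (fun τ : ℝ => exp (-τ / 2) * R) atTop (nhds (0 * R)) := by
      refine (tendsto_exp_atBot.comp ?_).mul_const R
      exact tendsto_neg_atTop_atBot.atBot_div_const two_pos
    rw [zero_mul] at h1
    exact h1.eventually_le_const H.hτ
  filter_upwards [hT, hω, hsr, hR0, eventually_gt_atTop 0, eventually_ge_atTop ((R ^ 2 + 2) / 2)]
    with τ hT hω hsr hR0 hτ hτR
  have : Nonempty (Icc (-R) R) := ⟨⟨0, by linarith, hR.le⟩⟩
  rw [mul_comm, ← le_div_iff₀ hτ]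
  refine ciSup_le fun y => ?_
  obtain ⟨y, hy⟩ := y
  have hr : 0 < exp (-τ) := exp_pos _
  have hyR : |y| ≤ R := abs_le.2 hy
  have hy2 : y ^ 2 ≤ R ^ 2 := by rw [← sq_abs]; gcongr
  have ha : |exp (-τ / 2) * y| = exp (-τ / 2) * |y| := by rw [abs_mul, abs_of_pos (exp_pos _)]
  have hx : exp (-τ / 2) * |y| ∈ Icc 0 τ₀ :=
    ⟨by positivity, le_trans (by gcongr) hR0⟩
  have hee : exp (-τ / 2) ^ 2 = exp (-τ) := by rw [← exp_nat_mul]; congr 1; push_cast; ring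
  have hee' : exp (τ / 2) ^ 2 * exp (-τ) = 1 := by
    rw [← exp_nat_mul, ← exp_add]; simp; ring
  have hx2 : (exp (-τ / 2) * |y|) ^ 2 = exp (-τ) * y ^ 2 := by rw [mul_pow, hee, sq_abs]
  have htT := Ioo_subset_Ico_self hT
  rw [lt_div_iff₀ hr] at hsr
  obtain ⟨h1, h2⟩ := hsp (exp (-τ / 2) * |y|) (T - exp (-τ)) htT hx (by
    rw [hx2]
    calc exp (-τ) * y ^ 2 ≤ exp (-τ) * (4 * √(θ (T - exp (-τ)))) := by gcongr; linarith
      _ = 8 * (1 / 2 * exp (-τ) * √(θ (T - exp (-τ)))) := by ring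
      _ ≤ _ := by gcongr)
  rw [hx2] at h1 h2
  simp only [ha]
  refine abs_sub_profile_le L.hκ hτ hy2 (by linarith)
    (mul_pos (exp_pos _) (hU _ hx _ htT)) ?_
  rw [he]
  have hsE : s (T - exp (-τ)) / exp (-τ) = exp (τ / 2) ^ 2 * s (T - exp (-τ)) := by
    rw [div_eq_iff hr.ne']
    linear_combination -s (T - exp (-τ)) * hee'
  have h3 := mul_le_mul_of_nonneg_left h1 (sq_nonneg (exp (τ / 2)))
  have h4 := mul_le_mul_of_nonneg_left h2 (sq_nonneg (exp (τ / 2)))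
  refine abs_sq_sub_le hτ hy2 ?_ ?_
  · rw [mul_pow, hsE]
    refine le_trans (le_of_eq ?_) h3
    linear_combination (-(y ^ 2 * lowerP κ (θ (T - exp (-τ))) / 2)) * hee'
  · rw [mul_pow, hsE]
    refine h4.trans (le_of_eq ?_)
    linear_combination (y ^ 2 *
      (κ / (√(θ (T - exp (-τ))) ^ 2 - 65 * √(θ (T - exp (-τ))))) / 2) * hee'

/-- Differentiability of an even (`σ = 1`) or odd (`σ = -1`) extension. -/
theorem hasDerivAt_reflect {A σ x : ℝ} {f f' F F' : ℝ → ℝ}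
    (hf : ∀ x ∈ Icc 0 A, HasDerivWithinAt f (f' x) (Icc 0 A) x)
    (hF : ∀ x, 0 ≤ x → F x = f x) (hFn : ∀ x, x ≤ 0 → F x = σ * f (-x))
    (hF' : ∀ x, 0 ≤ x → F' x = f' x) (hFn' : ∀ x, x ≤ 0 → F' x = -σ * f' (-x))
    (hx : x ∈ Ioo (-A) A) : HasDerivAt F (F' x) x := by
  have hA : 0 < A := by linarith [hx.1, hx.2]
  have hr : ∀ x ∈ Icc 0 A, HasDerivWithinAt F (F' x) (Icc 0 A) x := fun x hx => by
    rw [hF' x hx.1]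
    exact (hf x hx).congr (fun y hy => hF y hy.1) (hF x hx.1)
  have hl : ∀ x ∈ Icc (-A) 0, HasDerivWithinAt F (F' x) (Icc (-A) 0) x := fun x hx => by
    have hm : MapsTo (fun x : ℝ => -x) (Icc (-A) 0) (Icc 0 A) := fun y hy =>
      ⟨by linarith [hy.2], by linarith [hy.1]⟩
    have h1 := ((hf (-x) (hm hx)).scomp x (hasDerivAt_neg x).hasDerivWithinAt hm).const_mul σ
    refine (h1.congr (fun y hy => hFn y hy.2) (hFn x hx.2)).congr_deriv ?_
    rw [hFn' x hx.2, smul_eq_mul]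
    ring
  rcases lt_trichotomy x 0 with h | rfl | h
  · exact (hl x ⟨hx.1.le, h.le⟩).hasDerivAt (Icc_mem_nhds hx.1 h)
  · refine ((hl 0 ⟨hx.1.le, le_rfl⟩).union (hr 0 ⟨le_rfl, hA.le⟩)).hasDerivAt ?_
    rw [Icc_union_Icc_eq_Icc (by linarith) hA.le]
    exact Icc_mem_nhds hx.1 hx.2
  · exact (hr x ⟨h.le, hx.2.le⟩).hasDerivAt (Icc_mem_nhds h hx.2)

/-- There exists a positive rotationally symmetric solution
`U : (−a,a) × [0,T) → ℝ` of the mean curvature flow equation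
`∂ₜU = ∂ₓ²U/(1+(∂ₓU)²) − (n−1)/U`, with continuous partial derivatives, that develops a
nondegenerate neckpinch at time `T`: its type I rescaling
`u(y,τ) = e^{τ/2} U(e^{−τ/2} y, T − e^{−τ})` satisfies, for every `L > 0`,
`u(y,τ) = √(2(n−1)) + (√(2(n−1))/(4τ))(y² − 2) + o(τ^{−1})` uniformly on `|y| ≤ L`
as `τ → ∞`. -/
theorem exists_nondegenerate_neckpinch_profile (n : ℕ) (hn : 2 ≤ n) :
    ∃ (a T : ℝ) (U Ut Ux Uxx : ℝ → ℝ → ℝ),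
      0 < a ∧ 0 < T ∧
      (∀ x ∈ Ioo (-a) a, ∀ t ∈ Ico (0 : ℝ) T, 0 < U x t) ∧
      (∀ x ∈ Ioo (-a) a, ∀ t ∈ Ico (0 : ℝ) T, HasDerivAt (fun s => U x s) (Ut x t) t) ∧
      (∀ x ∈ Ioo (-a) a, ∀ t ∈ Ico (0 : ℝ) T, HasDerivAt (fun z => U z t) (Ux x t) x) ∧
      (∀ x ∈ Ioo (-a) a, ∀ t ∈ Ico (0 : ℝ) T, HasDerivAt (fun z => Ux z t) (Uxx x t) x) ∧
      ContinuousOn (fun p : ℝ × ℝ => (Ut p.1 p.2, Ux p.1 p.2, Uxx p.1 p.2))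
        (Ioo (-a) a ×ˢ Ico (0 : ℝ) T) ∧
      (∀ x ∈ Ioo (-a) a, ∀ t ∈ Ico (0 : ℝ) T,
        Ut x t = Uxx x t / (1 + (Ux x t) ^ 2) - ((n : ℝ) - 1) / U x t) ∧
      (∀ L > (0 : ℝ),
        Tendsto (fun τ : ℝ =>
            τ * ⨆ y : Icc (-L) L,
              |exp (τ / 2) * U (exp (-τ / 2) * (y : ℝ)) (T - exp (-τ))
                - Real.sqrt (2 * ((n : ℝ) - 1))
                - Real.sqrt (2 * ((n : ℝ) - 1)) / (4 * τ) * ((y : ℝ) ^ 2 - 2)|)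
          atTop (nhds 0)) := by
  have hn' : (2 : ℝ) ≤ n := by exact_mod_cast hn
  obtain ⟨m, hm⟩ : ∃ m : ℝ, m = n - 1 := ⟨_, rfl⟩
  rw [← hm]
  have hm1 : 1 ≤ m := by linarith
  obtain ⟨A, L⟩ := exists_largeTime (show 2 ≤ 2 * m by linarith)
  have hA : 0 < A := by linarith [L.tau_ge]
  obtain ⟨T, c, w₀, U, w, g, γ, P, S⟩ := exists_pinchingFlow_squareFlow (by linarith) hA (m := m)
  have hT := P.hT
  have hab : ∀ {x : ℝ}, x ∈ Ioo (-A) A → |x| ∈ Icc 0 A := fun hx =>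
    ⟨abs_nonneg _, (abs_lt.2 hx).le⟩
  have hxp : ∀ {x : ℝ}, x ∈ Ioo (-A) A → max x 0 ∈ Icc 0 A := fun hx =>
    ⟨le_max_right _ _, max_le hx.2.le hA.le⟩
  have hxn : ∀ {x : ℝ}, x ∈ Ioo (-A) A → max (-x) 0 ∈ Icc 0 A := fun hx =>
    ⟨le_max_right _ _, max_le (by linarith [hx.1]) hA.le⟩
  have hsh : ∀ {t : ℝ}, t ∈ Ico 0 (T / 2) → t + T / 2 ∈ Ioo 0 T := fun ht =>
    ⟨by linarith [ht.1], by linarith [ht.2]⟩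
  have hsh' : ∀ {t : ℝ}, t ∈ Ico 0 (T / 2) → t + T / 2 ∈ Ico 0 T := fun ht =>
    Ioo_subset_Ico_self (hsh ht)
  have hwp : ∀ t ∈ Ico 0 (T / 2), ∀ x, 0 ≤ x →
      w (max x 0) (t + T / 2) - w (max (-x) 0) (t + T / 2) = w x (t + T / 2) := fun t ht x hx => by
    rw [max_eq_left hx, max_eq_right (by linarith), P.w_zero _ (hsh' ht), sub_zero]
  have hwn : ∀ t ∈ Ico 0 (T / 2), ∀ x, x ≤ 0 →
      w (max x 0) (t + T / 2) - w (max (-x) 0) (t + T / 2) = -1 * w (-x) (t + T / 2) :=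
    fun t ht x hx => by
      rw [max_eq_right hx, max_eq_left (by linarith), P.w_zero _ (hsh' ht)]
      ring
  refine ⟨A, T / 2, fun x t => U |x| (t + T / 2), fun x t => g |x| (t + T / 2),
    fun x t => w (max x 0) (t + T / 2) - w (max (-x) 0) (t + T / 2),
    fun x t => (1 + w |x| (t + T / 2) ^ 2) * (g |x| (t + T / 2) + m / U |x| (t + T / 2)),
    hA, by positivity, fun x hx t ht => P.U_pos _ (hab hx) _ (hsh' ht),
    fun x hx t ht => (P.U_t _ (hab hx) _ (hsh ht)).comp_add_const t (T / 2), ?_, ?_, ?_, ?_, ?_⟩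
  · intro x hx t ht
    exact hasDerivAt_reflect (σ := 1) (f := fun x => U x (t + T / 2))
      (F := fun x => U |x| (t + T / 2))
      (F' := fun x => w (max x 0) (t + T / 2) - w (max (-x) 0) (t + T / 2))
      (fun x hx => P.U_x x hx _ (hsh' ht))
      (fun x hx => by rw [abs_of_nonneg hx]) (fun x hx => by rw [abs_of_nonpos hx, one_mul])
      (hwp t ht) (hwn t ht) hx
  · intro x hx t ht
    exact hasDerivAt_reflect (σ := -1) (f := fun x => w x (t + T / 2))
      (F' := fun x => (1 + w |x| (t + T / 2) ^ 2) * (g |x| (t + T / 2) + m / U |x| (t + T / 2)))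
      (fun x hx => P.w_x x hx _ (hsh' ht)) (hwp t ht) (hwn t ht)
      (fun x hx => by rw [abs_of_nonneg hx])
      (fun x hx => by rw [abs_of_nonpos hx, neg_neg, one_mul])
      hx
  · have hc : ∀ {φ : ℝ → ℝ} {f : ℝ → ℝ → ℝ}, Continuous φ →
        (∀ {x}, x ∈ Ioo (-A) A → φ x ∈ Icc 0 A) →
        ContinuousOn (fun p : ℝ × ℝ => f p.1 p.2) (Icc 0 A ×ˢ Ico 0 T) →
        ContinuousOn (fun p : ℝ × ℝ => f (φ p.1) (p.2 + T / 2))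
          (Ioo (-A) A ×ˢ Ico 0 (T / 2)) := fun {φ f} hφ hm hf =>
      hf.comp (f := fun p : ℝ × ℝ => (φ p.1, p.2 + T / 2)) (by fun_prop)
        fun p hp => ⟨hm hp.1, hsh' hp.2⟩
    have hg := hc continuous_abs hab P.cont_g
    have hw := hc continuous_abs hab P.cont_w
    have hU := hc continuous_abs hab P.cont_U
    exact hg.prodMk (((hc (by fun_prop) hxp P.cont_w).sub (hc (by fun_prop) hxn P.cont_w)).prodMk
      ((continuousOn_const.add (hw.pow 2)).mul (hg.add (continuousOn_const.div hU
        fun p hp => (P.U_pos _ (hab hp.1) _ (hsh' hp.2)).ne'))))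
  · intro x hx t ht
    have h1 : (w (max x 0) (t + T / 2) - w (max (-x) 0) (t + T / 2)) ^ 2 =
        w |x| (t + T / 2) ^ 2 := by
      rcases le_total 0 x with h | h
      · rw [hwp t ht x h, abs_of_nonneg h]
      · rw [hwn t ht x h, abs_of_nonpos h]
        ring
    simp only [h1]
    rw [mul_div_cancel_left₀ _ (by positivity)]
    ring
  · intro R hR
    refine (S.tendsto_profile L P.U_pos hR).congr fun τ => ?_
    beta_reduce
    rw [show T / 2 - exp (-τ) + T / 2 = T - exp (-τ) by ring]
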